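/- Let $S$ be a real-analytic function on a neighborhood of the origin in $\mathbf{R}^n$, not identically zero, with $S(0)=0$ and $\nabla S(0)=0$, and let $g=\min(a_0, l_1-\alpha_1,\dots,l_m-\alpha_m)$. Then there is a neighborhood $V$ of the origin in $\mathbf{R}^n$ such that whenever $K$ is supported in $V$ and satisfies the kernel bounds, the operator $T$ is bounded from $L^p(\mathbf{R}^{n+1})$ to $L^p_{\beta}(\mathbf{R}^{n+1})$ for every pair $(1/p,\beta)$ in the set $B=\{(x,y)\in A : y<g\}$, where $A$ is the open triangle in the plane with vertices $(1/2, 1/\max(o(S),2))$, $(0,0)$, and $(1,0)$. -/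

import Mathlib

open MeasureTheory Real Filter Topology Set
open scoped ENNReal

noncomputable section

namespace Paper

variable {n m : ℕ}

/-- The monomial `t ^ α`. -/
def monomial (α : Fin n → ℕ) (t : Fin n → ℝ) : ℝ := ∏ i, t i ^ α i

/-- `S` is real-analytic near the origin with Taylor coefficient family `c`:
its Taylor series at the origin converges to it near `0`. -/
def HasTaylorSeriesAtOrigin (S : (Fin n → ℝ) → ℝ) (c : (Fin n → ℕ) → ℝ) : Prop :=
  ∀ᶠ t in 𝓝 (0 : Fin n → ℝ), HasSum (fun α => c α * monomial α t) (S t)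

/-- The Newton polyhedron of the Taylor coefficient family `c`: the convex hull of
the octants above the exponents of the nonzero coefficients. -/
def newtonPolyhedron (c : (Fin n → ℕ) → ℝ) : Set (Fin n → ℝ) :=
  convexHull ℝ {x : Fin n → ℝ | ∃ α : Fin n → ℕ, c α ≠ 0 ∧ ∀ i, (α i : ℝ) ≤ x i}

/-- The vertices (extreme points) of the Newton polyhedron. -/
def newtonVertices (c : (Fin n → ℕ) → ℝ) : Set (Fin n → ℝ) :=
  Set.extremePoints ℝ (newtonPolyhedron c)

/-- `f^*`, the sum of the absolute values of the vertex monomials. -/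
def starFn (c : (Fin n → ℕ) → ℝ) (t : Fin n → ℝ) : ℝ :=
  ∑' v : newtonVertices c, ∏ i, |t i| ^ ((v : Fin n → ℝ) i)

/-- Compact (exposed) faces of the Newton polyhedron; a vertex is a face of dimension zero. -/
def IsCompactFace (c : (Fin n → ℕ) → ℝ) (F : Set (Fin n → ℝ)) : Prop :=
  IsExposed ℝ (newtonPolyhedron c) F ∧ F.Nonempty ∧ IsCompact F

/-- The face polynomial `f_F(t) = ∑_{α ∈ F} f_α t^α`. -/
def facePoly (c : (Fin n → ℕ) → ℝ) (F : Set (Fin n → ℝ)) (t : Fin n → ℝ) : ℝ :=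
  ∑' α : {α : Fin n → ℕ // (fun i => (α i : ℝ)) ∈ F}, c α.1 * monomial α.1 t

/-- The order of vanishing of `g` at `x`. -/
def vanishingOrder (g : (Fin n → ℝ) → ℝ) (x : Fin n → ℝ) : ℕ∞ :=
  sSup {k : ℕ∞ | ∀ j : ℕ, (j : ℕ∞) < k → iteratedFDeriv ℝ j g x = 0}

/-- `o(f)`: the maximum order of a zero of a compact face polynomial on `(ℝ ∖ {0})^n`
(`0` if there are no such zeroes). -/
def newtonOrder (c : (Fin n → ℕ) → ℝ) : ℕ∞ :=
  sSup {k : ℕ∞ | ∃ F : Set (Fin n → ℝ), IsCompactFace c F ∧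
    ∃ x : Fin n → ℝ, (∀ i, x i ≠ 0) ∧ facePoly c F x = 0 ∧
      k ≤ vanishingOrder (facePoly c F) x}

/-- The Euclidean norm `|t_k|` of the `k`-th group of variables. -/
def grpNorm (grp : Fin n → Fin m) (k : Fin m) (t : Fin n → ℝ) : ℝ :=
  Real.sqrt (∑ i ∈ Finset.univ.filter (fun i => grp i = k), t i ^ 2)

/-- The weight `∏_k |t_k|^{-α_k}`. -/
def kernelWeight (grp : Fin n → Fin m) (a : Fin m → ℝ) (t : Fin n → ℝ) : ℝ :=
  ∏ k, grpNorm grp k t ^ (-(a k))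

/-- The measure `dμ = ∏_k |t_k|^{-α_k} dm`, `m` being Lebesgue measure. -/
def fracMeasure (grp : Fin n → Fin m) (a : Fin m → ℝ) : Measure (Fin n → ℝ) :=
  volume.withDensity fun t => ENNReal.ofReal (kernelWeight grp a t)

/-- The characterization (1.5) of the sublevel growth exponents `a₀`, `d₀`. -/
def IsSublevelExponent (grp : Fin n → Fin m) (a : Fin m → ℝ) (c : (Fin n → ℕ) → ℝ)
    (a₀ : ℝ) (d₀ : ℕ) : Prop :=
  0 < a₀ ∧ d₀ ≤ n - 1 ∧ ∃ r₀ > (0 : ℝ), ∀ r : ℝ, 0 < r → r < r₀ →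
    ∃ b B : ℝ, 0 < b ∧ 0 < B ∧ ∀ ε : ℝ, 0 < ε → ε < 1/2 →
      ENNReal.ofReal (b * ε ^ a₀ * |Real.log ε| ^ d₀) <
          fracMeasure grp a {t | (∀ i, t i ∈ Set.Ioo 0 r) ∧ starFn c t < ε} ∧
        fracMeasure grp a {t | (∀ i, t i ∈ Set.Ioo 0 r) ∧ starFn c t < ε} <
          ENNReal.ofReal (B * ε ^ a₀ * |Real.log ε| ^ d₀)

/-- The kernel bounds (1.2a)-(1.2b): `K` is `C¹` off the coordinate hyperplanes,
`|K(t)| ≤ C ∏_k |t_k|^{-α_k}` and `|∂_{t_i} K(t)| ≤ C |t_i|⁻¹ ∏_k |t_k|^{-α_k}`. -/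
def KernelBounds (grp : Fin n → Fin m) (a : Fin m → ℝ) (K : (Fin n → ℝ) → ℝ) : Prop :=
  ContDiffOn ℝ 1 K {t | ∀ i, t i ≠ 0} ∧
  ∃ C : ℝ, ∀ t : Fin n → ℝ, (∀ i, t i ≠ 0) →
    |K t| ≤ C * kernelWeight grp a t ∧
    ∀ i : Fin n, |fderiv ℝ K t (Pi.single i 1)| ≤ C / |t i| * kernelWeight grp a t

/-- The averaging operator (1.1),
`Tf(x, x_{n+1}) = ∫ f(x - t, x_{n+1} - S(t)) K(t) dt`. -/
def radonOp (S K : (Fin n → ℝ) → ℝ) (f : (Fin (n+1) → ℝ) → ℂ) :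
    (Fin (n+1) → ℝ) → ℂ :=
  fun x => ∫ t : Fin n → ℝ, (K t : ℂ) * f (fun j => x j - Fin.snoc (α := fun _ => ℝ) t (S t) j)

/-- The Fourier transform on `ℝ^N`. -/
def fourierTransform {N : ℕ} (g : (Fin N → ℝ) → ℂ) (ξ : Fin N → ℝ) : ℂ :=
  ∫ x : Fin N → ℝ,
    Complex.exp (-2 * (Real.pi : ℂ) * Complex.I * ((∑ i, x i * ξ i : ℝ) : ℂ)) * g x

/-- The inverse Fourier transform on `ℝ^N`. -/
def fourierInv {N : ℕ} (g : (Fin N → ℝ) → ℂ) (x : Fin N → ℝ) : ℂ :=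
  ∫ ξ : Fin N → ℝ,
    Complex.exp (2 * (Real.pi : ℂ) * Complex.I * ((∑ i, x i * ξ i : ℝ) : ℂ)) * g ξ

/-- The Bessel potential `(I - Δ)^{β/2} g`, defined via the Fourier transform. -/
def besselPotential {N : ℕ} (β : ℝ) (g : (Fin N → ℝ) → ℂ) : (Fin N → ℝ) → ℂ :=
  fun x => fourierInv
    (fun ξ => (((1 + ∑ i, ξ i ^ 2) ^ (β / 2) : ℝ) : ℂ) * fourierTransform g ξ) x

/-- `T` is bounded from `L^p(ℝ^N)` to the `L^p` Sobolev space `L^p_β(ℝ^N)`,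
whose norm is `‖(I - Δ)^{β/2} f‖_{L^p}`. -/
def BddLpSobolev {N : ℕ} (p β : ℝ)
    (T : ((Fin N → ℝ) → ℂ) → ((Fin N → ℝ) → ℂ)) : Prop :=
  ∃ C : ℝ, 0 ≤ C ∧ ∀ f : SchwartzMap (Fin N → ℝ) ℂ,
    eLpNorm (besselPotential β (T ⇑f)) (ENNReal.ofReal p) volume ≤
      ENNReal.ofReal C * eLpNorm (⇑f) (ENNReal.ofReal p) volume

/-- `min(|t₁|,...,|tₙ|, S^*(t))`. -/
def minFactor (c : (Fin n → ℕ) → ℝ) (t : Fin n → ℝ) : ℝ :=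
  min (⨅ i, |t i|) (starFn c t)

/-- The analytic family (3.1):
`T_z f(x) = e^{z²} ∫ (min(|t₁|,...,|tₙ|,S^*(t)))^z f(x - t, x_{n+1} - S(t)) K(t) dt`. -/
def radonOpZ (S K : (Fin n → ℝ) → ℝ) (c : (Fin n → ℕ) → ℝ) (z : ℂ)
    (f : (Fin (n+1) → ℝ) → ℂ) : (Fin (n+1) → ℝ) → ℂ :=
  fun x => Complex.exp (z ^ 2) *
    ∫ t : Fin n → ℝ,
      ((minFactor c t : ℂ) ^ z) * (K t : ℂ) * f (fun j => x j - Fin.snoc (α := fun _ => ℝ) t (S t) j)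

/-- The Fourier transform (3.8) of the convolution kernel `ν_z` of `T_z`. -/
def nuHatZ (S K : (Fin n → ℝ) → ℝ) (c : (Fin n → ℕ) → ℝ) (z : ℂ)
    (lam : Fin (n+1) → ℝ) : ℂ :=
  Complex.exp (z ^ 2) *
    ∫ t : Fin n → ℝ,
      Complex.exp (Complex.I *
          (((∑ i, lam i.castSucc * t i) + lam (Fin.last n) * S t : ℝ) : ℂ)) *
        ((minFactor c t : ℂ) ^ z) * (K t : ℂ)


set_option linter.all false

section


/-! ### van der Corput -/

theorem vdc_base {a b : ℝ} (hab : a ≤ b) {p0 p1 p2 : ℝ → ℝ}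
    (h0 : ∀ s ∈ Icc a b, HasDerivAt p0 (p1 s) s)
    (h1 : ∀ s ∈ Icc a b, HasDerivAt p1 (p2 s) s)
    (h2 : ContinuousOn p2 (Icc a b))
    (hne : ∀ s ∈ Icc a b, p1 s ≠ 0) :
    ‖∫ s in a..b, Complex.exp (Complex.I * (p0 s : ℂ))‖ ≤
      1 / |p1 a| + 1 / |p1 b| + ∫ s in a..b, |p2 s| / (p1 s) ^ 2 := by
  have hu : uIcc a b = Icc a b := uIcc_of_le hab
  have c0 : ContinuousOn p0 (Icc a b) := fun s hs => (h0 s hs).continuousAt.continuousWithinAt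
  have c1 : ContinuousOn p1 (Icc a b) := fun s hs => (h1 s hs).continuousAt.continuousWithinAt
  have ce : ContinuousOn (fun s => Complex.exp (Complex.I * (p0 s : ℂ))) (Icc a b) := by
    fun_prop
  have c1' : ContinuousOn (fun s => (Complex.I * (p1 s : ℂ))) (Icc a b) := by fun_prop
  have hne' : ∀ s ∈ Icc a b, Complex.I * (p1 s : ℂ) ≠ 0 := fun s hs =>
    mul_ne_zero Complex.I_ne_zero (by exact_mod_cast hne s hs)
  have cR : ContinuousOn (fun s => Complex.exp (Complex.I * (p0 s : ℂ)) *
      (Complex.I * (p2 s : ℂ)) / (Complex.I * (p1 s : ℂ)) ^ 2) (Icc a b) := by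
    refine ContinuousOn.div ?_ (c1'.pow 2) (fun s hs => pow_ne_zero 2 (hne' s hs))
    exact ce.mul (by fun_prop)
  have hd : ∀ s ∈ uIcc a b, HasDerivAt
      (fun s => Complex.exp (Complex.I * (p0 s : ℂ)) / (Complex.I * (p1 s : ℂ)))
      (Complex.exp (Complex.I * (p0 s : ℂ)) - Complex.exp (Complex.I * (p0 s : ℂ)) *
      (Complex.I * (p2 s : ℂ)) / (Complex.I * (p1 s : ℂ)) ^ 2) s := by
    intro s hs
    rw [hu] at hs
    have e0 := ((h0 s hs).ofReal_comp.const_mul Complex.I).cexp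
    have e1 := ((h1 s hs).ofReal_comp.const_mul Complex.I)
    have := e0.div e1 (hne' s hs)
    refine this.congr_deriv ?_
    have h3 := hne' s hs
    rw [sub_div]
    congr 1
    rw [mul_assoc, pow_two, mul_div_assoc, div_self (mul_ne_zero h3 h3), mul_one]
  have hintegr := intervalIntegral.integral_eq_sub_of_hasDerivAt hd
    (ContinuousOn.intervalIntegrable (by rw [hu]; exact ce.sub cR))
  rw [intervalIntegral.integral_sub (ContinuousOn.intervalIntegrable (by rwa [hu]))
    (ContinuousOn.intervalIntegrable (by rwa [hu]))] at hintegr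
  rw [sub_eq_iff_eq_add.1 hintegr]
  have hex : ∀ x : ℝ, ‖Complex.exp (Complex.I * (x : ℂ))‖ = 1 := by
    intro x; rw [mul_comm]; exact Complex.norm_exp_ofReal_mul_I x
  have hint2 : ‖∫ s in a..b, Complex.exp (Complex.I * (p0 s : ℂ)) *
      (Complex.I * (p2 s : ℂ)) / (Complex.I * (p1 s : ℂ)) ^ 2‖ ≤
      ∫ s in a..b, |p2 s| / (p1 s) ^ 2 := by
    refine (intervalIntegral.norm_integral_le_integral_norm hab).trans (le_of_eq ?_)
    congr 1
    ext s
    rw [norm_div, norm_mul, hex, norm_pow, norm_mul, norm_mul]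
    simp
  refine (norm_add_le _ _).trans (add_le_add ((norm_sub_le _ _).trans ?_) hint2)
  rw [norm_div, norm_div, hex, hex, norm_mul, norm_mul]
  simp only [Complex.norm_I, one_mul, Complex.norm_real, Real.norm_eq_abs]
  rw [add_comm]

theorem vdc_one {a b : ℝ} (hab : a ≤ b) {p0 p1 p2 : ℝ → ℝ}
    (h0 : ∀ s ∈ Icc a b, HasDerivAt p0 (p1 s) s)
    (h1 : ∀ s ∈ Icc a b, HasDerivAt p1 (p2 s) s)
    (h2 : ContinuousOn p2 (Icc a b)) (L : ℝ) (hL : 0 < L)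
    (hne : ∀ s ∈ Icc a b, L ≤ |p1 s|) (hpos : ∀ s ∈ Icc a b, 0 ≤ p2 s) :
    ‖∫ s in a..b, Complex.exp (Complex.I * (p0 s : ℂ))‖ ≤ 4 / L := by
  have hne0 : ∀ s ∈ Icc a b, p1 s ≠ 0 := fun s hs h => by
    have := hne s hs; rw [h, abs_zero] at this; linarith
  have hb := vdc_base hab h0 h1 h2 hne0
  have hu : uIcc a b = Icc a b := uIcc_of_le hab
  have c1 : ContinuousOn p1 (Icc a b) := fun s hs => (h1 s hs).continuousAt.continuousWithinAt
  have hI : ∫ s in a..b, |p2 s| / (p1 s) ^ 2 = (- (p1 b)⁻¹) - (- (p1 a)⁻¹) := by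
    have e : ∫ s in a..b, |p2 s| / (p1 s) ^ 2 = ∫ s in a..b, p2 s / (p1 s) ^ 2 := by
      apply intervalIntegral.integral_congr
      intro s hs
      rw [hu] at hs
      simp only [abs_of_nonneg (hpos s hs)]
    rw [e]
    refine intervalIntegral.integral_eq_sub_of_hasDerivAt (f := fun s => - (p1 s)⁻¹) ?_ ?_
    · intro s hs
      rw [hu] at hs
      have := ((h1 s hs).inv (hne0 s hs)).neg
      refine this.congr_deriv ?_
      ring
    · apply ContinuousOn.intervalIntegrable
      rw [hu]
      exact h2.div (c1.pow 2) (fun s hs => pow_ne_zero 2 (hne0 s hs))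
  have ha' := hne a (left_mem_Icc.2 hab)
  have hb' := hne b (right_mem_Icc.2 hab)
  have i1 : 1 / |p1 a| ≤ 1 / L := one_div_le_one_div_of_le hL ha'
  have i2 : 1 / |p1 b| ≤ 1 / L := one_div_le_one_div_of_le hL hb'
  have i3 : - (p1 b)⁻¹ ≤ 1 / |p1 b| := by
    rw [one_div, ← abs_inv]; exact neg_le_abs _
  have i4 : (p1 a)⁻¹ ≤ 1 / |p1 a| := by
    rw [one_div, ← abs_inv]; exact le_abs_self _
  rw [hI] at hb
  have : 4 / L = 4 * (1 / L) := by ring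
  linarith

theorem vdc_neg (p : ℝ → ℝ) (a b : ℝ) :
    ‖∫ s in a..b, Complex.exp (Complex.I * ((- p s : ℝ) : ℂ))‖ =
    ‖∫ s in a..b, Complex.exp (Complex.I * (p s : ℂ))‖ := by
  have : (∫ s in a..b, Complex.exp (Complex.I * ((- p s : ℝ) : ℂ))) =
      (starRingEnd ℂ) (∫ s in a..b, Complex.exp (Complex.I * (p s : ℂ))) := by
    rw [intervalIntegral, intervalIntegral, map_sub, ← integral_conj, ← integral_conj]
    simp only [← Complex.exp_conj, map_mul, Complex.conj_I, Complex.conj_ofReal]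
    simp
  rw [this, RCLike.norm_conj]

theorem vdc_split {f g : ℝ → ℝ} {a b L : ℝ} (hab : a ≤ b)
    (h : ∀ s ∈ Icc a b, HasDerivAt f (g s) s) (hg : ∀ s ∈ Icc a b, L ≤ g s) :
    ∃ s0 ∈ Icc a b, (∀ s ∈ Icc a b, s0 < s → L * (s - s0) ≤ f s) ∧
      (∀ s ∈ Icc a b, s < s0 → f s ≤ - (L * (s0 - s))) := by
  have c : ContinuousOn f (Icc a b) := fun s hs => (h s hs).continuousAt.continuousWithinAt
  have grow : ∀ x ∈ Icc a b, ∀ y ∈ Icc a b, x ≤ y → L * (y - x) ≤ f y - f x := by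
    apply Convex.mul_sub_le_image_sub_of_le_deriv (convex_Icc a b) c
    · intro s hs
      exact (h s (interior_subset hs)).differentiableAt.differentiableWithinAt
    · intro s hs
      rw [(h s (interior_subset hs)).deriv]
      exact hg s (interior_subset hs)
  have ma : a ∈ Icc a b := left_mem_Icc.2 hab
  have mb : b ∈ Icc a b := right_mem_Icc.2 hab
  by_cases h1 : 0 ≤ f a
  · refine ⟨a, ma, fun s hs h' => ?_, fun s hs h' => ?_⟩
    · have := grow a ma s hs h'.le; linarith
    · exact absurd hs.1 (not_le.2 h')
  by_cases h2 : f b ≤ 0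
  · refine ⟨b, mb, fun s hs h' => ?_, fun s hs h' => ?_⟩
    · exact absurd hs.2 (not_le.2 h')
    · have := grow s hs b mb h'.le; linarith
  push Not at h1 h2
  obtain ⟨s0, hs0, hz⟩ := intermediate_value_Icc hab c (show (0:ℝ) ∈ Icc (f a) (f b) from ⟨h1.le, h2.le⟩)
  refine ⟨s0, hs0, fun s hs h' => ?_, fun s hs h' => ?_⟩
  · have := grow s0 hs0 s hs h'.le; linarith
  · have := grow s hs s0 hs0 h'.le; linarith

theorem vdc_norm_le (p : ℝ → ℝ) {a b : ℝ} (hab : a ≤ b) :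
    ‖∫ s in a..b, Complex.exp (Complex.I * (p s : ℂ))‖ ≤ b - a := by
  have := intervalIntegral.norm_integral_le_of_norm_le_const (a := a) (b := b) (C := 1)
    (f := fun s => Complex.exp (Complex.I * (p s : ℂ))) (by
      intro x _; rw [mul_comm]; exact (Complex.norm_exp_ofReal_mul_I _).le)
  rwa [one_mul, abs_of_nonneg (by linarith)] at this

/-- the induction step of van der Corput, abstractly -/
theorem vdc_step {p : ℝ → ℝ} {f g : ℝ → ℝ} {a b L d E : ℝ} (hab : a ≤ b) (hL : 0 < L) (hd : 0 < d)
    (hp : ContinuousOn p (Icc a b)) (hE : 0 ≤ E)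
    (h : ∀ s ∈ Icc a b, HasDerivAt f (g s) s) (hg : ∀ s ∈ Icc a b, L ≤ g s)
    (hpos : ∀ x y, a ≤ x → x ≤ y → y ≤ b → (∀ s ∈ Icc x y, L * d ≤ f s) →
      ‖∫ s in x..y, Complex.exp (Complex.I * (p s : ℂ))‖ ≤ E)
    (hneg : ∀ x y, a ≤ x → x ≤ y → y ≤ b → (∀ s ∈ Icc x y, f s ≤ - (L * d)) →
      ‖∫ s in x..y, Complex.exp (Complex.I * (p s : ℂ))‖ ≤ E) :
    ‖∫ s in a..b, Complex.exp (Complex.I * (p s : ℂ))‖ ≤ 2 * E + 2 * d := by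
  obtain ⟨s0, hs0, h1, h2⟩ := vdc_split hab h hg
  set x := max a (s0 - d) with hx
  set y := min b (s0 + d) with hy
  have hax : a ≤ x := le_max_left _ _
  have hyb : y ≤ b := min_le_left _ _
  have hxs : x ≤ s0 := max_le hs0.1 (by linarith)
  have hsy : s0 ≤ y := le_min hs0.2 (by linarith)
  have hxb : x ≤ b := hxs.trans hs0.2
  have hay : a ≤ y := hs0.1.trans hsy
  have I1 : ∀ u v, a ≤ u → u ≤ v → v ≤ b →
      IntervalIntegrable (fun s => Complex.exp (Complex.I * (p s : ℂ))) volume u v := by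
    intro u v h1 h2 h3
    apply ContinuousOn.intervalIntegrable
    rw [uIcc_of_le h2]
    have := hp.mono (Icc_subset_Icc h1 h3)
    fun_prop
  have e1 := intervalIntegral.integral_add_adjacent_intervals (I1 a x le_rfl hax hxb)
    (I1 x y hax (hxs.trans hsy) hyb)
  have e2 := intervalIntegral.integral_add_adjacent_intervals (I1 a y le_rfl hay hyb)
    (I1 y b hay hyb le_rfl)
  rw [← e2, ← e1]
  have b1 : ‖∫ s in a..x, Complex.exp (Complex.I * (p s : ℂ))‖ ≤ E := by
    rcases le_or_gt (s0 - d) a with hc | hc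
    · have : x = a := max_eq_left hc
      rw [this]; simpa using hE
    · have : x = s0 - d := max_eq_right hc.le
      refine hneg a x le_rfl hax hxb fun s hs => ?_
      have := h2 s ⟨hs.1, hs.2.trans hxb⟩ (by have := hs.2; linarith)
      have h3 : L * d ≤ L * (s0 - s) := by
        apply mul_le_mul_of_nonneg_left _ hL.le
        have := hs.2; linarith
      linarith
  have b3 : ‖∫ s in y..b, Complex.exp (Complex.I * (p s : ℂ))‖ ≤ E := by
    rcases le_or_gt b (s0 + d) with hc | hc
    · have : y = b := min_eq_left hc
      rw [this]; simpa using hE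
    · have : y = s0 + d := min_eq_right hc.le
      refine hpos y b hay hyb le_rfl fun s hs => ?_
      have := h1 s ⟨hay.trans hs.1, hs.2⟩ (by have := hs.1; linarith)
      have h3 : L * d ≤ L * (s - s0) := by
        apply mul_le_mul_of_nonneg_left _ hL.le
        have := hs.1; linarith
      linarith
  have b2 := vdc_norm_le p (hxs.trans hsy)
  have b2' : y - x ≤ 2 * d := by
    have := min_le_right b (s0 + d); have := le_max_right a (s0 - d); linarith
  calc _ ≤ _ := norm_add₃_le
    _ ≤ _ := by linarith

theorem vdc_pow (L : ℝ) (hL : 0 < L) (k : ℕ) (hk : 1 ≤ k) :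
    (L * L ^ (-(1:ℝ) / ((k:ℝ) + 1))) ^ (-(1:ℝ) / k) = L ^ (-(1:ℝ) / ((k:ℝ) + 1)) := by
  have hk' : (k:ℝ) ≠ 0 := by positivity
  have hk1 : (k:ℝ) + 1 ≠ 0 := by positivity
  have e : L * L ^ (-(1:ℝ) / ((k:ℝ) + 1)) = L ^ (1 + -(1:ℝ) / ((k:ℝ) + 1)) := by
    rw [Real.rpow_add hL, Real.rpow_one]
  rw [e, ← Real.rpow_mul hL.le]
  congr 1
  field_simp
  ring

/-- van der Corput's lemma for `k ≥ 2`. -/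
theorem vdc (k : ℕ) (hk : 2 ≤ k) : ∃ C : ℝ, 0 ≤ C ∧ ∀ (a b : ℝ) (p : ℕ → ℝ → ℝ) (L : ℝ), a ≤ b → 0 < L →
    (∀ i, ∀ s ∈ Icc a b, HasDerivAt (p i) (p (i+1) s) s) →
    ((∀ s ∈ Icc a b, L ≤ p k s) ∨ (∀ s ∈ Icc a b, p k s ≤ - L)) →
    ‖∫ s in a..b, Complex.exp (Complex.I * (p 0 s : ℂ))‖ ≤ C * L ^ (-(1:ℝ) / k) := by
  -- reduce to the positive case
  suffices H : ∃ C : ℝ, 0 ≤ C ∧ ∀ (a b : ℝ) (p : ℕ → ℝ → ℝ) (L : ℝ), a ≤ b → 0 < L →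
    (∀ i, ∀ s ∈ Icc a b, HasDerivAt (p i) (p (i+1) s) s) →
    (∀ s ∈ Icc a b, L ≤ p k s) →
    ‖∫ s in a..b, Complex.exp (Complex.I * (p 0 s : ℂ))‖ ≤ C * L ^ (-(1:ℝ) / k) by
    obtain ⟨C, hC, H⟩ := H
    refine ⟨C, hC, fun a b p L hab hL hd hor => ?_⟩
    rcases hor with h | h
    · exact H a b p L hab hL hd h
    · have := H a b (fun i s => - p i s) L hab hL (fun i s hs => (hd i s hs).neg)
        (fun s hs => by have := h s hs; linarith)
      rwa [vdc_neg] at this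
  induction k, hk using Nat.le_induction with
  | base =>
    refine ⟨10, by norm_num, fun a b p L hab hL hd hp => ?_⟩
    have hc : ∀ i, ContinuousOn (p i) (Icc a b) := fun i s hs =>
      (hd i s hs).continuousAt.continuousWithinAt
    set d := L ^ (-(1:ℝ) / 2) with hdd
    have hdpos : 0 < d := Real.rpow_pos_of_pos hL _
    have hLd : 4 / (L * d) = 4 * d := by
      have e := vdc_pow L hL 1 le_rfl
      norm_num at e
      rw [Real.rpow_neg_one] at e
      have e' : (L * d)⁻¹ = d := by rw [hdd, neg_div]; exact e
      rw [div_eq_mul_inv, e']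
    have := vdc_step hab hL hdpos (hc 0) (E := 4 / (L * d)) (by positivity) (hd 1) hp ?_ ?_
    · rw [hLd] at this
      push_cast
      linarith
    · intro x y hx hxy hy hs
      have sub : Icc x y ⊆ Icc a b := Icc_subset_Icc hx hy
      exact vdc_one hxy (fun s h => hd 0 s (sub h)) (fun s h => hd 1 s (sub h)) ((hc 2).mono sub) _
        (by positivity) (fun s h => (hs s h).trans (le_abs_self _)) (fun s h => hL.le.trans (hp s (sub h)))
    · intro x y hx hxy hy hs
      have sub : Icc x y ⊆ Icc a b := Icc_subset_Icc hx hy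
      exact vdc_one hxy (fun s h => hd 0 s (sub h)) (fun s h => hd 1 s (sub h)) ((hc 2).mono sub) _
        (by positivity) (fun s h => (by have := hs s h; have := neg_le_abs (p 1 s); linarith))
        (fun s h => hL.le.trans (hp s (sub h)))
  | succ k hk ih =>
    obtain ⟨C, hC, H⟩ := ih
    refine ⟨2 * C + 2, by positivity, fun a b p L hab hL hd hp => ?_⟩
    have hc : ∀ i, ContinuousOn (p i) (Icc a b) := fun i s hs =>
      (hd i s hs).continuousAt.continuousWithinAt
    set d := L ^ (-(1:ℝ) / ((k:ℝ)+1)) with hdd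
    have hdpos : 0 < d := Real.rpow_pos_of_pos hL _
    have e := vdc_pow L hL k (by omega)
    rw [← hdd] at e
    have := vdc_step hab hL hdpos (hc 0) (E := C * d) (by positivity) (hd k) hp ?_ ?_
    · push_cast
      rw [← hdd]
      linarith
    · intro x y hx hxy hy hs
      have sub : Icc x y ⊆ Icc a b := Icc_subset_Icc hx hy
      have := H x y p (L * d) hxy (by positivity) (fun i s h => hd i s (sub h)) hs
      rwa [e] at this
    · intro x y hx hxy hy hs
      have sub : Icc x y ⊆ Icc a b := Icc_subset_Icc hx hy
      have := H x y (fun i s => - p i s) (L * d) hxy (by positivity)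
        (fun i s h => (hd i s (sub h)).neg) (fun s h => by have := hs s h; linarith)
      rwa [e, vdc_neg] at this

/-- Adding an amplitude. -/
theorem vdc_amp {a b : ℝ} (hab : a ≤ b) (hab1 : b - a ≤ 1) {p : ℝ → ℝ} (hp : ContinuousOn p (Icc a b))
    {E D : ℝ} (hE : 0 ≤ E)
    (h : ∀ x ∈ Icc a b, ‖∫ s in a..x, Complex.exp (Complex.I * (p s : ℂ))‖ ≤ E)
    {q q' : ℝ → ℝ} (hq : ∀ s ∈ Icc a b, HasDerivAt q (q' s) s) (hq' : ContinuousOn q' (Icc a b))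
    (hD : ∀ s ∈ Icc a b, |q s| ≤ D) (hD' : ∀ s ∈ Icc a b, |q' s| ≤ D) :
    ‖∫ s in a..b, Complex.exp (Complex.I * (p s : ℂ)) * (q s : ℂ)‖ ≤ 2 * E * D := by
  have hu : uIcc a b = Icc a b := uIcc_of_le hab
  have ce : ContinuousOn (fun s => Complex.exp (Complex.I * (p s : ℂ))) (Icc a b) := by
    fun_prop
  set F : ℝ → ℂ := fun x => ∫ s in a..x, Complex.exp (Complex.I * (p s : ℂ)) with hF
  have ie : IntervalIntegrable (fun s => Complex.exp (Complex.I * (p s : ℂ))) volume a b :=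
    ContinuousOn.intervalIntegrable (by rwa [hu])
  have cF : ContinuousOn F (uIcc a b) := by
    apply intervalIntegral.continuousOn_primitive_interval
    rw [hu]
    exact ce.integrableOn_Icc
  have hbp := intervalIntegral.integral_deriv_mul_eq_sub_of_hasDerivAt (a := a) (b := b) (u := F)
    (u' := fun s => Complex.exp (Complex.I * (p s : ℂ)))
    (v := fun s => (q s : ℂ)) (v' := fun s => (q' s : ℂ)) cF
    (fun s hs => by
      rw [hu] at hs; exact (hq s hs).ofReal_comp.continuousAt.continuousWithinAt)
    (fun s hs => by
      rw [min_eq_left hab, max_eq_right hab] at hs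
      have hnhd : Icc a b ∈ 𝓝 s := Icc_mem_nhds hs.1 hs.2
      refine intervalIntegral.integral_hasDerivAt_right ?_ ?_ (ce.continuousAt hnhd)
      · apply ContinuousOn.intervalIntegrable
        rw [uIcc_of_le hs.1.le]
        exact ce.mono (Icc_subset_Icc le_rfl hs.2.le)
      · exact ⟨Icc a b, hnhd, ce.aestronglyMeasurable measurableSet_Icc⟩)
    (fun s hs => by
      rw [min_eq_left hab, max_eq_right hab] at hs
      exact (hq s ⟨hs.1.le, hs.2.le⟩).ofReal_comp)
    ie (ContinuousOn.intervalIntegrable (by rw [hu]; fun_prop))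
  have cq : ContinuousOn q (Icc a b) := fun s hs => (hq s hs).continuousAt.continuousWithinAt
  have i1 : IntervalIntegrable (fun s => Complex.exp (Complex.I * (p s : ℂ)) * (q s : ℂ)) volume a b :=
    ContinuousOn.intervalIntegrable (by rw [hu]; exact ce.mul (by fun_prop))
  have i2 : IntervalIntegrable (fun s => F s * (q' s : ℂ)) volume a b :=
    ContinuousOn.intervalIntegrable (by rw [hu] at cF ⊢; exact cF.mul (by fun_prop))
  rw [intervalIntegral.integral_add i1 i2] at hbp
  have hFa : F a = 0 := by simp [hF]
  rw [hFa, zero_mul, sub_zero] at hbp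
  rw [eq_sub_of_add_eq hbp]
  have hD0 : 0 ≤ D := (abs_nonneg _).trans (hD a (left_mem_Icc.2 hab))
  have b1 : ‖F b * (q b : ℂ)‖ ≤ E * D := by
    rw [norm_mul, Complex.norm_real]
    exact mul_le_mul (h b (right_mem_Icc.2 hab)) (hD b (right_mem_Icc.2 hab)) (norm_nonneg _) hE
  have b2 : ‖∫ s in a..b, F s * (q' s : ℂ)‖ ≤ E * D := by
    have := intervalIntegral.norm_integral_le_of_norm_le_const (a := a) (b := b) (C := E * D)
      (f := fun s => F s * (q' s : ℂ)) (by
        intro x hx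
        rw [uIoc_of_le hab] at hx
        have hx' : x ∈ Icc a b := ⟨hx.1.le, hx.2⟩
        rw [norm_mul, Complex.norm_real]
        exact mul_le_mul (h x hx') (hD' x hx') (norm_nonneg _) hE)
    refine this.trans ?_
    rw [abs_of_nonneg (by linarith)]
    exact mul_le_of_le_one_right (by positivity) hab1
  exact (norm_sub_le _ _).trans (by linarith)

end

section


/-! ## Minkowski's integral inequality (weighted) -/

lemma minkowski_lint {X Y : Type*} [MeasurableSpace X] [MeasurableSpace Y] {μ : Measure X} {η : Measure Y}
    [SFinite μ] [SFinite η] {p : ℝ} (hp : 1 < p) {u : Y → X → ℂ} {w : Y → ℝ≥0∞} {D : ℝ≥0∞}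
    (hu : AEStronglyMeasurable (fun z : X × Y => u z.2 z.1) (μ.prod η)) (hw : AEMeasurable w η)
    (hw0 : ∀ᵐ y ∂η, w y ≠ 0 ∧ w y ≠ ⊤)
    (h : ∀ᵐ y ∂η, ∫⁻ x, ‖u y x‖ₑ ^ p ∂μ ≤ (w y * D) ^ p) :
    ∫⁻ x, ‖∫ y, u y x ∂η‖ₑ ^ p ∂μ ≤ ((∫⁻ y, w y ∂η) * D) ^ p := by
  have hp0 : 0 < p := by linarith
  have hp1 : 0 < p - 1 := by linarith
  set q := Real.conjExponent p with hq
  have hpq : p.HolderConjugate q := Real.HolderConjugate.conjExponent hp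
  have hqp : 1 / q * p = p - 1 := by
    have h1 := hpq.inv_add_inv_eq_one
    have : 1 / q = 1 - 1 / p := by rw [one_div, one_div]; linarith
    rw [this]; field_simp
  have hm : AEMeasurable (fun z : X × Y => w z.2 ^ (-(p - 1)) * ‖u z.2 z.1‖ₑ ^ p) (μ.prod η) :=
    (hw.comp_snd.pow_const _).mul (hu.enorm.pow_const _)
  have key : ∀ᵐ x ∂μ, ‖∫ y, u y x ∂η‖ₑ ^ p ≤
      (∫⁻ y, w y ∂η) ^ (p - 1) * ∫⁻ y, w y ^ (-(p - 1)) * ‖u y x‖ₑ ^ p ∂η := by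
    filter_upwards [hu.prodMk_left] with x hx
    have h1 : ∫⁻ y, ‖u y x‖ₑ ∂η = ∫⁻ y, (w y ^ (1 / q)) * (w y ^ (-(1 / q)) * ‖u y x‖ₑ) ∂η := by
      refine lintegral_congr_ae ?_
      filter_upwards [hw0] with y hy
      rw [← mul_assoc, ← ENNReal.rpow_add _ _ hy.1 hy.2, add_neg_cancel, ENNReal.rpow_zero, one_mul]
    have h2 := ENNReal.lintegral_mul_le_Lp_mul_Lq η hpq.symm (f := fun y => w y ^ (1 / q))
      (g := fun y => w y ^ (-(1 / q)) * ‖u y x‖ₑ) (hw.pow_const _)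
      ((hw.pow_const _).mul hx.enorm)
    have h3 : ‖∫ y, u y x ∂η‖ₑ ≤ _ := (enorm_integral_le_lintegral_enorm _).trans (h1.le.trans h2)
    refine (ENNReal.rpow_le_rpow h3 hp0.le).trans (le_of_eq ?_)
    rw [ENNReal.mul_rpow_of_nonneg _ _ hp0.le, ← ENNReal.rpow_mul, ← ENNReal.rpow_mul, hqp,
      one_div_mul_cancel hp0.ne', ENNReal.rpow_one]
    congr 2
    · refine lintegral_congr fun y => ?_
      rw [← ENNReal.rpow_mul, one_div_mul_cancel hpq.symm.ne_zero, ENNReal.rpow_one]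
    · ext y
      rw [ENNReal.mul_rpow_of_nonneg _ _ hp0.le, ← ENNReal.rpow_mul, neg_mul, hqp]
  refine (lintegral_mono_ae key).trans ?_
  have hkm : AEMeasurable (fun x => ∫⁻ y, w y ^ (-(p - 1)) * ‖u y x‖ₑ ^ p ∂η) μ := hm.lintegral_prod_right'
  rw [lintegral_const_mul'' _ hkm, lintegral_lintegral_swap hm]
  have h4 : ∫⁻ y, ∫⁻ x, w y ^ (-(p - 1)) * ‖u y x‖ₑ ^ p ∂μ ∂η ≤ ∫⁻ y, w y * D ^ p ∂η := by
    refine lintegral_mono_ae ?_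
    filter_upwards [hw0, h] with y hy h
    have hc : w y ^ (-(p - 1)) ≠ ⊤ := by
      simp [ENNReal.rpow_eq_top_iff, hy.1, hy.2]
    rw [lintegral_const_mul' _ _ hc]
    refine (mul_le_mul_right h _).trans (le_of_eq ?_)
    rw [ENNReal.mul_rpow_of_nonneg _ _ hp0.le, ← mul_assoc, ← ENNReal.rpow_add _ _ hy.1 hy.2]
    rw [show -(p - 1) + p = 1 by ring, ENNReal.rpow_one]
  refine (mul_le_mul_right h4 _).trans ?_
  rw [lintegral_mul_const'' _ hw, ENNReal.mul_rpow_of_nonneg _ _ hp0.le, ← mul_assoc]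
  gcongr
  by_cases h0 : ∫⁻ y, w y ∂η = 0
  · rw [h0, mul_zero]; exact zero_le
  by_cases ht : ∫⁻ y, w y ∂η = ⊤
  · rw [ht, ENNReal.top_rpow_of_pos hp0]; exact le_top
  rw [show p = (p - 1) + 1 by ring, ENNReal.rpow_add _ _ h0 ht, ENNReal.rpow_one]
  simp

lemma minkowski {X Y : Type*} [MeasurableSpace X] [MeasurableSpace Y] {μ : Measure X} {η : Measure Y}
    [SFinite μ] [SFinite η] {p : ℝ} (hp : 1 < p) {u : Y → X → ℂ} {w : Y → ℝ≥0∞} {D : ℝ≥0∞}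
    (hu : AEStronglyMeasurable (fun z : X × Y => u z.2 z.1) (μ.prod η)) (hw : AEMeasurable w η)
    (hw0 : ∀ᵐ y ∂η, w y ≠ 0 ∧ w y ≠ ⊤)
    (h : ∀ᵐ y ∂η, eLpNorm (u y) (ENNReal.ofReal p) μ ≤ w y * D) :
    eLpNorm (fun x => ∫ y, u y x ∂η) (ENNReal.ofReal p) μ ≤ (∫⁻ y, w y ∂η) * D := by
  have hp0 : 0 < p := by linarith
  have e : ∀ f : X → ℂ, eLpNorm f (ENNReal.ofReal p) μ = (∫⁻ x, ‖f x‖ₑ ^ p ∂μ) ^ (1 / p) := by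
    intro f
    rw [eLpNorm_eq_lintegral_rpow_enorm_toReal (by simpa using hp0) ENNReal.ofReal_ne_top,
      ENNReal.toReal_ofReal hp0.le]
  have h' : ∀ᵐ y ∂η, ∫⁻ x, ‖u y x‖ₑ ^ p ∂μ ≤ (w y * D) ^ p := by
    filter_upwards [h] with y hy
    rw [e] at hy
    have := ENNReal.rpow_le_rpow hy hp0.le
    rwa [← ENNReal.rpow_mul, one_div_mul_cancel hp0.ne', ENNReal.rpow_one] at this
  have := minkowski_lint hp hu hw hw0 h'
  rw [e]
  have := ENNReal.rpow_le_rpow this (show 0 ≤ 1 / p by positivity)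
  rwa [← ENNReal.rpow_mul _ p, mul_one_div_cancel hp0.ne', ENNReal.rpow_one] at this

end

section


/-! ## Gaussian and Plancherel inequality -/

/-- squared Euclidean norm -/
def nsq {N : ℕ} (x : Fin N → ℝ) : ℝ := ∑ i, x i ^ 2

/-- the character -/
def ew {N : ℕ} (x ξ : Fin N → ℝ) : ℂ :=
  Complex.exp (2 * (Real.pi : ℂ) * Complex.I * ((∑ i, x i * ξ i : ℝ) : ℂ))

lemma nsq_nonneg {N : ℕ} (x : Fin N → ℝ) : 0 ≤ nsq x :=
  Finset.sum_nonneg fun _ _ => sq_nonneg _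

lemma continuous_nsq {N : ℕ} : Continuous (nsq : (Fin N → ℝ) → ℝ) := by
  unfold nsq; fun_prop

lemma norm_ew {N : ℕ} (x ξ : Fin N → ℝ) : ‖ew x ξ‖ = 1 := by
  unfold ew
  rw [Complex.norm_exp]
  simp

lemma continuous_ew {N : ℕ} : Continuous (fun z : (Fin N → ℝ) × (Fin N → ℝ) => ew z.1 z.2) := by
  unfold ew; fun_prop

lemma continuous_ew_comp {N : ℕ} {X : Type*} [TopologicalSpace X] {f g : X → (Fin N → ℝ)}
    (hf : Continuous f) (hg : Continuous g) : Continuous (fun z => ew (f z) (g z)) :=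
  continuous_ew.comp (hf.prodMk hg)

lemma ew_comm {N : ℕ} (x ξ : Fin N → ℝ) : ew x ξ = ew ξ x := by
  unfold ew; simp only [mul_comm]

lemma ew_add {N : ℕ} (x ξ η : Fin N → ℝ) : ew x (ξ + η) = ew x ξ * ew x η := by
  unfold ew
  rw [← Complex.exp_add]
  congr 1
  simp only [Pi.add_apply, mul_add, Finset.sum_add_distrib]
  push_cast; ring

lemma ew_add_left {N : ℕ} (x y ξ : Fin N → ℝ) : ew (x + y) ξ = ew x ξ * ew y ξ := by
  rw [ew_comm, ew_add, ew_comm, ew_comm ξ y]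

lemma ew_neg {N : ℕ} (x ξ : Fin N → ℝ) : ew x (-ξ) = (starRingEnd ℂ) (ew x ξ) := by
  unfold ew
  rw [← Complex.exp_conj]
  congr 1
  simp only [map_mul, Complex.conj_ofReal, Complex.conj_I, Pi.neg_apply, mul_neg,
    Finset.sum_neg_distrib, Complex.ofReal_neg, Complex.conj_ofNat]
  ring

lemma ew_neg_left {N : ℕ} (x ξ : Fin N → ℝ) : ew (-x) ξ = (starRingEnd ℂ) (ew x ξ) := by
  rw [ew_comm, ew_neg, ew_comm]

lemma fourierInv_eq {N : ℕ} (g : (Fin N → ℝ) → ℂ) (x : Fin N → ℝ) :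
    fourierInv g x = ∫ ξ, ew x ξ * g ξ := rfl

lemma fourierTransform_eq {N : ℕ} (g : (Fin N → ℝ) → ℂ) (ξ : Fin N → ℝ) :
    fourierTransform g ξ = ∫ x, ew (-ξ) x * g x := by
  unfold fourierTransform ew
  congr 1
  ext x
  congr 2
  simp only [Pi.neg_apply, neg_mul, Finset.sum_neg_distrib, Complex.ofReal_neg, mul_neg]
  congr 3
  simp only [mul_comm]

lemma fourierTransform_eq_inv {N : ℕ} (g : (Fin N → ℝ) → ℂ) (ξ : Fin N → ℝ) :
    fourierTransform g ξ = fourierInv g (-ξ) := fourierTransform_eq g ξ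

lemma integrable_ew_mul {N : ℕ} {q : (Fin N → ℝ) → ℂ} (hq : Integrable q) (x : Fin N → ℝ) :
    Integrable (fun ξ => ew x ξ * q ξ) := by
  refine hq.bdd_mul (c := 1) ?_ ?_
  · exact (continuous_ew_comp continuous_const continuous_id).aestronglyMeasurable
  · exact Eventually.of_forall fun ξ => (norm_ew _ _).le

lemma norm_fourierInv_le {N : ℕ} (q : (Fin N → ℝ) → ℂ) (x : Fin N → ℝ) :
    ‖fourierInv q x‖ ≤ ∫ ξ, ‖q ξ‖ := by
  rw [fourierInv_eq]
  refine (norm_integral_le_integral_norm _).trans (le_of_eq ?_)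
  congr 1; ext ξ
  rw [norm_mul, norm_ew, one_mul]

lemma continuous_fourierInv {N : ℕ} {q : (Fin N → ℝ) → ℂ} (hq : Integrable q) :
    Continuous (fourierInv q) := by
  have : fourierInv q = fun x => ∫ ξ, ew x ξ * q ξ := rfl
  rw [this]
  refine continuous_of_dominated (bound := fun ξ => ‖q ξ‖) ?_ ?_ hq.norm ?_
  · intro x; exact (integrable_ew_mul hq x).aestronglyMeasurable
  · intro x; refine Eventually.of_forall fun ξ => ?_
    rw [norm_mul, norm_ew, one_mul]
  · refine Eventually.of_forall fun ξ => ?_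
    exact (continuous_ew_comp continuous_id continuous_const).mul continuous_const

lemma continuous_fourierTransform {N : ℕ} {q : (Fin N → ℝ) → ℂ} (hq : Integrable q) :
    Continuous (fourierTransform q) := by
  have : fourierTransform q = fun x => fourierInv q (-x) := by
    ext x; exact fourierTransform_eq_inv _ _
  rw [this]
  exact (continuous_fourierInv hq).comp continuous_neg

/-- the Gaussian kernel -/
def gk {N : ℕ} (b : ℝ) (ξ : Fin N → ℝ) : ℝ :=
  (π / b) ^ ((N : ℝ) / 2) * Real.exp (-(π ^ 2 / b) * nsq ξ)

lemma gk_nonneg {N : ℕ} {b : ℝ} (hb : 0 < b) (ξ : Fin N → ℝ) : 0 ≤ gk b ξ := by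
  unfold gk; positivity

lemma continuous_gk {N : ℕ} (b : ℝ) : Continuous (gk b : (Fin N → ℝ) → ℝ) := by
  unfold gk
  exact continuous_const.mul (Real.continuous_exp.comp (continuous_const.mul continuous_nsq))

lemma gauss_ft {N : ℕ} {b : ℝ} (hb : 0 < b) (ξ : Fin N → ℝ) :
    ∫ x : Fin N → ℝ, ew x ξ * ((Real.exp (-b * nsq x) : ℝ) : ℂ) = (gk b ξ : ℂ) := by
  have h := GaussianFourier.integral_cexp_neg_mul_sum_add (ι := Fin N) (b := (b : ℂ))
    (by simpa using hb) (fun i => 2 * (π : ℂ) * Complex.I * ξ i)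
  have hb' : (b : ℂ) ≠ 0 := by exact_mod_cast hb.ne'
  have h' : (∫ x : Fin N → ℝ, ew x ξ * ((Real.exp (-b * nsq x) : ℝ) : ℂ)) =
      ∫ v : Fin N → ℝ, Complex.exp (-↑b * ∑ i, (v i : ℂ) ^ 2 +
        ∑ i, 2 * ↑π * Complex.I * ↑(ξ i) * ↑(v i)) := ?_
  · refine h'.trans (h.trans ?_)
    · unfold gk
      push_cast
      congr 1
      · rw [Complex.ofReal_cpow (by positivity)]
        push_cast
        simp
      · congr 1
        simp only [mul_pow, Complex.I_sq]
        unfold nsq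
        push_cast
        rw [← Finset.mul_sum]
        field_simp
        ring
  · congr 1
    ext x
    unfold ew nsq
    rw [Complex.ofReal_exp, ← Complex.exp_add]
    congr 1
    push_cast
    rw [add_comm]
    congr 1
    rw [Finset.mul_sum]
    refine Finset.sum_congr rfl fun i _ => ?_
    ring

lemma integrable_gauss {N : ℕ} {b : ℝ} (hb : 0 < b) :
    Integrable (fun x : Fin N → ℝ => Real.exp (-b * nsq x)) := by
  have h := GaussianFourier.integrable_cexp_neg_mul_sum_add (ι := Fin N) (b := (b : ℂ))
    (by simpa using hb) (fun i => 0)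
  have := h.re
  refine this.congr (Eventually.of_forall fun x => ?_)
  simp only [zero_mul, Finset.sum_const_zero, add_zero]
  unfold nsq
  rw [show (-(b : ℂ) * ∑ i, (x i : ℂ) ^ 2) = ((-b * ∑ i, x i ^ 2 : ℝ) : ℂ) by push_cast; ring,
    ← Complex.ofReal_exp]
  exact Complex.ofReal_re _

lemma integral_gauss {N : ℕ} {b : ℝ} (hb : 0 < b) :
    ∫ x : Fin N → ℝ, Real.exp (-b * nsq x) = (π / b) ^ ((N : ℝ) / 2) := by
  have h := gauss_ft (N := N) hb 0
  have h0 : nsq (0 : Fin N → ℝ) = 0 := by simp [nsq]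
  simp only [gk, h0, mul_zero, Real.exp_zero, mul_one] at h
  have : ∀ x : Fin N → ℝ, ew x 0 = 1 := by intro x; simp [ew]
  simp only [this, one_mul] at h
  rw [integral_complex_ofReal] at h
  exact_mod_cast h

lemma integrable_gk {N : ℕ} {b : ℝ} (hb : 0 < b) :
    Integrable (gk b : (Fin N → ℝ) → ℝ) := by
  unfold gk
  exact (integrable_gauss (N := N) (b := π ^ 2 / b) (by positivity)).const_mul _

lemma integral_gk {N : ℕ} {b : ℝ} (hb : 0 < b) :
    ∫ x : Fin N → ℝ, gk b x = 1 := by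
  unfold gk
  rw [integral_const_mul, integral_gauss (by positivity), ← Real.mul_rpow (by positivity) (by positivity)]
  have : π / b * (π / (π ^ 2 / b)) = 1 := by
    have := Real.pi_pos.ne'
    field_simp
  rw [this, Real.one_rpow]

lemma lintegral_gk {N : ℕ} {b : ℝ} (hb : 0 < b) :
    ∫⁻ x : Fin N → ℝ, ENNReal.ofReal (gk b x) = 1 := by
  rw [← ofReal_integral_eq_lintegral_ofReal (integrable_gk hb)
    (Eventually.of_forall fun x => gk_nonneg hb x), integral_gk hb, ENNReal.ofReal_one]

lemma plancherel_gauss {N : ℕ} {q : (Fin N → ℝ) → ℂ} (hq : Integrable q) {b : ℝ} (hb : 0 < b) :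
    ∫⁻ x, ENNReal.ofReal (Real.exp (-b * nsq x)) * ‖fourierInv q x‖ₑ ^ 2 ≤ ∫⁻ ξ, ‖q ξ‖ₑ ^ 2 := by
  set E := fourierInv q with hE
  have hEc := continuous_fourierInv hq
  -- step 1: E conj E as a double integral
  have h1 : ∀ x, E x * (starRingEnd ℂ) (E x) =
      ∫ z : (Fin N → ℝ) × (Fin N → ℝ), ew x (z.1 - z.2) * (q z.1 * (starRingEnd ℂ) (q z.2)) := by
    intro x
    have : (starRingEnd ℂ) (E x) = ∫ η, ew x (-η) * (starRingEnd ℂ) (q η) := by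
      rw [hE, fourierInv_eq, ← integral_conj]
      congr 1; ext η
      rw [map_mul, ew_neg]
    rw [this, hE, fourierInv_eq, ← integral_prod_mul]
    rw [Measure.volume_eq_prod]
    congr 1; ext z
    rw [sub_eq_add_neg, ew_add]; ring
  have hqq : Integrable (fun z : (Fin N → ℝ) × (Fin N → ℝ) => q z.1 * (starRingEnd ℂ) (q z.2)) := by
    rw [Measure.volume_eq_prod]
    have hcq : Integrable (fun η => (starRingEnd ℂ) (q η)) :=
      (Complex.conjCLE.toContinuousLinearMap).integrable_comp hq
    exact Integrable.mul_prod hq hcq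
  have h2 : ∫ x, ((Real.exp (-b * nsq x) : ℝ) : ℂ) * (E x * (starRingEnd ℂ) (E x)) =
      ∫ z : (Fin N → ℝ) × (Fin N → ℝ), (gk b (z.1 - z.2) : ℂ) * (q z.1 * (starRingEnd ℂ) (q z.2)) := by
    simp_rw [h1, ← integral_const_mul]
    rw [integral_integral_swap]
    · congr 1; ext z
      rw [← gauss_ft hb, ← integral_mul_const]
      congr 1; ext x; ring
    · have hgi : Integrable (fun x : Fin N → ℝ => ((Real.exp (-b * nsq x) : ℝ) : ℂ)) :=
        (integrable_gauss (N := N) hb).ofReal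
      have := Integrable.mul_prod hgi hqq
      refine (this.bdd_mul (c := 1) (f := fun z => ew z.1 (z.2.1 - z.2.2)) ?_ ?_).congr ?_
      · exact (continuous_ew_comp (by fun_prop) (by fun_prop)).aestronglyMeasurable
      · exact Eventually.of_forall fun z => (norm_ew _ _).le
      · refine Eventually.of_forall fun z => ?_
        simp only [Function.uncurry]
        ring
  have h3 : ∫⁻ x, ENNReal.ofReal (Real.exp (-b * nsq x)) * ‖E x‖ₑ ^ 2 =
      ENNReal.ofReal (∫ x, Real.exp (-b * nsq x) * ‖E x‖ ^ 2) := by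
    rw [ofReal_integral_eq_lintegral_ofReal]
    · refine lintegral_congr fun x => ?_
      rw [ENNReal.ofReal_mul (by positivity), ← ofReal_norm, ENNReal.ofReal_pow (by positivity)]
    · refine (integrable_gauss hb).mul_bdd (c := (∫ ξ, ‖q ξ‖) ^ 2) (hEc.norm.pow 2).aestronglyMeasurable ?_
      refine Eventually.of_forall fun x => ?_
      rw [norm_pow, norm_norm]
      gcongr
      exact norm_fourierInv_le q x
    · exact Eventually.of_forall fun x => by positivity
  have h4 : ∫ x, Real.exp (-b * nsq x) * ‖E x‖ ^ 2 =
    ‖∫ x, ((Real.exp (-b * nsq x) : ℝ) : ℂ) * (E x * (starRingEnd ℂ) (E x))‖ := by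
    have : ∀ x, ((Real.exp (-b * nsq x) : ℝ) : ℂ) * (E x * (starRingEnd ℂ) (E x)) =
        ((Real.exp (-b * nsq x) * ‖E x‖ ^ 2 : ℝ) : ℂ) := by
      intro x
      rw [Complex.mul_conj, Complex.normSq_eq_norm_sq]; push_cast; rfl
    simp_rw [this]
    rw [integral_complex_ofReal, Complex.norm_real, Real.norm_of_nonneg]
    exact integral_nonneg fun x => by positivity
  rw [h3, h4, h2]
  rw [ofReal_norm]
  refine (enorm_integral_le_lintegral_enorm _).trans ?_
  have hm : AEMeasurable (fun ξ => ‖q ξ‖ₑ ^ 2) := hq.aestronglyMeasurable.enorm.pow_const 2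
  have hmg : Measurable (fun x : Fin N → ℝ => ENNReal.ofReal (gk b x)) :=
    (ENNReal.continuous_ofReal.comp (continuous_gk b)).measurable
  calc ∫⁻ z : (Fin N → ℝ) × (Fin N → ℝ), ‖(gk b (z.1 - z.2) : ℂ) * (q z.1 * (starRingEnd ℂ) (q z.2))‖ₑ
      ≤ ∫⁻ z : (Fin N → ℝ) × (Fin N → ℝ), (ENNReal.ofReal (gk b (z.1 - z.2)) * (2⁻¹ * ‖q z.1‖ₑ ^ 2)
        + ENNReal.ofReal (gk b (z.1 - z.2)) * (2⁻¹ * ‖q z.2‖ₑ ^ 2)) := by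
        refine lintegral_mono fun z => ?_
        simp only [← ofReal_norm]
        rw [show (2⁻¹ : ENNReal) = ENNReal.ofReal (2⁻¹) by
          rw [ENNReal.ofReal_inv_of_pos (by norm_num)]; simp]
        have hg := gk_nonneg hb (z.1 - z.2)
        simp only [← ENNReal.ofReal_pow (norm_nonneg _)]
        rw [← ENNReal.ofReal_mul (by positivity), ← ENNReal.ofReal_mul (by positivity),
          ← ENNReal.ofReal_mul (by positivity), ← ENNReal.ofReal_mul (by positivity),
          ← ENNReal.ofReal_add (by positivity) (by positivity)]
        refine ENNReal.ofReal_le_ofReal ?_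
        rw [norm_mul, norm_mul, Complex.norm_real, Real.norm_of_nonneg hg, RCLike.norm_conj]
        nlinarith [mul_nonneg hg (sq_nonneg (‖q z.1‖ - ‖q z.2‖))]
    _ = ∫⁻ ξ, ‖q ξ‖ₑ ^ 2 := by
        have hcm : Measurable (fun z : (Fin N → ℝ) × (Fin N → ℝ) => ENNReal.ofReal (gk b (z.1 - z.2))) :=
          hmg.comp (measurable_fst.sub measurable_snd)
        have m1 : AEMeasurable (fun z : (Fin N → ℝ) × (Fin N → ℝ) =>
            ENNReal.ofReal (gk b (z.1 - z.2)) * (2⁻¹ * ‖q z.1‖ₑ ^ 2)) :=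
          hcm.aemeasurable.mul (hm.comp_fst.const_mul _)
        have m2 : AEMeasurable (fun z : (Fin N → ℝ) × (Fin N → ℝ) =>
            ENNReal.ofReal (gk b (z.1 - z.2)) * (2⁻¹ * ‖q z.2‖ₑ ^ 2)) :=
          hcm.aemeasurable.mul (hm.comp_snd.const_mul _)
        rw [lintegral_add_left' m1]
        have e1 : ∫⁻ z : (Fin N → ℝ) × (Fin N → ℝ),
            ENNReal.ofReal (gk b (z.1 - z.2)) * (2⁻¹ * ‖q z.1‖ₑ ^ 2) = 2⁻¹ * ∫⁻ ξ, ‖q ξ‖ₑ ^ 2 := by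
          rw [Measure.volume_eq_prod] at m1 ⊢
          rw [lintegral_prod _ m1]
          simp only
          rw [← lintegral_const_mul' _ _ (by simp)]
          refine lintegral_congr fun x => ?_
          rw [lintegral_mul_const _ (show Measurable fun y : Fin N → ℝ => ENNReal.ofReal (gk b (x - y)) from
            hmg.comp (measurable_const.sub measurable_id))]
          have := lintegral_sub_left_eq_self (μ := (volume : Measure (Fin N → ℝ)))
            (fun y => ENNReal.ofReal (gk b y)) x
          rw [this, lintegral_gk hb, one_mul]
        have e2 : ∫⁻ z : (Fin N → ℝ) × (Fin N → ℝ),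
            ENNReal.ofReal (gk b (z.1 - z.2)) * (2⁻¹ * ‖q z.2‖ₑ ^ 2) = 2⁻¹ * ∫⁻ ξ, ‖q ξ‖ₑ ^ 2 := by
          rw [Measure.volume_eq_prod] at m2 ⊢
          rw [lintegral_prod_symm _ m2]
          simp only
          rw [← lintegral_const_mul' _ _ (by simp)]
          refine lintegral_congr fun x => ?_
          rw [lintegral_mul_const _ (show Measurable fun y : Fin N → ℝ => ENNReal.ofReal (gk b (y - x)) from
            hmg.comp (measurable_id.sub measurable_const))]
          have := lintegral_sub_right_eq_self (μ := (volume : Measure (Fin N → ℝ)))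
            (fun y => ENNReal.ofReal (gk b y)) x
          rw [this, lintegral_gk hb, one_mul]
        rw [e1, e2, ← add_mul, ENNReal.inv_two_add_inv_two, one_mul]

lemma plancherel_inv {N : ℕ} {q : (Fin N → ℝ) → ℂ} (hq : Integrable q) :
    ∫⁻ x, ‖fourierInv q x‖ₑ ^ 2 ≤ ∫⁻ ξ, ‖q ξ‖ₑ ^ 2 := by
  have hEc := continuous_fourierInv hq
  have key : ∫⁻ x, ‖fourierInv q x‖ₑ ^ 2 ≤ liminf (fun k : ℕ => ∫⁻ x,
      ENNReal.ofReal (Real.exp (-(1 / ((k : ℝ) + 1)) * nsq x)) * ‖fourierInv q x‖ₑ ^ 2) atTop := by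
    refine le_trans (le_of_eq ?_) (lintegral_liminf_le ?_)
    · refine lintegral_congr fun x => ?_
      symm
      apply Tendsto.liminf_eq
      have : Tendsto (fun k : ℕ => ENNReal.ofReal (Real.exp (-(1 / ((k : ℝ) + 1)) * nsq x))) atTop
          (𝓝 (ENNReal.ofReal (Real.exp (-0 * nsq x)))) := by
        refine (ENNReal.continuous_ofReal.tendsto _).comp ((Real.continuous_exp.tendsto _).comp ?_)
        exact (tendsto_one_div_add_atTop_nhds_zero_nat (𝕜 := ℝ)).neg.mul_const _
      have := ENNReal.Tendsto.mul_const (b := ‖fourierInv q x‖ₑ ^ 2) this (Or.inl (by simp))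
      simpa using this
    · intro k
      refine Measurable.mul ?_ (hEc.measurable.enorm.pow_const 2)
      exact ENNReal.measurable_ofReal.comp
        (Real.continuous_exp.comp (continuous_const.mul continuous_nsq)).measurable
  refine key.trans ?_
  refine liminf_le_of_frequently_le' (Frequently.of_forall fun k => ?_)
  exact plancherel_gauss hq (by positivity)

lemma plancherel_ft {N : ℕ} {q : (Fin N → ℝ) → ℂ} (hq : Integrable q) :
    ∫⁻ x, ‖fourierTransform q x‖ₑ ^ 2 ≤ ∫⁻ ξ, ‖q ξ‖ₑ ^ 2 := by
  have h : ∀ x, fourierTransform q x = fourierInv q (-x) := fourierTransform_eq_inv q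
  simp_rw [h]
  rw [lintegral_neg_eq_self (μ := volume) (fun x => ‖fourierInv q x‖ₑ ^ 2)]
  exact plancherel_inv hq

end

section


/-! ## Interpolation -/

lemma lint_pow_lt {r b : ℝ} (hr : -1 < r) (hb : 0 ≤ b) :
    ∫⁻ s in Ioc 0 b, ENNReal.ofReal (s ^ r) = ENNReal.ofReal (b ^ (r + 1) / (r + 1)) := by
  have hi : IntervalIntegrable (fun s : ℝ => s ^ r) volume 0 b := intervalIntegral.intervalIntegrable_rpow' hr
  have := ofReal_integral_eq_lintegral_ofReal (μ := volume.restrict (Ioc 0 b)) (f := fun s : ℝ => s ^ r)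
    ((intervalIntegrable_iff_integrableOn_Ioc_of_le hb).1 hi) ?_
  · rw [← this, ← intervalIntegral.integral_of_le hb, integral_rpow (Or.inl hr),
      Real.zero_rpow (by linarith), sub_zero]
  · exact (ae_restrict_iff' measurableSet_Ioc).2 (Eventually.of_forall fun s hs =>
      Real.rpow_nonneg hs.1.le _)

lemma lint_pow_gt {r b : ℝ} (hr : r < -1) (hb : 0 < b) :
    ∫⁻ s in Ioi b, ENNReal.ofReal (s ^ r) = ENNReal.ofReal (b ^ (r + 1) / (-(r + 1))) := by
  have := ofReal_integral_eq_lintegral_ofReal (μ := volume.restrict (Ioi b)) (f := fun s : ℝ => s ^ r)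
    (integrableOn_Ioi_rpow_of_lt hr hb) ?_
  · rw [← this, integral_Ioi_rpow_of_lt hr hb, div_neg, neg_div]
  · exact (ae_restrict_iff' measurableSet_Ioi).2 (Eventually.of_forall fun s hs =>
      Real.rpow_nonneg (hb.trans hs).le _)

section Marc
variable {X : Type*} [MeasurableSpace X] {μ : Measure X} [SFinite μ]

lemma layer_big {g : X → ℝ} (hg : Measurable g) (hg0 : ∀ x, 0 ≤ g x) {γ r e : ℝ} (hγ : 0 < γ)
    (hr : -1 < r) (he : 0 < e) :
    ∫⁻ s in Ioi (0:ℝ), ENNReal.ofReal (s ^ r) * ∫⁻ x, ENNReal.ofReal (if γ * s ≤ g x then g x ^ e else 0) ∂μ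
     = ENNReal.ofReal (γ ^ (-(r + 1)) / (r + 1)) * ∫⁻ x, ENNReal.ofReal (g x ^ (e + r + 1)) ∂μ := by
  have hm : Measurable (fun z : ℝ × X => ENNReal.ofReal (z.1 ^ r) *
      ENNReal.ofReal (if γ * z.1 ≤ g z.2 then g z.2 ^ e else 0)) := by
    refine Measurable.mul (by fun_prop) (ENNReal.measurable_ofReal.comp ?_)
    refine Measurable.ite ?_ (by fun_prop) measurable_const
    exact measurableSet_le (by fun_prop) (by fun_prop)
  have h1 : ∀ s : ℝ, ENNReal.ofReal (s ^ r) * ∫⁻ x, ENNReal.ofReal (if γ * s ≤ g x then g x ^ e else 0) ∂μ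
      = ∫⁻ x, ENNReal.ofReal (s ^ r) * ENNReal.ofReal (if γ * s ≤ g x then g x ^ e else 0) ∂μ := by
    intro s
    rw [lintegral_const_mul' _ _ ENNReal.ofReal_ne_top]
  simp_rw [h1]
  rw [lintegral_lintegral_swap hm.aemeasurable, ← lintegral_const_mul' _ _ ENNReal.ofReal_ne_top]
  refine lintegral_congr fun x => ?_
  have h2 : ∀ s : ℝ, ENNReal.ofReal (s ^ r) * ENNReal.ofReal (if γ * s ≤ g x then g x ^ e else 0)
      = (Iic (g x / γ)).indicator (fun s => ENNReal.ofReal (s ^ r)) s * ENNReal.ofReal (g x ^ e) := by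
    intro s
    have : γ * s ≤ g x ↔ s ≤ g x / γ := by rw [le_div_iff₀ hγ, mul_comm]
    by_cases h : s ≤ g x / γ
    · rw [if_pos (this.2 h), indicator_of_mem (show s ∈ Iic (g x / γ) from h)]
    · rw [if_neg (fun h' => h (this.1 h')), indicator_of_notMem (show s ∉ Iic (g x / γ) from h)]
      simp
  simp_rw [h2]
  rw [lintegral_mul_const' _ _ ENNReal.ofReal_ne_top, lintegral_indicator measurableSet_Iic,
    Measure.restrict_restrict measurableSet_Iic, inter_comm, Ioi_inter_Iic,
    lint_pow_lt hr (div_nonneg (hg0 x) hγ.le), ← ENNReal.ofReal_mul (by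
      have := hg0 x; have : 0 < r + 1 := by linarith
      positivity), ← ENNReal.ofReal_mul (by
      have : 0 < r + 1 := by linarith
      positivity)]
  congr 1
  rw [Real.div_rpow (hg0 x) hγ.le, Real.rpow_neg hγ.le]
  rcases (hg0 x).eq_or_lt with h0 | h0
  · rw [← h0, Real.zero_rpow (show r + 1 ≠ 0 by linarith),
      Real.zero_rpow (show e + r + 1 ≠ 0 by linarith)]; simp
  · rw [add_assoc, Real.rpow_add h0 e (r + 1)]
    ring

lemma layer_small {g : X → ℝ} (hg : Measurable g) (hg0 : ∀ x, 0 ≤ g x) {γ r e : ℝ} (hγ : 0 < γ)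
    (hr : r < -1) (he : 0 < e) (her : 0 < e + r + 1) :
    ∫⁻ s in Ioi (0:ℝ), ENNReal.ofReal (s ^ r) * ∫⁻ x, ENNReal.ofReal (if g x < γ * s then g x ^ e else 0) ∂μ
     = ENNReal.ofReal (γ ^ (-(r + 1)) / (-(r + 1))) * ∫⁻ x, ENNReal.ofReal (g x ^ (e + r + 1)) ∂μ := by
  have hm : Measurable (fun z : ℝ × X => ENNReal.ofReal (z.1 ^ r) *
      ENNReal.ofReal (if g z.2 < γ * z.1 then g z.2 ^ e else 0)) := by
    refine Measurable.mul (by fun_prop) (ENNReal.measurable_ofReal.comp ?_)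
    refine Measurable.ite ?_ (by fun_prop) measurable_const
    exact measurableSet_lt (by fun_prop) (by fun_prop)
  have h1 : ∀ s : ℝ, ENNReal.ofReal (s ^ r) * ∫⁻ x, ENNReal.ofReal (if g x < γ * s then g x ^ e else 0) ∂μ
      = ∫⁻ x, ENNReal.ofReal (s ^ r) * ENNReal.ofReal (if g x < γ * s then g x ^ e else 0) ∂μ := by
    intro s
    rw [lintegral_const_mul' _ _ ENNReal.ofReal_ne_top]
  simp_rw [h1]
  rw [lintegral_lintegral_swap hm.aemeasurable, ← lintegral_const_mul' _ _ ENNReal.ofReal_ne_top]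
  refine lintegral_congr fun x => ?_
  rcases (hg0 x).eq_or_lt with h0 | h0
  · simp only [← h0]
    rw [Real.zero_rpow he.ne', Real.zero_rpow her.ne']
    simp
  have h2 : ∀ s : ℝ, ENNReal.ofReal (s ^ r) * ENNReal.ofReal (if g x < γ * s then g x ^ e else 0)
      = (Ioi (g x / γ)).indicator (fun s => ENNReal.ofReal (s ^ r)) s * ENNReal.ofReal (g x ^ e) := by
    intro s
    have : g x < γ * s ↔ g x / γ < s := by rw [div_lt_iff₀ hγ, mul_comm]
    by_cases h : g x / γ < s
    · rw [if_pos (this.2 h), indicator_of_mem (show s ∈ Ioi (g x / γ) from h)]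
    · rw [if_neg (fun h' => h (this.1 h')), indicator_of_notMem (show s ∉ Ioi (g x / γ) from h)]
      simp
  simp_rw [h2]
  have hgg : 0 < g x / γ := div_pos h0 hγ
  have hrr : 0 < -(r + 1) := by linarith
  rw [lintegral_mul_const' _ _ ENNReal.ofReal_ne_top, lintegral_indicator measurableSet_Ioi,
    Measure.restrict_restrict measurableSet_Ioi, Ioi_inter_Ioi, sup_eq_left.2 hgg.le,
    lint_pow_gt hr hgg, ← ENNReal.ofReal_mul (by positivity), ← ENNReal.ofReal_mul (by positivity)]
  congr 1
  rw [Real.div_rpow (hg0 x) hγ.le, Real.rpow_neg hγ.le, add_assoc, Real.rpow_add h0 e (r + 1)]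
  ring

lemma marc_lt {p : ℝ} (hp : 1 < p) (hp2 : p < 2) {A B : ℝ} (hA : 0 < A) (hB : 0 < B)
    {g v : X → ℝ} (hg : Measurable g) (hg0 : ∀ x, 0 ≤ g x) (hv : AEMeasurable v μ) (hv0 : ∀ x, 0 ≤ v x)
    (h : ∀ s : ℝ, 0 < s → μ {x | s < v x} ≤
      ENNReal.ofReal (2 * A / s) * ∫⁻ x, ENNReal.ofReal (if A / B ^ 2 * s ≤ g x then g x ^ (1:ℝ) else 0) ∂μ +
      ENNReal.ofReal (4 * B ^ 2 / s ^ 2) * ∫⁻ x, ENNReal.ofReal (if g x < A / B ^ 2 * s then g x ^ (2:ℝ) else 0) ∂μ) :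
    ∫⁻ x, ENNReal.ofReal (v x ^ p) ∂μ ≤
      ENNReal.ofReal (p * (2 / (p - 1) + 4 / (2 - p)) * (A ^ (2 - p) * B ^ (2 * p - 2))) *
        ∫⁻ x, ENNReal.ofReal (g x ^ p) ∂μ := by
  have hp0 : 0 < p := by linarith
  have hp1 : 0 < p - 1 := by linarith
  have hp2' : 0 < 2 - p := by linarith
  set γ := A / B ^ 2 with hγd
  have hγ : 0 < γ := by positivity
  set I1 : ℝ → ENNReal := fun s => ∫⁻ x, ENNReal.ofReal (if γ * s ≤ g x then g x ^ (1:ℝ) else 0) ∂μ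
  set I2 : ℝ → ENNReal := fun s => ∫⁻ x, ENNReal.ofReal (if g x < γ * s then g x ^ (2:ℝ) else 0) ∂μ
  rw [lintegral_rpow_eq_lintegral_meas_lt_mul μ (Eventually.of_forall hv0) hv hp0]
  have step : ∫⁻ s in Ioi (0:ℝ), μ {x | s < v x} * ENNReal.ofReal (s ^ (p - 1)) ≤
      ∫⁻ s in Ioi (0:ℝ), (ENNReal.ofReal (2 * A) * (ENNReal.ofReal (s ^ (p - 2)) * I1 s) +
        ENNReal.ofReal (4 * B ^ 2) * (ENNReal.ofReal (s ^ (p - 3)) * I2 s)) := by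
    refine setLIntegral_mono' measurableSet_Ioi fun s hs => ?_
    have hs : 0 < s := hs
    refine (mul_le_mul_left (h s hs) _).trans (le_of_eq ?_)
    rw [add_mul]
    have e1 : ENNReal.ofReal (2 * A / s) * ENNReal.ofReal (s ^ (p - 1)) =
        ENNReal.ofReal (2 * A) * ENNReal.ofReal (s ^ (p - 2)) := by
      rw [← ENNReal.ofReal_mul (by positivity), ← ENNReal.ofReal_mul (by positivity)]
      congr 1
      rw [show p - 1 = (p - 2) + 1 by ring, Real.rpow_add hs, Real.rpow_one]
      field_simp
    have e2 : ENNReal.ofReal (4 * B ^ 2 / s ^ 2) * ENNReal.ofReal (s ^ (p - 1)) =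
        ENNReal.ofReal (4 * B ^ 2) * ENNReal.ofReal (s ^ (p - 3)) := by
      rw [← ENNReal.ofReal_mul (by positivity), ← ENNReal.ofReal_mul (by positivity)]
      congr 1
      rw [show p - 1 = (p - 3) + (2:ℕ) by push_cast; ring, Real.rpow_add hs, Real.rpow_natCast]
      field_simp
    congr 1
    · rw [mul_right_comm, e1, mul_assoc]
    · rw [mul_right_comm, e2, mul_assoc]
  have hm1 : Measurable (fun s => ENNReal.ofReal (2 * A) * (ENNReal.ofReal (s ^ (p - 2)) * I1 s)) := by
    refine Measurable.const_mul (Measurable.mul (by fun_prop) ?_) _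
    refine Measurable.lintegral_prod_right' (f := fun z : ℝ × X =>
      ENNReal.ofReal (if γ * z.1 ≤ g z.2 then g z.2 ^ (1:ℝ) else 0)) ?_
    refine ENNReal.measurable_ofReal.comp ?_
    refine Measurable.ite ?_ (by fun_prop) measurable_const
    exact measurableSet_le (by fun_prop) (by fun_prop)
  rw [lintegral_add_left hm1, lintegral_const_mul' _ _ ENNReal.ofReal_ne_top,
    lintegral_const_mul' _ _ ENNReal.ofReal_ne_top,
    layer_big hg hg0 hγ (by linarith) one_pos, layer_small hg hg0 hγ (by linarith) two_pos (by linarith)]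
    at step
  refine (mul_le_mul_right step _).trans (le_of_eq ?_)
  rw [show (1:ℝ) + (p - 2) + 1 = p by ring, show (2:ℝ) + (p - 3) + 1 = p by ring, ← mul_assoc, ← mul_assoc,
    ← add_mul, ← mul_assoc]
  congr 1
  rw [show p - 2 + 1 = p - 1 by ring, show -(p - 3 + 1) = 2 - p by ring,
    ← ENNReal.ofReal_mul (by positivity), ← ENNReal.ofReal_mul (by positivity),
    ← ENNReal.ofReal_add (by positivity) (by positivity), ← ENNReal.ofReal_mul (by positivity)]
  congr 1
  have hγ1 : γ ^ (-(p - 1)) = A ^ (1 - p) * B ^ (2 * p - 2) := by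
    rw [hγd, Real.div_rpow hA.le (by positivity), ← Real.rpow_natCast, ← Real.rpow_mul hB.le,
      div_eq_mul_inv, ← Real.rpow_neg hB.le]
    push_cast
    congr 2 <;> ring
  have hγ2 : γ ^ (2 - p) = A ^ (2 - p) * B ^ (2 * p - 4) := by
    rw [hγd, Real.div_rpow hA.le (by positivity), ← Real.rpow_natCast, ← Real.rpow_mul hB.le,
      div_eq_mul_inv, ← Real.rpow_neg hB.le]
    push_cast
    congr 2; ring
  rw [hγ1, hγ2]
  have hA1 : A ^ (2 - p) = A ^ (1 - p) * A := by
    rw [show 2 - p = (1 - p) + 1 by ring, Real.rpow_add hA, Real.rpow_one]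
  have hB1 : B ^ (2 * p - 2) = B ^ (2 * p - 4) * B ^ 2 := by
    rw [show 2 * p - 2 = (2 * p - 4) + (2:ℕ) by push_cast; ring, Real.rpow_add hB, Real.rpow_natCast]
  rw [hA1, hB1]
  ring

lemma marc_gt {p : ℝ} (hp2 : 2 < p) {A B : ℝ} (hA : 0 < A) (hB : 0 < B)
    {g v : X → ℝ} (hg : Measurable g) (hg0 : ∀ x, 0 ≤ g x) (hv : AEMeasurable v μ) (hv0 : ∀ x, 0 ≤ v x)
    (h : ∀ s : ℝ, 0 < s → μ {x | s < v x} ≤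
      ENNReal.ofReal (4 * B ^ 2 / s ^ 2) * ∫⁻ x, ENNReal.ofReal (if 1 / (2 * A) * s ≤ g x then g x ^ (2:ℝ) else 0) ∂μ) :
    ∫⁻ x, ENNReal.ofReal (v x ^ p) ∂μ ≤
      ENNReal.ofReal (p * (4 / (p - 2)) * 2 ^ (p - 2) * (A ^ (p - 2) * B ^ (2:ℝ))) *
        ∫⁻ x, ENNReal.ofReal (g x ^ p) ∂μ := by
  have hp0 : 0 < p := by linarith
  have hp2' : 0 < p - 2 := by linarith
  set γ := 1 / (2 * A) with hγd
  have hγ : 0 < γ := by positivity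
  set I2 : ℝ → ENNReal := fun s => ∫⁻ x, ENNReal.ofReal (if γ * s ≤ g x then g x ^ (2:ℝ) else 0) ∂μ
  rw [lintegral_rpow_eq_lintegral_meas_lt_mul μ (Eventually.of_forall hv0) hv hp0]
  have step : ∫⁻ s in Ioi (0:ℝ), μ {x | s < v x} * ENNReal.ofReal (s ^ (p - 1)) ≤
      ∫⁻ s in Ioi (0:ℝ), 
        ENNReal.ofReal (4 * B ^ 2) * (ENNReal.ofReal (s ^ (p - 3)) * I2 s) := by
    refine setLIntegral_mono' measurableSet_Ioi fun s hs => ?_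
    have hs : 0 < s := hs
    refine (mul_le_mul_left (h s hs) _).trans (le_of_eq ?_)
    have e2 : ENNReal.ofReal (4 * B ^ 2 / s ^ 2) * ENNReal.ofReal (s ^ (p - 1)) =
        ENNReal.ofReal (4 * B ^ 2) * ENNReal.ofReal (s ^ (p - 3)) := by
      rw [← ENNReal.ofReal_mul (by positivity), ← ENNReal.ofReal_mul (by positivity)]
      congr 1
      rw [show p - 1 = (p - 3) + (2:ℕ) by push_cast; ring, Real.rpow_add hs, Real.rpow_natCast]
      field_simp
    rw [mul_right_comm, e2, mul_assoc]
  rw [lintegral_const_mul' _ _ ENNReal.ofReal_ne_top,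
    layer_big hg hg0 hγ (by linarith) two_pos] at step
  refine (mul_le_mul_right step _).trans (le_of_eq ?_)
  rw [show (2:ℝ) + (p - 3) + 1 = p by ring, ← mul_assoc, ← mul_assoc]
  congr 1
  rw [show p - 3 + 1 = p - 2 by ring,
    ← ENNReal.ofReal_mul (by positivity), ← ENNReal.ofReal_mul (by positivity)]
  congr 1
  have hγ2 : γ ^ (-(p - 2)) = 2 ^ (p - 2) * A ^ (p - 2) := by
    rw [hγd, one_div, Real.inv_rpow (by positivity), Real.rpow_neg (by positivity), inv_inv,
      Real.mul_rpow (by positivity) hA.le]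
  rw [hγ2]
  have : B ^ (2:ℝ) = B ^ 2 := by norm_cast
  rw [this]
  ring

end Marc

section Interp
variable {N : ℕ}

lemma integrable_q_ft {q f : (Fin N → ℝ) → ℂ} (hq : Integrable q) (hf : Integrable f) :
    Integrable (fun ξ => q ξ * fourierTransform f ξ) := by
  refine hq.mul_bdd (c := ∫ x, ‖f x‖) (continuous_fourierTransform hf).aestronglyMeasurable ?_
  refine Eventually.of_forall fun ξ => ?_
  rw [fourierTransform_eq_inv]
  exact norm_fourierInv_le _ _

lemma conv_eq {q f : (Fin N → ℝ) → ℂ} (hq : Integrable q) (hf : Integrable f) (x : Fin N → ℝ) :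
    fourierInv (fun ξ => q ξ * fourierTransform f ξ) x = ∫ y, fourierInv q (x - y) * f y := by
  rw [fourierInv_eq]
  have h1 : ∀ ξ, ew x ξ * (q ξ * fourierTransform f ξ) = ∫ y, ew (x - y) ξ * (q ξ * f y) := by
    intro ξ
    rw [fourierTransform_eq, ← integral_const_mul, ← integral_const_mul]
    congr 1; ext y
    rw [sub_eq_add_neg, ew_add_left, ew_comm (-ξ) y, ew_neg, ew_neg_left]
    ring
  simp_rw [h1]
  rw [integral_integral_swap]
  · congr 1; ext y
    rw [fourierInv_eq, ← integral_mul_const]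
    congr 1; ext ξ; ring
  · have := Integrable.mul_prod hq hf
    refine (this.bdd_mul (c := 1) (f := fun z => ew (x - z.2) z.1) ?_ ?_).congr ?_
    · exact (continuous_ew_comp (by fun_prop) (by fun_prop)).aestronglyMeasurable
    · exact Eventually.of_forall fun z => (norm_ew _ _).le
    · exact Eventually.of_forall fun z => rfl

lemma conv_add {q f g : (Fin N → ℝ) → ℂ} (hq : Integrable q) (hf : Integrable f) (hg : Integrable g)
    (x : Fin N → ℝ) :
    fourierInv (fun ξ => q ξ * fourierTransform (fun y => f y + g y) ξ) x =
    fourierInv (fun ξ => q ξ * fourierTransform f ξ) x +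
    fourierInv (fun ξ => q ξ * fourierTransform g ξ) x := by
  have hfg : Integrable (fun y => f y + g y) := hf.add hg
  rw [conv_eq hq hfg, conv_eq hq hf, conv_eq hq hg, ← integral_add]
  · congr 1; ext y; ring
  · refine hf.bdd_mul (c := ∫ ξ, ‖q ξ‖) ?_ (Eventually.of_forall fun y => norm_fourierInv_le _ _)
    exact ((continuous_fourierInv hq).comp (by fun_prop)).aestronglyMeasurable
  · refine hg.bdd_mul (c := ∫ ξ, ‖q ξ‖) ?_ (Eventually.of_forall fun y => norm_fourierInv_le _ _)
    exact ((continuous_fourierInv hq).comp (by fun_prop)).aestronglyMeasurable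

lemma conv_L1 {q f : (Fin N → ℝ) → ℂ} (hq : Integrable q) (hf : Integrable f) :
    ∫⁻ x, ‖fourierInv (fun ξ => q ξ * fourierTransform f ξ) x‖ₑ ≤
      (∫⁻ x, ‖fourierInv q x‖ₑ) * ∫⁻ y, ‖f y‖ₑ := by
  have hk := (continuous_fourierInv hq).measurable
  calc ∫⁻ x, ‖fourierInv (fun ξ => q ξ * fourierTransform f ξ) x‖ₑ
      ≤ ∫⁻ x, ∫⁻ y, ‖fourierInv q (x - y)‖ₑ * ‖f y‖ₑ := by
        refine lintegral_mono fun x => ?_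
        rw [conv_eq hq hf]
        refine (enorm_integral_le_lintegral_enorm _).trans (le_of_eq ?_)
        simp only [enorm_mul]
    _ = ∫⁻ y, ∫⁻ x, ‖fourierInv q (x - y)‖ₑ * ‖f y‖ₑ := by
        rw [lintegral_lintegral_swap]
        refine AEMeasurable.mul ?_ hf.aestronglyMeasurable.enorm.comp_snd
        exact (hk.enorm.comp (measurable_fst.sub measurable_snd)).aemeasurable
    _ = ∫⁻ y, (∫⁻ x, ‖fourierInv q x‖ₑ) * ‖f y‖ₑ := by
        refine lintegral_congr fun y => ?_
        rw [lintegral_mul_const'  _ _ enorm_ne_top, lintegral_sub_right_eq_self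
          (μ := (volume : Measure (Fin N → ℝ))) (fun x => ‖fourierInv q x‖ₑ) y]
    _ = _ := by rw [lintegral_const_mul'' _ hf.aestronglyMeasurable.enorm]

lemma conv_Linf {q f : (Fin N → ℝ) → ℂ} (hq : Integrable q) (hf : Integrable f) {A M : ℝ}
    (hA : 0 ≤ A) (hM : 0 ≤ M)
    (hk : ∫⁻ x, ‖fourierInv q x‖ₑ ≤ ENNReal.ofReal A) (hfM : ∀ y, ‖f y‖ ≤ M) (x : Fin N → ℝ) :
    ‖fourierInv (fun ξ => q ξ * fourierTransform f ξ) x‖ ≤ A * M := by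
  rw [conv_eq hq hf]
  have : ‖∫ y, fourierInv q (x - y) * f y‖ₑ ≤ ENNReal.ofReal (A * M) := by
    refine (enorm_integral_le_lintegral_enorm _).trans ?_
    calc ∫⁻ y, ‖fourierInv q (x - y) * f y‖ₑ ≤ ∫⁻ y, ‖fourierInv q (x - y)‖ₑ * ENNReal.ofReal M := by
          refine lintegral_mono fun y => ?_
          rw [enorm_mul]
          gcongr
          rw [← ofReal_norm]
          exact ENNReal.ofReal_le_ofReal (hfM y)
      _ = (∫⁻ y, ‖fourierInv q y‖ₑ) * ENNReal.ofReal M := by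
          rw [lintegral_mul_const' _ _ ENNReal.ofReal_ne_top, lintegral_sub_left_eq_self
          (μ := (volume : Measure (Fin N → ℝ))) (fun x => ‖fourierInv q x‖ₑ) x]
      _ ≤ _ := by
          rw [ENNReal.ofReal_mul hA]
          gcongr
  rw [← ofReal_norm] at this
  exact (ENNReal.ofReal_le_ofReal_iff (by positivity)).1 this

lemma conv_L2 {q f : (Fin N → ℝ) → ℂ} (hq : Integrable q) (hf : Integrable f) {B : ℝ}
    (hB : ∀ ξ, ‖q ξ‖ ≤ B) (hB0 : 0 ≤ B) :
    ∫⁻ x, ‖fourierInv (fun ξ => q ξ * fourierTransform f ξ) x‖ₑ ^ 2 ≤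
      ENNReal.ofReal (B ^ 2) * ∫⁻ y, ‖f y‖ₑ ^ 2 := by
  refine (plancherel_inv (integrable_q_ft hq hf)).trans ?_
  calc ∫⁻ ξ, ‖q ξ * fourierTransform f ξ‖ₑ ^ 2 ≤
      ∫⁻ ξ, ENNReal.ofReal (B ^ 2) * ‖fourierTransform f ξ‖ₑ ^ 2 := by
        refine lintegral_mono fun ξ => ?_
        rw [enorm_mul, mul_pow, ENNReal.ofReal_pow hB0]
        gcongr
        rw [← ofReal_norm]
        exact ENNReal.ofReal_le_ofReal (hB ξ)
    _ ≤ _ := by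
        rw [lintegral_const_mul' _ _ ENNReal.ofReal_ne_top]
        exact mul_le_mul_right (plancherel_ft hf) _

lemma cheb1 {u : (Fin N → ℝ) → ℂ} {s : ℝ} (hs : 0 < s) (hu : AEStronglyMeasurable u volume) :
    volume {x | s / 2 ≤ ‖u x‖} ≤ ENNReal.ofReal (2 / s) * ∫⁻ x, ‖u x‖ₑ := by
  have h := meas_ge_le_lintegral_div (μ := volume) hu.enorm (ε := ENNReal.ofReal (s / 2))
    (by positivity) ENNReal.ofReal_ne_top
  refine (measure_mono ?_).trans (h.trans (le_of_eq ?_))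
  · intro x hx
    show _ ≤ ‖u x‖ₑ
    rw [← ofReal_norm]
    exact ENNReal.ofReal_le_ofReal hx
  · rw [ENNReal.div_eq_inv_mul, ← ENNReal.ofReal_inv_of_pos (by positivity), inv_div]

lemma cheb2 {u : (Fin N → ℝ) → ℂ} {s : ℝ} (hs : 0 < s) (hu : AEStronglyMeasurable u volume) :
    volume {x | s / 2 ≤ ‖u x‖} ≤ ENNReal.ofReal (4 / s ^ 2) * ∫⁻ x, ‖u x‖ₑ ^ 2 := by
  have h := meas_ge_le_lintegral_div (μ := volume) (hu.enorm.pow_const 2) (ε := ENNReal.ofReal ((s / 2) ^ 2))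
    (by positivity) ENNReal.ofReal_ne_top
  refine (measure_mono ?_).trans (h.trans (le_of_eq ?_))
  · intro x hx
    show _ ≤ ‖u x‖ₑ ^ 2
    rw [← ofReal_norm, ← ENNReal.ofReal_pow (norm_nonneg _)]
    have hx : s / 2 ≤ ‖u x‖ := hx
    exact ENNReal.ofReal_le_ofReal (by gcongr)
  · rw [ENNReal.div_eq_inv_mul, ← ENNReal.ofReal_inv_of_pos (by positivity)]
    congr 2
    rw [div_pow, inv_div]; norm_num

lemma interp_lint {p : ℝ} (hp : 1 < p) : ∃ C : ℝ, 0 < C ∧ ∀ (q f : (Fin N → ℝ) → ℂ) (A B : ℝ),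
    0 < A → 0 < B → Integrable q → Integrable f → Measurable f → (∀ ξ, ‖q ξ‖ ≤ B) →
    (∫⁻ x, ‖fourierInv q x‖ₑ ≤ ENNReal.ofReal A) →
    ∫⁻ x, ENNReal.ofReal (‖fourierInv (fun ξ => q ξ * fourierTransform f ξ) x‖ ^ p) ≤
      ENNReal.ofReal (C * (A ^ (1 - 2 * min (1 / p) (1 - 1 / p)) * B ^ (2 * min (1 / p) (1 - 1 / p))) ^ p) *
        ∫⁻ x, ENNReal.ofReal (‖f x‖ ^ p) := by
  have hp0 : 0 < p := by linarith
  have hpow : ∀ (A B θ : ℝ), 0 < A → 0 < B → (A ^ (1 - θ) * B ^ θ) ^ p = A ^ (p - θ * p) * B ^ (θ * p) := by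
    intro A B θ hA hB
    rw [Real.mul_rpow (by positivity) (by positivity), ← Real.rpow_mul hA.le, ← Real.rpow_mul hB.le]
    congr 2; ring
  -- pieces
  have hbigm : ∀ (f : (Fin N → ℝ) → ℂ), Measurable f → ∀ c : ℝ, MeasurableSet {x | c ≤ ‖f x‖} :=
    fun f hf c => measurableSet_le measurable_const hf.norm
  have split : ∀ (q f : (Fin N → ℝ) → ℂ), Integrable q → Integrable f → Measurable f → ∀ c s : ℝ,
    {x | s < ‖fourierInv (fun ξ => q ξ * fourierTransform f ξ) x‖} ⊆
      {x | s / 2 ≤ ‖fourierInv (fun ξ => q ξ * fourierTransform ({x | c ≤ ‖f x‖}.indicator f) ξ) x‖} ∪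
      {x | s / 2 < ‖fourierInv (fun ξ => q ξ * fourierTransform ({x | c ≤ ‖f x‖}ᶜ.indicator f) ξ) x‖} := by
    intro q f hq hf hfm c s x hx
    have h1 := conv_add hq (hf.indicator (hbigm f hfm c)) (hf.indicator (hbigm f hfm c).compl) x
    have h2 : (fun y => {x | c ≤ ‖f x‖}.indicator f y + {x | c ≤ ‖f x‖}ᶜ.indicator f y) = f := by
      ext y; exact congrFun (indicator_self_add_compl _ f) y
    rw [h2] at h1
    by_contra hcon
    simp only [mem_union, mem_ofPred_eq, not_or, not_le, not_lt] at hcon hx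
    rw [h1] at hx
    have := norm_add_le (fourierInv (fun ξ => q ξ * fourierTransform ({x | c ≤ ‖f x‖}.indicator f) ξ) x)
      (fourierInv (fun ξ => q ξ * fourierTransform ({x | c ≤ ‖f x‖}ᶜ.indicator f) ξ) x)
    linarith [hcon.1, hcon.2]
  have meas : ∀ (q f : (Fin N → ℝ) → ℂ), Integrable q → Integrable f →
      Continuous (fourierInv (fun ξ => q ξ * fourierTransform f ξ)) :=
    fun q f hq hf => continuous_fourierInv (integrable_q_ft hq hf)
  have big2 : ∀ (f : (Fin N → ℝ) → ℂ) (c : ℝ), ∫⁻ x, ‖{x | c ≤ ‖f x‖}.indicator f x‖ₑ ^ 2 =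
      ∫⁻ x, ENNReal.ofReal (if c ≤ ‖f x‖ then ‖f x‖ ^ (2:ℝ) else 0) := by
    intro f c
    refine lintegral_congr fun x => ?_
    by_cases h : c ≤ ‖f x‖
    · rw [indicator_of_mem (show x ∈ {x | c ≤ ‖f x‖} from h), if_pos h, ← ofReal_norm,
        ← ENNReal.ofReal_pow (norm_nonneg _)]
      norm_cast
    · rw [indicator_of_notMem (show x ∉ {x | c ≤ ‖f x‖} from h), if_neg h]
      simp
  have big1 : ∀ (f : (Fin N → ℝ) → ℂ) (c : ℝ), ∫⁻ x, ‖{x | c ≤ ‖f x‖}.indicator f x‖ₑ =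
      ∫⁻ x, ENNReal.ofReal (if c ≤ ‖f x‖ then ‖f x‖ ^ (1:ℝ) else 0) := by
    intro f c
    refine lintegral_congr fun x => ?_
    by_cases h : c ≤ ‖f x‖
    · rw [indicator_of_mem (show x ∈ {x | c ≤ ‖f x‖} from h), if_pos h, ← ofReal_norm, Real.rpow_one]
    · rw [indicator_of_notMem (show x ∉ {x | c ≤ ‖f x‖} from h), if_neg h]
      simp
  have small2 : ∀ (f : (Fin N → ℝ) → ℂ) (c : ℝ), ∫⁻ x, ‖{x | c ≤ ‖f x‖}ᶜ.indicator f x‖ₑ ^ 2 =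
      ∫⁻ x, ENNReal.ofReal (if ‖f x‖ < c then ‖f x‖ ^ (2:ℝ) else 0) := by
    intro f c
    refine lintegral_congr fun x => ?_
    by_cases h : ‖f x‖ < c
    · rw [indicator_of_mem (show x ∈ {x | c ≤ ‖f x‖}ᶜ from not_le.2 h), if_pos h, ← ofReal_norm,
        ← ENNReal.ofReal_pow (norm_nonneg _)]
      norm_cast
    · rw [indicator_of_notMem (show x ∉ {x | c ≤ ‖f x‖}ᶜ from fun h' => h (not_le.1 h')), if_neg h]
      simp
  rcases lt_trichotomy p 2 with h2 | h2 | h2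
  · have hp1 : 0 < p - 1 := by linarith
    have hp2 : 0 < 2 - p := by linarith
    refine ⟨p * (2 / (p - 1) + 4 / (2 - p)), by positivity, ?_⟩
    intro q f A B hA hB hq hf hfm hqB hk
    have hmin : min (1 / p) (1 - 1 / p) = 1 - 1 / p := by
      apply min_eq_right
      have : 1 / 2 < 1 / p := one_div_lt_one_div_of_lt hp0 h2
      linarith
    rw [hmin, hpow _ _ _ hA hB, show p - 2 * (1 - 1 / p) * p = 2 - p by field_simp; ring,
      show 2 * (1 - 1 / p) * p = 2 * p - 2 by field_simp]
    refine marc_lt hp h2 hA hB hfm.norm (fun x => norm_nonneg _)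
      (meas q f hq hf).norm.measurable.aemeasurable (fun x => norm_nonneg _) ?_
    intro s hs
    set c := A / B ^ 2 * s
    have hi1 := hf.indicator (hbigm f hfm c)
    have hi2 := hf.indicator (hbigm f hfm c).compl
    refine (measure_mono (split q f hq hf hfm c s)).trans ((measure_union_le _ _).trans (add_le_add ?_ ?_))
    · refine (cheb1 hs (meas q _ hq hi1).aestronglyMeasurable).trans ?_
      refine (mul_le_mul_right (conv_L1 hq hi1) _).trans ?_
      rw [big1, ← mul_assoc]
      gcongr
      refine (mul_le_mul_right hk _).trans (le_of_eq ?_)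
      rw [← ENNReal.ofReal_mul (by positivity)]
      congr 1; ring
    · refine (measure_mono fun x hx => ?_).trans ((cheb2 hs (meas q _ hq hi2).aestronglyMeasurable).trans ?_)
      · exact le_of_lt (show s / 2 < _ from hx)
      refine (mul_le_mul_right (conv_L2 hq hi2 hqB hB.le) _).trans ?_
      rw [small2, ← mul_assoc]
      gcongr
      refine (le_of_eq ?_)
      rw [← ENNReal.ofReal_mul (by positivity)]
      congr 1; ring
  · subst h2
    refine ⟨1, one_pos, ?_⟩
    intro q f A B hA hB hq hf hfm hqB hk
    have hmin : min (1 / 2 : ℝ) (1 - 1 / 2) = 1 / 2 := by norm_num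
    rw [hmin, hpow _ _ _ hA hB]
    have h := conv_L2 hq hf hqB hB.le
    have e : ∀ z : ℂ, ENNReal.ofReal (‖z‖ ^ (2:ℝ)) = ‖z‖ₑ ^ 2 := by
      intro z
      rw [← ofReal_norm, ← ENNReal.ofReal_pow (norm_nonneg _)]; norm_cast
    simp_rw [e]
    refine h.trans (le_of_eq ?_)
    congr 2
    norm_num
  · have hp2 : 0 < p - 2 := by linarith
    refine ⟨p * (4 / (p - 2)) * 2 ^ (p - 2), by positivity, ?_⟩
    intro q f A B hA hB hq hf hfm hqB hk
    have hmin : min (1 / p) (1 - 1 / p) = 1 / p := by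
      apply min_eq_left
      have : 1 / p < 1 / 2 := one_div_lt_one_div_of_lt two_pos h2
      linarith
    rw [hmin, hpow _ _ _ hA hB, show p - 2 * (1 / p) * p = p - 2 by field_simp,
      show 2 * (1 / p) * p = 2 by field_simp]
    refine marc_gt h2 hA hB hfm.norm (fun x => norm_nonneg _)
      (meas q f hq hf).norm.measurable.aemeasurable (fun x => norm_nonneg _) ?_
    intro s hs
    set c := 1 / (2 * A) * s with hc
    have hi1 := hf.indicator (hbigm f hfm c)
    have hi2 := hf.indicator (hbigm f hfm c).compl
    have hempty : {x | s / 2 < ‖fourierInv (fun ξ => q ξ * fourierTransform ({x | c ≤ ‖f x‖}ᶜ.indicator f) ξ) x‖} = ∅ := by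
      refine eq_empty_of_forall_notMem fun x hx => ?_
      have hx : s / 2 < _ := hx
      have := conv_Linf hq hi2 hA.le (M := c) (by positivity) hk ?_ x
      · have e : A * c = s / 2 := by rw [hc]; field_simp
        linarith
      · intro y
        by_cases h : ‖f y‖ < c
        · rw [indicator_of_mem (show y ∈ {x | c ≤ ‖f x‖}ᶜ from not_le.2 h)]
          exact h.le
        · rw [indicator_of_notMem (show y ∉ {x | c ≤ ‖f x‖}ᶜ from fun h' => h (not_le.1 h'))]
          simp; positivity
    refine (measure_mono (split q f hq hf hfm c s)).trans ?_
    rw [hempty, union_empty]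
    refine (cheb2 hs (meas q _ hq hi1).aestronglyMeasurable).trans ?_
    refine (mul_le_mul_right (conv_L2 hq hi1 hqB hB.le) _).trans ?_
    rw [big2, ← mul_assoc]
    gcongr
    refine (le_of_eq ?_)
    rw [← ENNReal.ofReal_mul (by positivity)]
    congr 1; ring

lemma eLpNorm_eq_lint {p : ℝ} (hp : 0 < p) (f : (Fin N → ℝ) → ℂ) :
    eLpNorm f (ENNReal.ofReal p) volume = (∫⁻ x, ENNReal.ofReal (‖f x‖ ^ p)) ^ (1 / p) := by
  rw [eLpNorm_eq_lintegral_rpow_enorm_toReal (by simpa using hp) ENNReal.ofReal_ne_top,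
    ENNReal.toReal_ofReal hp.le]
  congr 2
  ext x
  rw [← ofReal_norm, ENNReal.ofReal_rpow_of_nonneg (norm_nonneg _) hp.le]

theorem interp {p : ℝ} (hp : 1 < p) : ∃ C : ℝ, 0 < C ∧ ∀ (q f : (Fin N → ℝ) → ℂ) (A B : ℝ),
    0 < A → 0 < B → Integrable q → Integrable f → Measurable f → (∀ ξ, ‖q ξ‖ ≤ B) →
    (∫⁻ x, ‖fourierInv q x‖ₑ ≤ ENNReal.ofReal A) →
    eLpNorm (fourierInv (fun ξ => q ξ * fourierTransform f ξ)) (ENNReal.ofReal p) volume ≤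
      ENNReal.ofReal (C * (A ^ (1 - 2 * min (1 / p) (1 - 1 / p)) * B ^ (2 * min (1 / p) (1 - 1 / p)))) *
        eLpNorm f (ENNReal.ofReal p) volume := by
  have hp0 : 0 < p := by linarith
  obtain ⟨C, hC, h⟩ := interp_lint (N := N) hp
  refine ⟨C ^ (1 / p), by positivity, ?_⟩
  intro q f A B hA hB hq hf hfm hqB hk
  have := h q f A B hA hB hq hf hfm hqB hk
  rw [eLpNorm_eq_lint hp0, eLpNorm_eq_lint hp0]
  refine (ENNReal.rpow_le_rpow this (by positivity)).trans (le_of_eq ?_)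
  rw [ENNReal.mul_rpow_of_nonneg _ _ (by positivity)]
  congr 1
  rw [ENNReal.ofReal_rpow_of_nonneg (by positivity) (by positivity)]
  congr 1
  rw [Real.mul_rpow hC.le (by positivity), ← Real.rpow_mul (by positivity), mul_one_div_cancel hp0.ne',
    Real.rpow_one]

end Interp

end

section


/-! ## Integrability of the weights -/

/-- the box of points with nonzero coordinates of size less than `δ` -/
def pbox (n : ℕ) (δ : ℝ) : Set (Fin n → ℝ) := {t | ∀ i, 0 < |t i| ∧ |t i| < δ}

/-- the positive box -/
def posbox (n : ℕ) (δ : ℝ) : Set (Fin n → ℝ) := {t | ∀ i, t i ∈ Set.Ioo 0 δ}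

/-- the minimum of the coordinates and `σ` -/
def mmin (σ : (Fin n → ℝ) → ℝ) (t : Fin n → ℝ) : ℝ := min (⨅ i, |t i|) (σ t)

lemma measurableSet_posbox (n : ℕ) (δ : ℝ) : MeasurableSet (posbox n δ) := by
  have : posbox n δ = Set.univ.pi (fun _ => Set.Ioo 0 δ) := by
    ext t; simp [posbox]
  rw [this]
  exact MeasurableSet.univ_pi fun _ => measurableSet_Ioo

lemma measurableSet_pbox (n : ℕ) (δ : ℝ) : MeasurableSet (pbox n δ) := by
  have : pbox n δ = ⋂ i, {t | 0 < |t i| ∧ |t i| < δ} := by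
    ext t; simp [pbox]
  rw [this]
  refine MeasurableSet.iInter fun i => ?_
  have hm : Measurable (fun t : Fin n → ℝ => |t i|) := by fun_prop
  exact (measurableSet_lt measurable_const hm).inter (measurableSet_lt hm measurable_const)

lemma measurable_grpNorm (grp : Fin n → Fin m) (k : Fin m) : Measurable (grpNorm grp k) := by
  unfold grpNorm; fun_prop

lemma measurable_kernelWeight (grp : Fin n → Fin m) (a : Fin m → ℝ) :
    Measurable (kernelWeight grp a) := by
  unfold kernelWeight
  have := measurable_grpNorm grp
  fun_prop

lemma grpNorm_nonneg (grp : Fin n → Fin m) (k : Fin m) (t : Fin n → ℝ) : 0 ≤ grpNorm grp k t :=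
  Real.sqrt_nonneg _

lemma kernelWeight_nonneg (grp : Fin n → Fin m) (a : Fin m → ℝ) (t : Fin n → ℝ) :
    0 ≤ kernelWeight grp a t :=
  Finset.prod_nonneg fun k _ => Real.rpow_nonneg (grpNorm_nonneg _ _ _) _

lemma abs_le_grpNorm (grp : Fin n → Fin m) (t : Fin n → ℝ) (i : Fin n) :
    |t i| ≤ grpNorm grp (grp i) t := by
  unfold grpNorm
  rw [← Real.sqrt_sq_eq_abs]
  refine Real.sqrt_le_sqrt ?_
  exact Finset.single_le_sum (f := fun i => t i ^ 2) (fun j _ => sq_nonneg _) (by simp)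

lemma grpNorm_pos (grp : Fin n → Fin m) (hgrp : Function.Surjective grp) (k : Fin m) {t : Fin n → ℝ}
    (ht : ∀ i, t i ≠ 0) : 0 < grpNorm grp k t := by
  obtain ⟨i, rfl⟩ := hgrp k
  exact (abs_pos.2 (ht i)).trans_le (abs_le_grpNorm grp t i)

lemma kernelWeight_pos (grp : Fin n → Fin m) (hgrp : Function.Surjective grp) (a : Fin m → ℝ)
    {t : Fin n → ℝ} (ht : ∀ i, t i ≠ 0) : 0 < kernelWeight grp a t :=
  Finset.prod_pos fun k _ => Real.rpow_pos_of_pos (grpNorm_pos grp hgrp k ht) _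

lemma kernelWeight_abs (grp : Fin n → Fin m) (a : Fin m → ℝ) (t : Fin n → ℝ) :
    kernelWeight grp a (fun i => |t i|) = kernelWeight grp a t := by
  unfold kernelWeight grpNorm
  simp only [sq_abs]

lemma lint_prod_lt_top {δ : ℝ} (hδ : 0 < δ) {e : Fin n → ℝ} (he : ∀ i, e i < 1) :
    ∫⁻ t in posbox n δ, ENNReal.ofReal (∏ i, t i ^ (-(e i))) < ⊤ := by
  have h1 : ∀ i, Integrable ((Set.Ioo 0 δ).indicator (fun x : ℝ => x ^ (-(e i)))) := by
    intro i
    rw [integrable_indicator_iff measurableSet_Ioo]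
    have := (intervalIntegral.intervalIntegrable_rpow' (a := 0) (b := δ) (r := -(e i)) (by linarith [he i]))
    exact ((intervalIntegrable_iff_integrableOn_Ioc_of_le hδ.le).1 this).mono_set Ioo_subset_Ioc_self
  have h2 := Integrable.fintype_prod h1
  have h3 : ∫⁻ t in posbox n δ, ENNReal.ofReal (∏ i, t i ^ (-(e i))) =
      ∫⁻ t : Fin n → ℝ, ENNReal.ofReal (∏ i, (Set.Ioo 0 δ).indicator (fun x : ℝ => x ^ (-(e i))) (t i)) := by
    rw [← lintegral_indicator (measurableSet_posbox n δ)]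
    refine lintegral_congr fun t => ?_
    by_cases ht : t ∈ posbox n δ
    · rw [indicator_of_mem ht]
      congr 1
      refine Finset.prod_congr rfl fun i _ => ?_
      rw [indicator_of_mem (ht i)]
    · rw [indicator_of_notMem ht]
      have : ∃ i, t i ∉ Set.Ioo 0 δ := by
        by_contra hc; push Not at hc; exact ht hc
      obtain ⟨i, hi⟩ := this
      rw [Finset.prod_eq_zero (Finset.mem_univ i) (indicator_of_notMem hi _)]
      simp
  rw [h3]
  exact h2.lintegral_lt_top

lemma int_coord (grp : Fin n → Fin m) (hgrp : Function.Surjective grp)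
    (l : Fin m → ℕ) (hl : ∀ k, l k = (Finset.univ.filter (fun i => grp i = k)).card)
    (a : Fin m → ℝ) (ha : ∀ k, 0 ≤ a k ∧ a k < l k) {δ β : ℝ} (hδ : 0 < δ) (i : Fin n)
    (hβ0 : 0 ≤ β) (hβ1 : β < 1) (hβ : β < l (grp i) - a (grp i)) :
    ∫⁻ t in posbox n δ, ENNReal.ofReal (kernelWeight grp a t) * ENNReal.ofReal |t i| ^ (-β) < ⊤ := by
  set b : Fin m → ℝ := fun k => if k = grp i then β else 0 with hb
  set b' : Fin n → ℝ := fun j => if j = i then β else 0 with hb'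
  set e : Fin n → ℝ := fun j => a (grp j) * ((1 - b' j) / (l (grp j) - b (grp j))) + b' j with he
  have hlb : ∀ k, a k < l k - b k := by
    intro k
    by_cases h : k = grp i
    · subst h; simp only [hb, if_true]; linarith
    · simp only [hb, if_neg h]; linarith [(ha k).2]
  have hlb0 : ∀ k, 0 < l k - b k := fun k => (ha k).1.trans_lt (hlb k)
  have hb'1 : ∀ j, 0 < 1 - b' j := by
    intro j; simp only [hb']; split_ifs <;> linarith
  have he1 : ∀ j, e j < 1 := by
    intro j
    have h1 := hlb (grp j)
    have h2 := hlb0 (grp j)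
    have h3 := hb'1 j
    have : a (grp j) * ((1 - b' j) / (l (grp j) - b (grp j))) < 1 - b' j := by
      rw [mul_div_assoc', div_lt_iff₀ h2, mul_comm]
      exact mul_lt_mul_of_pos_left h1 h3
    simp only [he]; linarith
  have hsum : ∀ k, ∑ j ∈ Finset.univ.filter (fun j => grp j = k), (1 - b' j) / (l (grp j) - b (grp j)) = 1 := by
    intro k
    have : ∀ j ∈ Finset.univ.filter (fun j => grp j = k), (1 - b' j) / (l (grp j) - b (grp j)) =
        (1 - b' j) / (l k - b k) := by
      intro j hj
      rw [(Finset.mem_filter.1 hj).2]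
    rw [Finset.sum_congr rfl this, ← Finset.sum_div, Finset.sum_sub_distrib]
    rw [div_eq_one_iff_eq (hlb0 k).ne']
    congr 1
    · rw [hl k]; simp
    · simp only [hb', hb]
      rw [Finset.sum_ite_eq']
      simp [eq_comm]
  have hpt : ∀ t ∈ posbox n δ, ENNReal.ofReal (kernelWeight grp a t) * ENNReal.ofReal |t i| ^ (-β) ≤
      ENNReal.ofReal (∏ j, t j ^ (-(e j))) := by
    intro t ht
    have hti : ∀ j, 0 < t j := fun j => (ht j).1
    rw [abs_of_pos (hti i), ENNReal.ofReal_rpow_of_pos (hti i), ← ENNReal.ofReal_mul (kernelWeight_nonneg _ _ _)]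
    refine ENNReal.ofReal_le_ofReal ?_
    have h1 : ∏ j, t j ^ (-(e j)) = (∏ j, (t j ^ (-( a (grp j) * ((1 - b' j) / (l (grp j) - b (grp j))))))) *
        ∏ j, t j ^ (-(b' j)) := by
      rw [← Finset.prod_mul_distrib]
      refine Finset.prod_congr rfl fun j _ => ?_
      rw [← Real.rpow_add (hti j)]
      congr 1; simp only [he]; ring
    have h2 : ∏ j, t j ^ (-(b' j)) = t i ^ (-β) := by
      rw [Finset.prod_eq_single i]
      · simp [hb']
      · intro j _ hj; simp [hb', hj]
      · simp
    rw [h1, h2]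
    refine mul_le_mul_of_nonneg_right ?_ (Real.rpow_nonneg (hti i).le _)
    rw [← Finset.prod_fiberwise (g := grp)]
    unfold kernelWeight
    refine Finset.prod_le_prod (fun k _ => Real.rpow_nonneg (grpNorm_nonneg _ _ _) _) fun k _ => ?_
    have hG : 0 < grpNorm grp k t := grpNorm_pos grp hgrp k fun j => (hti j).ne'
    calc grpNorm grp k t ^ (-(a k)) = ∏ j ∈ Finset.univ.filter (fun j => grp j = k),
          grpNorm grp k t ^ (-( a (grp j) * ((1 - b' j) / (l (grp j) - b (grp j))))) := by
          rw [← Real.rpow_sum_of_pos hG]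
          congr 1
          rw [Finset.sum_neg_distrib]
          congr 1
          have : ∀ j ∈ Finset.univ.filter (fun j => grp j = k),
              a (grp j) * ((1 - b' j) / (l (grp j) - b (grp j))) =
              a k * ((1 - b' j) / (l (grp j) - b (grp j))) := by
            intro j hj
            rw [(Finset.mem_filter.1 hj).2]
          rw [Finset.sum_congr rfl this, ← Finset.mul_sum, hsum, mul_one]
      _ ≤ _ := by
          refine Finset.prod_le_prod (fun j _ => Real.rpow_nonneg hG.le _) fun j hj => ?_
          have hjk : grp j = k := (Finset.mem_filter.1 hj).2
          refine Real.rpow_le_rpow_of_nonpos (hti j) ?_ ?_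
          · have := abs_le_grpNorm grp t j
            rw [hjk, abs_of_pos (hti j)] at this
            exact this
          · have := div_nonneg (hb'1 j).le (hlb0 (grp j)).le
            have := mul_nonneg (ha (grp j)).1 this
            linarith
  exact (setLIntegral_mono' (measurableSet_posbox n δ) hpt).trans_lt (lint_prod_lt_top hδ he1)

lemma int_kw (grp : Fin n → Fin m) (hgrp : Function.Surjective grp) (hn : 0 < n)
    (l : Fin m → ℕ) (hl : ∀ k, l k = (Finset.univ.filter (fun i => grp i = k)).card)
    (a : Fin m → ℝ) (ha : ∀ k, 0 ≤ a k ∧ a k < l k) {δ : ℝ} (hδ : 0 < δ) :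
    ∫⁻ t in posbox n δ, ENNReal.ofReal (kernelWeight grp a t) < ⊤ := by
  have := int_coord grp hgrp l hl a ha hδ ⟨0, hn⟩ (le_refl (0:ℝ)) one_pos
    (by linarith [(ha (grp ⟨0, hn⟩)).2])
  simpa using this

lemma dyadic_bound {σ β : ℝ} (hσ : 0 < σ) (hβ : 0 < β) :
    ENNReal.ofReal σ ^ (-β) ≤ ENNReal.ofReal (8 ^ β) +
      ∑' k : ℕ, (if σ < (1/2) ^ (k + 2) then ENNReal.ofReal (2 ^ (β * (k + 4))) else 0) := by
  rw [ENNReal.ofReal_rpow_of_pos hσ]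
  by_cases h : 1 / 8 ≤ σ
  · refine le_add_right (ENNReal.ofReal_le_ofReal ?_)
    calc σ ^ (-β) ≤ (1/8 : ℝ) ^ (-β) := Real.rpow_le_rpow_of_nonpos (by norm_num) h (by linarith)
      _ = 8 ^ β := by rw [one_div, Real.inv_rpow (by norm_num), Real.rpow_neg (by norm_num), inv_inv]
  · push Not at h
    obtain ⟨N, hN1, hN2⟩ := exists_nat_pow_near_of_lt_one hσ (by linarith : σ ≤ 1) (by norm_num : (0:ℝ) < 1/2)
      (by norm_num)
    have hN3 : 3 ≤ N := by
      by_contra hc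
      have : N + 1 ≤ 3 := by omega
      have : (1/2 : ℝ) ^ 3 ≤ (1/2) ^ (N + 1) := pow_le_pow_of_le_one (by norm_num) (by norm_num) this
      norm_num at this h
      linarith
    obtain ⟨k, rfl⟩ := Nat.exists_eq_add_of_le' hN3
    refine le_add_left (le_trans ?_ (ENNReal.le_tsum k))
    rw [if_pos]
    · refine ENNReal.ofReal_le_ofReal ?_
      calc σ ^ (-β) ≤ ((1/2 : ℝ) ^ (k + 3 + 1)) ^ (-β) :=
            Real.rpow_le_rpow_of_nonpos (by positivity) hN1.le (by linarith)
        _ = 2 ^ (β * (k + 4)) := by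
            rw [← Real.rpow_natCast, ← Real.rpow_mul (by norm_num), one_div, Real.inv_rpow (by norm_num),
              ← Real.rpow_neg (by norm_num)]
            congr 1
            push_cast; ring
    · refine hN2.trans_lt ?_
      exact pow_lt_pow_right_of_lt_one₀ (by norm_num) (by norm_num) (by omega)

lemma summ_aux (d : ℕ) {r : ℝ} (hr0 : 0 < r) (hr : r < 1) :
    Summable (fun k : ℕ => ((k : ℝ) + 2) ^ d * r ^ k) := by
  have h1 : ‖r‖ < 1 := by rwa [Real.norm_of_nonneg hr0.le]
  have h2 : Summable (fun k : ℕ => (k : ℝ) ^ d * r ^ k) := summable_pow_mul_geometric_of_norm_lt_one d h1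
  have h3 : Summable (fun k : ℕ => ((k + 2 : ℕ) : ℝ) ^ d * r ^ (k + 2)) :=
    h2.comp_injective (add_left_injective 2)
  have h4 : (fun k : ℕ => ((k : ℝ) + 2) ^ d * r ^ k) =
      fun k : ℕ => (r ^ 2)⁻¹ * (((k + 2 : ℕ) : ℝ) ^ d * r ^ (k + 2)) := by
    ext k
    have h5 : (r ^ 2)⁻¹ * r ^ 2 = 1 := inv_mul_cancel₀ (by positivity)
    rw [pow_add r k 2]
    push_cast
    calc _ = ((k : ℝ) + 2) ^ d * r ^ k * 1 := by ring
      _ = _ := by rw [← h5]; ring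
  rw [h4]
  exact h3.mul_left _

set_option maxHeartbeats 800000 in
lemma int_sigma (grp : Fin n → Fin m) (hgrp : Function.Surjective grp) (hn : 0 < n)
    (l : Fin m → ℕ) (hl : ∀ k, l k = (Finset.univ.filter (fun i => grp i = k)).card)
    (a : Fin m → ℝ) (ha : ∀ k, 0 ≤ a k ∧ a k < l k) {c : (Fin n → ℕ) → ℝ} {a₀ B δ β : ℝ} {d₀ : ℕ}
    {σ : (Fin n → ℝ) → ℝ} (hσm : Measurable σ) (hσ0 : ∀ t, (∀ i, t i ≠ 0) → 0 < σ t)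
    (hσ : ∀ t, (∀ i, t i ≠ 0) → starFn c t ≤ σ t)
    (hδ : 0 < δ) (hβ0 : 0 < β) (hβ : β < a₀)
    (hB : 0 < B)
    (hS : ∀ ε : ℝ, 0 < ε → ε < 1/2 → fracMeasure grp a {t | (∀ i, t i ∈ Set.Ioo 0 δ) ∧ starFn c t < ε} <
          ENNReal.ofReal (B * ε ^ a₀ * |Real.log ε| ^ d₀)) :
    ∫⁻ t in posbox n δ, ENNReal.ofReal (kernelWeight grp a t) * ENNReal.ofReal (σ t) ^ (-β) < ⊤ := by
  have hkm : Measurable (fun t => ENNReal.ofReal (kernelWeight grp a t)) :=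
    (measurable_kernelWeight grp a).ennreal_ofReal
  have hme : ∀ ε, MeasurableSet {t : Fin n → ℝ | σ t < ε} := fun ε => measurableSet_lt hσm measurable_const
  have h1 : ∫⁻ t in posbox n δ, ENNReal.ofReal (kernelWeight grp a t) * ENNReal.ofReal (σ t) ^ (-β) ≤
      ∫⁻ t in posbox n δ, (ENNReal.ofReal (kernelWeight grp a t) * ENNReal.ofReal (8 ^ β) +
        ∑' k : ℕ, ({t : Fin n → ℝ | σ t < (1/2) ^ (k + 2)}.indicator
          (fun t => ENNReal.ofReal (kernelWeight grp a t)) t) * ENNReal.ofReal (2 ^ (β * (k + 4)))) := by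
    refine setLIntegral_mono' (measurableSet_posbox n δ) fun t ht => ?_
    refine (mul_le_mul_right (dyadic_bound (hσ0 t fun i => (ht i).1.ne') hβ0) _).trans (le_of_eq ?_)
    rw [mul_add, ← ENNReal.tsum_mul_left]
    congr 2
    ext k
    by_cases h : σ t < (1/2) ^ (k + 2)
    · rw [if_pos h, indicator_of_mem (show t ∈ {t : Fin n → ℝ | σ t < (1/2) ^ (k + 2)} from h)]
    · rw [if_neg h, indicator_of_notMem (show t ∉ {t : Fin n → ℝ | σ t < (1/2) ^ (k + 2)} from h)]
      simp
  refine h1.trans_lt ?_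
  rw [lintegral_add_left (hkm.mul_const _), lintegral_mul_const _ hkm]
  refine ENNReal.add_lt_top.2 ⟨ENNReal.mul_lt_top (int_kw grp hgrp hn l hl a ha hδ) ENNReal.ofReal_lt_top, ?_⟩
  rw [lintegral_tsum (fun k => ((hkm.indicator (hme _)).mul_const _).aemeasurable)]
  have h2 : ∀ k : ℕ, ∫⁻ t in posbox n δ, ({t : Fin n → ℝ | σ t < (1/2) ^ (k + 2)}.indicator
          (fun t => ENNReal.ofReal (kernelWeight grp a t)) t) * ENNReal.ofReal (2 ^ (β * (k + 4))) ≤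
      ENNReal.ofReal (B * 2 ^ (4 * β) * 2 ^ (- (2 * a₀)) * Real.log 2 ^ d₀ * (((k : ℝ) + 2) ^ d₀ * (2 ^ (β - a₀)) ^ k)) := by
    intro k
    have hε := hS ((1/2) ^ (k + 2)) (by positivity) (by
      calc (1/2 : ℝ) ^ (k + 2) ≤ (1/2) ^ 2 := pow_le_pow_of_le_one (by norm_num) (by norm_num) (by omega)
        _ < 1/2 := by norm_num)
    rw [lintegral_mul_const _ (hkm.indicator (hme _)), lintegral_indicator (hme _),
      Measure.restrict_restrict (hme _)]
    have h3 : ∫⁻ t in {t : Fin n → ℝ | σ t < (1/2) ^ (k + 2)} ∩ posbox n δ, ENNReal.ofReal (kernelWeight grp a t)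
        ≤ fracMeasure grp a {t | (∀ i, t i ∈ Set.Ioo 0 δ) ∧ starFn c t < (1/2) ^ (k + 2)} := by
      unfold fracMeasure
      rw [← withDensity_apply _ ((hme _).inter (measurableSet_posbox n δ))]
      refine measure_mono fun t ht => ⟨ht.2, ?_⟩
      exact (hσ t fun i => (ht.2 i).1.ne').trans_lt ht.1
    refine (mul_le_mul_left (h3.trans hε.le) _).trans (le_of_eq ?_)
    rw [← ENNReal.ofReal_mul (by positivity)]
    congr 1
    have e1 : |Real.log ((1/2) ^ (k + 2))| = ((k : ℝ) + 2) * Real.log 2 := by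
      rw [Real.log_pow, one_div, Real.log_inv]
      have := Real.log_pos one_lt_two
      push_cast
      rw [mul_neg, abs_neg, abs_of_pos (by positivity)]
    have e2 : ((1/2 : ℝ) ^ (k + 2)) ^ a₀ = 2 ^ (-(2 * a₀)) * (2 ^ (- a₀)) ^ k := by
      rw [← Real.rpow_natCast, ← Real.rpow_mul (by norm_num), one_div, Real.inv_rpow (by norm_num),
              ← Real.rpow_neg (by norm_num), ← Real.rpow_natCast, ← Real.rpow_mul (by norm_num),
              ← Real.rpow_add (by norm_num)]
      congr 1; push_cast; ring
    have e3 : (2:ℝ) ^ (β * (k + 4)) = 2 ^ (4 * β) * (2 ^ β) ^ k := by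
      rw [← Real.rpow_natCast, ← Real.rpow_mul (by norm_num),
              ← Real.rpow_add (by norm_num)]
      congr 1; push_cast; ring
    have e4 : (2:ℝ) ^ (β - a₀) = 2 ^ β * 2 ^ (-a₀) := by
      rw [← Real.rpow_add (by norm_num)]; rfl
    rw [e1, e2, e3, e4, mul_pow, mul_pow]
    ring
  refine (ENNReal.tsum_le_tsum h2).trans_lt ?_
  have hsum : Summable (fun k : ℕ => B * 2 ^ (4 * β) * 2 ^ (- (2 * a₀)) * Real.log 2 ^ d₀ *
      (((k : ℝ) + 2) ^ d₀ * (2 ^ (β - a₀)) ^ k)) :=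
    Summable.mul_left _ (summ_aux d₀ (Real.rpow_pos_of_pos two_pos _)
      (Real.rpow_lt_one_of_one_lt_of_neg one_lt_two (sub_neg.2 hβ)))
  rw [← ENNReal.ofReal_tsum_of_nonneg _ hsum]
  · exact ENNReal.ofReal_lt_top
  · intro k
    have := Real.log_pos one_lt_two
    positivity

lemma even_lint {F : (Fin n → ℝ) → ℝ≥0∞} (hF : ∀ t, F (fun i => |t i|) = F t) {δ : ℝ}
    (h : ∫⁻ t in posbox n δ, F t < ⊤) : ∫⁻ t in pbox n δ, F t < ⊤ := by
  have hcov : pbox n δ ⊆ ⋃ s : Fin n → Bool, {t | (fun i => (if s i then 1 else -1) * t i) ∈ posbox n δ} := by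
    intro t ht
    rw [mem_iUnion]
    refine ⟨fun i => decide (0 < t i), fun i => ?_⟩
    have := ht i
    by_cases h0 : 0 < t i
    · simp only [h0, decide_true, if_true, one_mul]
      rw [abs_of_pos h0] at this; exact this
    · simp only [h0, decide_false]
      have h1 : |t i| = - t i := abs_of_nonpos (not_lt.1 h0)
      rw [h1] at this
      simpa using this
  refine (lintegral_mono_set hcov).trans_lt ?_
  refine (lintegral_iUnion_le _ _).trans_lt ?_
  rw [tsum_fintype]
  refine ENNReal.sum_lt_top.2 fun s _ => ?_
  refine lt_of_le_of_lt (le_of_eq ?_) h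
  have hmp : MeasurePreserving (fun (t : Fin n → ℝ) i => (if s i then (1:ℝ) else -1) * t i) volume volume := by
    refine volume_preserving_pi (f := fun i (x : ℝ) => (if s i then (1:ℝ) else -1) * x) fun i => ?_
    cases hs : s i
    · simpa using Measure.measurePreserving_neg (volume : Measure ℝ)
    · simp only [if_true, one_mul]; exact MeasurePreserving.id _
  have hemb : MeasurableEmbedding (fun (t : Fin n → ℝ) i => (if s i then (1:ℝ) else -1) * t i) := by
    have hinv : Function.Involutive (fun (t : Fin n → ℝ) i => (if s i then (1:ℝ) else -1) * t i) := by
      intro t; ext i; simp only; split_ifs <;> ring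
    exact (MeasurableEquiv.ofInvolutive _ hinv hmp.measurable).measurableEmbedding
  have := hmp.setLIntegral_comp_preimage_emb hemb F (posbox n δ)
  rw [← this]
  refine lintegral_congr fun t => ?_
  rw [← hF, ← hF (fun i => (if s i then (1:ℝ) else -1) * t i)]
  congr 1
  ext i
  rw [abs_mul]
  split_ifs <;> simp

theorem int_main (grp : Fin n → Fin m) (hgrp : Function.Surjective grp) (hn : 0 < n)
    (l : Fin m → ℕ) (hl : ∀ k, l k = (Finset.univ.filter (fun i => grp i = k)).card)
    (a : Fin m → ℝ) (ha : ∀ k, 0 ≤ a k ∧ a k < l k) {c : (Fin n → ℕ) → ℝ} {a₀ : ℝ} {d₀ : ℕ}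
    (ha₀ : IsSublevelExponent grp a c a₀ d₀)
    {σ : (Fin n → ℝ) → ℝ} (hσm : Measurable σ) (hσ0 : ∀ t, (∀ i, t i ≠ 0) → 0 < σ t)
    (hσ : ∀ t, (∀ i, t i ≠ 0) → starFn c t ≤ σ t) (hσe : ∀ t, σ (fun i => |t i|) = σ t) :
    ∃ δ₀ > 0, ∀ δ, 0 < δ → δ ≤ δ₀ → ∀ β, 0 < β → β < 1 → β < min a₀ (⨅ k, ((l k : ℝ) - a k)) →
    ∫⁻ t in pbox n δ, ENNReal.ofReal (kernelWeight grp a t) * ENNReal.ofReal (mmin σ t) ^ (-β) < ⊤ := by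
  obtain ⟨ha0, -, r₀, hr₀, hS⟩ := ha₀
  refine ⟨r₀ / 2, by positivity, ?_⟩
  intro δ hδ hδ₀ β hβ0 hβ1 hβ
  obtain ⟨b, B, hb, hB, hS⟩ := hS δ hδ (by linarith)
  refine even_lint ?_ ?_
  · intro t
    rw [kernelWeight_abs]
    unfold mmin
    rw [hσe]
    simp only [abs_abs]
  have hpt : ∀ t ∈ posbox n δ, ENNReal.ofReal (kernelWeight grp a t) * ENNReal.ofReal (mmin σ t) ^ (-β) ≤
      ENNReal.ofReal (kernelWeight grp a t) * ENNReal.ofReal (σ t) ^ (-β) +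
      ∑ i, ENNReal.ofReal (kernelWeight grp a t) * ENNReal.ofReal |t i| ^ (-β) := by
    intro t ht
    haveI : Nonempty (Fin n) := ⟨⟨0, hn⟩⟩
    unfold mmin
    rcases min_choice (⨅ i, |t i|) (σ t) with h | h
    · obtain ⟨i, hi⟩ := exists_eq_ciInf_of_finite (f := fun i => |t i|)
      rw [h, ← hi]
      refine le_add_left ?_
      exact Finset.single_le_sum (f := fun i => ENNReal.ofReal (kernelWeight grp a t) * ENNReal.ofReal |t i| ^ (-β))
        (fun _ _ => zero_le) (Finset.mem_univ i)
    · rw [h]; exact le_add_right le_rfl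
  refine (setLIntegral_mono' (measurableSet_posbox n δ) hpt).trans_lt ?_
  have hkm : Measurable (fun t => ENNReal.ofReal (kernelWeight grp a t)) :=
    (measurable_kernelWeight grp a).ennreal_ofReal
  rw [lintegral_add_left (show Measurable fun t => ENNReal.ofReal (kernelWeight grp a t) * ENNReal.ofReal (σ t) ^ (-β) from
    hkm.mul (hσm.ennreal_ofReal.pow_const _))]
  refine ENNReal.add_lt_top.2 ⟨int_sigma grp hgrp hn l hl a ha hσm hσ0 hσ hδ hβ0
    (hβ.trans_le (min_le_left _ _)) hB fun ε h1 h2 => (hS ε h1 h2).2, ?_⟩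
  rw [lintegral_finsetSum' _ (fun i _ => by
    refine (hkm.mul (Measurable.pow_const ?_ _)).aemeasurable
    exact ENNReal.measurable_ofReal.comp (by fun_prop))]
  refine ENNReal.sum_lt_top.2 fun i _ => ?_
  refine int_coord grp hgrp l hl a ha hδ i hβ0.le hβ1 ?_
  exact (hβ.trans_le (min_le_right _ _)).trans_le
    (ciInf_le (f := fun k => ((l k : ℝ) - a k)) (Set.finite_range _).bddBelow (grp i))

end

section

open Polynomial in
def lp (α : Fin n → ℕ) (t v : Fin n → ℝ) : Polynomial ℝ := ∏ i, (C (t i) + C (v i) * X) ^ α i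

def dc (k : ℕ) (α : Fin n → ℕ) (t v : Fin n → ℝ) : ℝ := (k.factorial : ℝ) * (lp α t v).coeff k

def dS (c : (Fin n → ℕ) → ℝ) (k : ℕ) (t v : Fin n → ℝ) : ℝ := ∑' α, c α * dc k α t v

def PDom (p P : Polynomial ℝ) : Prop := ∀ k, |p.coeff k| ≤ P.coeff k

lemma PDom.nonneg {p P : Polynomial ℝ} (h : PDom p P) (k : ℕ) : 0 ≤ P.coeff k := (abs_nonneg _).trans (h k)

lemma PDom.mul {p P q Q : Polynomial ℝ} (h : PDom p P) (h' : PDom q Q) : PDom (p * q) (P * Q) := by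
  intro k
  rw [Polynomial.coeff_mul, Polynomial.coeff_mul]
  refine (Finset.abs_sum_le_sum_abs _ _).trans (Finset.sum_le_sum fun x _ => ?_)
  rw [abs_mul]
  exact mul_le_mul (h _) (h' _) (abs_nonneg _) (h.nonneg _)

lemma PDom.one : PDom 1 1 := by
  intro k
  rw [Polynomial.coeff_one]
  split_ifs <;> simp

lemma PDom.pow {p P : Polynomial ℝ} (h : PDom p P) (j : ℕ) : PDom (p ^ j) (P ^ j) := by
  induction j with
  | zero => simpa using PDom.one
  | succ j ih => rw [pow_succ, pow_succ]; exact ih.mul h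

lemma PDom.prod {ι : Type*} (s : Finset ι) {p P : ι → Polynomial ℝ} (h : ∀ i, PDom (p i) (P i)) :
    PDom (∏ i ∈ s, p i) (∏ i ∈ s, P i) := by
  classical
  induction s using Finset.induction_on with
  | empty => simpa using PDom.one
  | insert a s ha ih => rw [Finset.prod_insert ha, Finset.prod_insert ha]; exact (h a).mul ih

lemma lp_dom (α : Fin n → ℕ) (t v : Fin n → ℝ) :
    PDom (lp α t v) (lp α (fun i => |t i|) (fun i => |v i|)) := by
  refine PDom.prod _ fun i => PDom.pow ?_ _
  intro k
  simp only [Polynomial.coeff_add, Polynomial.coeff_C, Polynomial.coeff_C_mul, Polynomial.coeff_X]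
  split_ifs <;> simp <;> omega

lemma eval_lp (α : Fin n → ℕ) (t v : Fin n → ℝ) (s : ℝ) :
    (lp α t v).eval s = monomial α (fun i => t i + s * v i) := by
  unfold lp monomial
  rw [Polynomial.eval_prod]
  refine Finset.prod_congr rfl fun i _ => ?_
  simp only [Polynomial.eval_pow, Polynomial.eval_add, Polynomial.eval_mul, Polynomial.eval_C, Polynomial.eval_X]
  ring

lemma coeff_le_eval {P : Polynomial ℝ} (h : ∀ k, 0 ≤ P.coeff k) (k : ℕ) : P.coeff k ≤ P.eval 1 := by
  rw [Polynomial.eval_eq_sum_range]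
  simp only [one_pow, mul_one]
  by_cases hk : k ≤ P.natDegree
  · exact Finset.single_le_sum (f := fun k => P.coeff k) (fun i _ => h i) (Finset.mem_range.2 (by omega))
  · rw [Polynomial.coeff_eq_zero_of_natDegree_lt (by omega)]
    exact Finset.sum_nonneg fun i _ => h i

lemma coeff_lp_le (k : ℕ) (α : Fin n → ℕ) (t v : Fin n → ℝ) :
    |(lp α t v).coeff k| ≤ ∏ i, (|t i| + |v i|) ^ α i := by
  refine (lp_dom α t v k).trans ?_
  refine (coeff_le_eval (fun k => (lp_dom α t v).nonneg k) k).trans (le_of_eq ?_)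
  rw [eval_lp]
  simp [monomial]

lemma dc_le (k : ℕ) (α : Fin n → ℕ) {t v : Fin n → ℝ} {R : ℝ} (h : ∀ i, |t i| + |v i| ≤ R) :
    |dc k α t v| ≤ k.factorial * R ^ (∑ i, α i) := by
  unfold dc
  rw [abs_mul, abs_of_nonneg (by positivity)]
  refine mul_le_mul_of_nonneg_left ?_ (by positivity)
  refine (coeff_lp_le k α t v).trans ?_
  rw [← Finset.prod_pow_eq_pow_sum]
  exact Finset.prod_le_prod (fun i _ => by positivity) fun i _ => pow_le_pow_left₀ (by positivity) (h i) _

lemma lp_scale (α : Fin n → ℕ) (τ u v : Fin n → ℝ) :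
    lp α (fun i => τ i * u i) (fun i => τ i * v i) = Polynomial.C (monomial α τ) * lp α u v := by
  unfold lp monomial
  rw [map_prod, ← Finset.prod_mul_distrib]
  refine Finset.prod_congr rfl fun i _ => ?_
  rw [map_pow, ← mul_pow, Polynomial.C_mul, Polynomial.C_mul]
  ring

lemma dc_scale (k : ℕ) (α : Fin n → ℕ) (τ u v : Fin n → ℝ) :
    dc k α (fun i => τ i * u i) (fun i => τ i * v i) = monomial α τ * dc k α u v := by
  unfold dc
  rw [lp_scale, Polynomial.coeff_C_mul]; ring

lemma dc_homog (k : ℕ) (α : Fin n → ℕ) (t v : Fin n → ℝ) (l : ℝ) :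
    dc k α t (fun i => l * v i) = l ^ k * dc k α t v := by
  have : lp α t (fun i => l * v i) = (lp α t v).comp (Polynomial.C l * Polynomial.X) := by
    unfold lp
    rw [Polynomial.prod_comp]
    refine Finset.prod_congr rfl fun i _ => ?_
    simp only [Polynomial.pow_comp, Polynomial.add_comp, Polynomial.mul_comp, Polynomial.C_comp, Polynomial.X_comp,
      Polynomial.C_mul]
    ring
  unfold dc
  rw [this, Polynomial.comp_C_mul_X_coeff]
  ring

lemma dc_zero (α : Fin n → ℕ) (t v : Fin n → ℝ) : dc 0 α t v = monomial α t := by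
  unfold dc
  rw [Polynomial.coeff_zero_eq_eval_zero, eval_lp]
  simp

lemma dc_shift (k : ℕ) (α : Fin n → ℕ) (t v : Fin n → ℝ) (s : ℝ) :
    dc k α (fun i => t i + s * v i) v = (Polynomial.derivative^[k] (lp α t v)).eval s := by
  have h1 : lp α (fun i => t i + s * v i) v = Polynomial.taylor s (lp α t v) := by
    unfold lp
    rw [Polynomial.taylor_apply, Polynomial.prod_comp]
    refine Finset.prod_congr rfl fun i _ => ?_
    simp only [Polynomial.pow_comp, Polynomial.add_comp, Polynomial.mul_comp, Polynomial.C_comp, Polynomial.X_comp,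
      Polynomial.C_mul, Polynomial.C_add]
    ring
  unfold dc
  rw [h1, Polynomial.taylor_coeff, ← Polynomial.factorial_smul_hasseDeriv]
  simp

lemma hasDerivAt_dc (k : ℕ) (α : Fin n → ℕ) (t v : Fin n → ℝ) (s : ℝ) :
    HasDerivAt (fun s => dc k α (fun i => t i + s * v i) v) (dc (k+1) α (fun i => t i + s * v i) v) s := by
  simp only [dc_shift]
  rw [Function.iterate_succ_apply']
  exact Polynomial.hasDerivAt _ _

/-- Absolute convergence data. -/
def GoodR (S : (Fin n → ℝ) → ℝ) (c : (Fin n → ℕ) → ℝ) (R : ℝ) : Prop :=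
  0 < R ∧ Summable (fun α => |c α| * R ^ (∑ i, α i)) ∧
    ∀ t : Fin n → ℝ, (∀ i, |t i| ≤ R) → HasSum (fun α => c α * monomial α t) (S t)

lemma exists_goodR {S : (Fin n → ℝ) → ℝ} {c : (Fin n → ℕ) → ℝ} (h : HasTaylorSeriesAtOrigin S c) :
    ∃ R, GoodR S c R := by
  obtain ⟨ε, hε, hb⟩ := Metric.eventually_nhds_iff_ball.1 h
  have hin : ∀ t : Fin n → ℝ, (∀ i, |t i| ≤ ε / 2) → HasSum (fun α => c α * monomial α t) (S t) := by
    intro t ht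
    refine hb t ?_
    rw [mem_ball_zero_iff]
    refine (pi_norm_lt_iff hε).2 fun i => ?_
    rw [Real.norm_eq_abs]
    linarith [ht i]
  refine ⟨ε / 2, by positivity, ?_, hin⟩
  have := (hin (fun _ => ε / 2) (fun i => by rw [abs_of_pos (by positivity)])).summable.abs
  refine this.congr fun α => ?_
  rw [abs_mul]
  unfold monomial
  rw [Finset.prod_pow_eq_pow_sum, abs_of_nonneg (show 0 ≤ (ε / 2) ^ (∑ i, α i) by positivity)]

variable {S : (Fin n → ℝ) → ℝ} {c : (Fin n → ℕ) → ℝ} {R : ℝ}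

lemma summable_dS (hR : GoodR S c R) (k : ℕ) {t v : Fin n → ℝ} (h : ∀ i, |t i| + |v i| ≤ R) :
    Summable (fun α => c α * dc k α t v) := by
  refine Summable.of_norm_bounded (hR.2.1.mul_left (k.factorial : ℝ)) fun α => ?_
  rw [Real.norm_eq_abs, abs_mul]
  have := mul_le_mul_of_nonneg_left (dc_le k α h) (abs_nonneg (c α))
  linarith

lemma dS_le (hR : GoodR S c R) (k : ℕ) {t v : Fin n → ℝ} (h : ∀ i, |t i| + |v i| ≤ R) :
    |dS c k t v| ≤ k.factorial * ∑' α, |c α| * R ^ (∑ i, α i) := by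
  unfold dS
  rw [← tsum_mul_left, ← Real.norm_eq_abs]
  refine tsum_of_norm_bounded (hR.2.1.mul_left (k.factorial : ℝ)).hasSum fun α => ?_
  rw [Real.norm_eq_abs, abs_mul]
  have := mul_le_mul_of_nonneg_left (dc_le k α h) (abs_nonneg (c α))
  linarith

lemma dS_zero (hR : GoodR S c R) {t : Fin n → ℝ} (v : Fin n → ℝ) (h : ∀ i, |t i| ≤ R) : dS c 0 t v = S t := by
  unfold dS
  simp only [dc_zero]
  exact (hR.2.2 t h).tsum_eq

lemma dS_homog (c : (Fin n → ℕ) → ℝ) (k : ℕ) (t v : Fin n → ℝ) (l : ℝ) :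
    dS c k t (fun i => l * v i) = l ^ k * dS c k t v := by
  unfold dS
  rw [← tsum_mul_left]
  refine tsum_congr fun α => ?_
  rw [dc_homog]; ring

lemma hasDerivAt_dS (hR : GoodR S c R) (k : ℕ) {t v : Fin n → ℝ} {s : ℝ}
    (h : ∀ i, |t i + s * v i| + |v i| < R) :
    HasDerivAt (fun s => dS c k (fun i => t i + s * v i) v) (dS c (k+1) (fun i => t i + s * v i) v) s := by
  have hev : ∀ᶠ s' in 𝓝 s, ∀ i, |t i + s' * v i| + |v i| < R := by
    rw [eventually_all]
    intro i
    have : ContinuousAt (fun s' : ℝ => |t i + s' * v i| + |v i|) s := by fun_prop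
    exact this.eventually_lt continuousAt_const (h i)
  obtain ⟨ε, hε, hb⟩ := Metric.eventually_nhds_iff_ball.1 hev
  have hs : s ∈ Metric.ball s ε := Metric.mem_ball_self hε
  refine hasDerivAt_tsum_of_isPreconnected (u := fun α => |c α| * (((k+1).factorial : ℝ) * R ^ (∑ i, α i)))
    (t := Metric.ball s ε)
    (y₀ := s) ?_ Metric.isOpen_ball (convex_ball s ε).isPreconnected
    (g := fun α s => c α * dc k α (fun i => t i + s * v i) v)
    (g' := fun α s => c α * dc (k+1) α (fun i => t i + s * v i) v) ?_ ?_ hs ?_ hs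
  · refine (hR.2.1.mul_left (((k+1).factorial : ℝ))).congr fun α => by ring
  · intro α y _
    exact (hasDerivAt_dc k α t v y).const_mul _
  · intro α y hy
    rw [Real.norm_eq_abs, abs_mul]
    exact mul_le_mul_of_nonneg_left (dc_le (k+1) α fun i => (hb y hy i).le) (abs_nonneg _)
  · exact summable_dS hR k fun i => (h i).le

lemma deg_cases (α : Fin n → ℕ) (h : ∑ i, α i < 2) : α = 0 ∨ ∃ j, α = Pi.single j 1 := by
  by_cases h0 : α = 0
  · exact Or.inl h0
  right
  obtain ⟨j, hj⟩ : ∃ j, α j ≠ 0 := by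
    by_contra! hh
    exact h0 (funext hh)
  refine ⟨j, ?_⟩
  have h1 : α j + ∑ i ∈ Finset.univ.erase j, α i = ∑ i, α i := Finset.add_sum_erase _ _ (Finset.mem_univ j)
  ext i
  by_cases hij : i = j
  · subst hij; simp; omega
  · have : α i ≤ ∑ i ∈ Finset.univ.erase j, α i :=
      Finset.single_le_sum (f := α) (fun _ _ => Nat.zero_le _) (Finset.mem_erase.2 ⟨hij, Finset.mem_univ _⟩)
    simp [hij]; omega

lemma monomial_single (j : Fin n) (t : Fin n → ℝ) : monomial (Pi.single j 1) t = t j := by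
  unfold monomial
  rw [Finset.prod_eq_single j]
  · simp
  · intro i _ hij; simp [hij]
  · simp

lemma monomial_abs_le (α : Fin n → ℕ) {t : Fin n → ℝ} {r : ℝ} (h : ∀ i, |t i| ≤ r) :
    |monomial α t| ≤ r ^ (∑ i, α i) := by
  unfold monomial
  rw [Finset.abs_prod, ← Finset.prod_pow_eq_pow_sum]
  refine Finset.prod_le_prod (fun i _ => by positivity) fun i _ => ?_
  rw [abs_pow]
  exact pow_le_pow_left₀ (by positivity) (h i) _

lemma taylor_two (hR : GoodR S c R) {t : Fin n → ℝ} (h : ∀ i, |t i| ≤ R) {r : ℝ} (hr : ∀ i, |t i| ≤ r) (hr0 : 0 ≤ r) (hrR : r ≤ R) :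
    |S t - c 0 - ∑ j, c (Pi.single j 1) * t j| ≤ r ^ 2 * ((∑' α, |c α| * R ^ (∑ i, α i)) / R ^ 2) := by
  classical
  have hRp := hR.1
  have h1 := hR.2.2 t h
  set f : (Fin n → ℕ) → ℝ := fun α => if 2 ≤ ∑ i, α i then c α * monomial α t else 0 with hf
  set T : Finset (Fin n → ℕ) := insert 0 (Finset.univ.image fun j : Fin n => (Pi.single j 1 : Fin n → ℕ)) with hT
  have h2 : HasSum (fun α => c α * monomial α t - f α) (∑ α ∈ T, c α * monomial α t) := by
    have e : ∑ α ∈ T, c α * monomial α t = ∑ α ∈ T, (c α * monomial α t - f α) := by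
      refine Finset.sum_congr rfl fun α hα => ?_
      have : ¬ 2 ≤ ∑ i, α i := by
        rw [hT, Finset.mem_insert, Finset.mem_image] at hα
        rcases hα with rfl | ⟨j, -, rfl⟩
        · simp
        · simp
      simp only [hf, if_neg this, sub_zero]
    rw [e]
    refine hasSum_sum_of_ne_finset_zero fun α hα => ?_
    have : 2 ≤ ∑ i, α i := by
      by_contra! hh
      refine hα ?_
      rw [hT, Finset.mem_insert, Finset.mem_image]
      rcases deg_cases α hh with h | ⟨j, h⟩
      · exact Or.inl h
      · exact Or.inr ⟨j, Finset.mem_univ _, h.symm⟩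
    simp only [hf, if_pos this, sub_self]
  have h3 : ∑ α ∈ T, c α * monomial α t = c 0 + ∑ j, c (Pi.single j 1) * t j := by
    rw [hT, Finset.sum_insert, Finset.sum_image]
    · simp only [monomial_single]
      simp [monomial]
    · intro i _ j _ hij
      by_contra hne
      have := congrFun hij i
      simp [hne] at this
    · simp only [Finset.mem_image, Finset.mem_univ, true_and, not_exists]
      intro j hj
      have := congrFun hj j
      simp at this
  have h4 := h1.sub h2
  simp only [sub_sub_cancel] at h4
  rw [h3] at h4
  have h5 : S t - c 0 - ∑ j, c (Pi.single j 1) * t j = ∑' α, f α := by rw [h4.tsum_eq]; ring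
  rw [h5, ← Real.norm_eq_abs, ← tsum_div_const, ← tsum_mul_left]
  refine tsum_of_norm_bounded ((hR.2.1.div_const _).mul_left _).hasSum fun α => ?_
  simp only [hf]
  split_ifs with h6
  · rw [Real.norm_eq_abs, abs_mul]
    have h7 := monomial_abs_le α hr
    have h8 : r ^ (∑ i, α i) ≤ r ^ 2 * (R ^ (∑ i, α i) / R ^ 2) := by
      obtain ⟨j, hj⟩ := Nat.exists_eq_add_of_le h6
      rw [hj, pow_add, pow_add, mul_div_cancel_left₀ _ (by positivity)]
      exact mul_le_mul_of_nonneg_left (pow_le_pow_left₀ hr0 hrR _) (by positivity)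
    calc |c α| * |monomial α t| ≤ |c α| * (r ^ 2 * (R ^ (∑ i, α i) / R ^ 2)) :=
          mul_le_mul_of_nonneg_left (h7.trans h8) (abs_nonneg _)
      _ = _ := by ring
  · rw [norm_zero]; positivity

lemma c_zero (hR : GoodR S c R) (hS0 : S 0 = 0) : c 0 = 0 := by
  have := taylor_two hR (t := 0) (fun i => by simpa using hR.1.le) (r := 0) (by simp) le_rfl hR.1.le
  simp [hS0] at this
  exact this

lemma c_single (hR : GoodR S c R) (hS0 : S 0 = 0) (hS1 : fderiv ℝ S 0 = 0) (j : Fin n) : c (Pi.single j 1) = 0 := by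
  have hRp := hR.1
  have hc0 := c_zero hR hS0
  set L : (Fin n → ℝ) →L[ℝ] ℝ := ∑ j, c (Pi.single j 1) • ContinuousLinearMap.proj j with hL
  have hLt : ∀ t, L t = ∑ j, c (Pi.single j 1) * t j := by intro t; simp [hL]
  have hd : HasFDerivAt S L 0 := by
    rw [hasFDerivAt_iff_isLittleO_nhds_zero]
    refine Asymptotics.IsBigO.trans_isLittleO (g := fun h => ‖h‖ ^ 2) ?_ ?_
    · refine Asymptotics.IsBigO.of_bound ((∑' α, |c α| * R ^ (∑ i, α i)) / R ^ 2) ?_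
      filter_upwards [Metric.ball_mem_nhds (0 : Fin n → ℝ) hRp] with t ht
      rw [mem_ball_zero_iff] at ht
      have h1 : ∀ i, |t i| ≤ ‖t‖ := fun i => norm_le_pi_norm t i
      have := taylor_two hR (t := t) (fun i => (h1 i).trans ht.le) h1 (norm_nonneg _) ht.le
      rw [Real.norm_eq_abs, zero_add, hS0, hLt, Real.norm_of_nonneg (by positivity), sub_zero, mul_comm _ (‖t‖ ^ 2)]
      rwa [hc0, sub_zero] at this
    · have := Asymptotics.isLittleO_norm_pow_id (E' := Fin n → ℝ) one_lt_two
      exact this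
  have := hd.fderiv
  rw [hS1] at this
  have h2 := congrArg (fun l => l (Pi.single j 1)) this
  simp only [hLt] at h2
  simpa [Pi.single_apply] using h2.symm

lemma dS_le_small (hR : GoodR S c R) (hc2 : ∀ α, c α ≠ 0 → 2 ≤ ∑ i, α i) (k : ℕ) {t v : Fin n → ℝ} {r : ℝ}
    (hr0 : 0 ≤ r) (hrR : r ≤ R) (h : ∀ i, |t i| + |v i| ≤ r) :
    |dS c k t v| ≤ k.factorial * (r ^ 2 / R ^ 2) * ∑' α, |c α| * R ^ (∑ i, α i) := by
  have hRp := hR.1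
  unfold dS
  rw [← tsum_mul_left, ← Real.norm_eq_abs]
  refine tsum_of_norm_bounded (hR.2.1.mul_left _).hasSum fun α => ?_
  rw [Real.norm_eq_abs, abs_mul]
  by_cases h0 : c α = 0
  · simp [h0]
  have h8 : r ^ (∑ i, α i) ≤ r ^ 2 * (R ^ (∑ i, α i) / R ^ 2) := by
    obtain ⟨j, hj⟩ := Nat.exists_eq_add_of_le (hc2 α h0)
    rw [hj, pow_add, pow_add, mul_div_cancel_left₀ _ (by positivity)]
    exact mul_le_mul_of_nonneg_left (pow_le_pow_left₀ hr0 hrR _) (by positivity)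
  calc |c α| * |dc k α t v| ≤ |c α| * (k.factorial * r ^ (∑ i, α i)) :=
        mul_le_mul_of_nonneg_left (dc_le k α h) (abs_nonneg (c α))
    _ ≤ |c α| * (k.factorial * (r ^ 2 * (R ^ (∑ i, α i) / R ^ 2))) := by gcongr
    _ = _ := by ring

/-- Directional derivative bounds near the origin. -/
lemma dS_dir (hR : GoodR S c R) (hc2 : ∀ α, c α ≠ 0 → 2 ≤ ∑ i, α i) :
    ∃ r₁ > 0, ∃ B : ℝ, 0 ≤ B ∧ ∀ (t : Fin n → ℝ) (i : Fin n), (∀ j, |t j| ≤ r₁) →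
      |dS c 1 t (Pi.single i 1)| ≤ 1/2 ∧ |dS c 2 t (Pi.single i 1)| ≤ B := by
  have hRp := hR.1
  set M := ∑' α, |c α| * R ^ (∑ i, α i) with hM
  have hM0 : 0 ≤ M := tsum_nonneg fun α => by positivity
  obtain ⟨r, hr, hr1, hr2⟩ : ∃ r > 0, 2 * r ≤ R ∧ 4 * r * M ≤ R ^ 2 / 2 := by
    refine ⟨min (R / 2) (R ^ 2 / (8 * (M + 1))), by positivity, ?_, ?_⟩
    · linarith [min_le_left (R / 2) (R ^ 2 / (8 * (M + 1)))]
    · have h1 := min_le_right (R / 2) (R ^ 2 / (8 * (M + 1)))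
      calc _ ≤ 4 * (R ^ 2 / (8 * (M + 1))) * (M + 1) := by gcongr; linarith
        _ = _ := by field_simp; ring
  have key : ∀ (k : ℕ) (t : Fin n → ℝ) (i : Fin n), (∀ j, |t j| ≤ r) →
      r ^ k * |dS c k t (Pi.single i 1)| ≤ k.factorial * ((2 * r) ^ 2 / R ^ 2) * M := by
    intro k t i ht
    have h1 := dS_homog c k t (Pi.single i 1) r
    have h2 := dS_le_small hR hc2 k (t := t) (v := fun j => r * (Pi.single i 1 : Fin n → ℝ) j) (r := 2 * r)
      (by positivity) hr1 (fun j => by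
        have : |r * (Pi.single i 1 : Fin n → ℝ) j| ≤ r := by
          rw [abs_mul, abs_of_pos hr, Pi.single_apply]
          split_ifs <;> simp [hr.le]
        linarith [ht j])
    rw [h1, abs_mul, abs_of_pos (by positivity)] at h2
    exact h2
  refine ⟨r, hr, (2 * ((2 * r) ^ 2 / R ^ 2) * M) / r ^ 2, by positivity, fun t i ht => ⟨?_, ?_⟩⟩
  · have h1 := key 1 t i ht
    simp only [pow_one, Nat.factorial_one, Nat.cast_one, one_mul] at h1
    have h2 : (2 * r) ^ 2 / R ^ 2 * M ≤ r * (1/2) := by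
      rw [div_mul_eq_mul_div, div_le_iff₀ (by positivity)]
      nlinarith
    exact le_of_mul_le_mul_left (h1.trans h2) hr
  · have h1 := key 2 t i ht
    rw [le_div_iff₀ (by positivity)]
    simp only [Nat.factorial_two, Nat.cast_ofNat] at h1
    linarith

lemma exists_minimal (c : (Fin n → ℕ) → ℝ) : ∃ A : Finset (Fin n → ℕ), (∀ α ∈ A, c α ≠ 0) ∧
    ∀ α, c α ≠ 0 → ∃ b ∈ A, b ≤ α := by
  set s : Set (Fin n → ℕ) := {α | c α ≠ 0} with hs
  have hfin : {α | Minimal (· ∈ s) α}.Finite :=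
    WellQuasiOrderedLE.finite_of_isAntichain (setOfPred_minimal_antichain _)
  refine ⟨hfin.toFinset, fun α hα => ((hfin.mem_toFinset).1 hα).1, fun α hα => ?_⟩
  obtain ⟨b, hb, hb2⟩ := exists_minimal_le_of_wellFoundedLT (· ∈ s) α hα
  exact ⟨b, hfin.mem_toFinset.2 hb2, hb⟩

def sig (A : Finset (Fin n → ℕ)) (t : Fin n → ℝ) : ℝ := ∑ α ∈ A, ∏ i, |t i| ^ α i

lemma measurable_sig (A : Finset (Fin n → ℕ)) : Measurable (sig A) := by
  unfold sig
  refine Continuous.measurable ?_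
  fun_prop

lemma sig_abs (A : Finset (Fin n → ℕ)) (t : Fin n → ℝ) : sig A (fun i => |t i|) = sig A t := by
  simp [sig]

lemma sig_pos {A : Finset (Fin n → ℕ)} (hA : A.Nonempty) {t : Fin n → ℝ} (ht : ∀ i, t i ≠ 0) : 0 < sig A t :=
  Finset.sum_pos (fun α _ => Finset.prod_pos fun i _ => pow_pos (abs_pos.2 (ht i)) _) hA

lemma starFn_le {A : Finset (Fin n → ℕ)} (hA1 : ∀ α ∈ A, c α ≠ 0) (hA : ∀ α, c α ≠ 0 → ∃ b ∈ A, b ≤ α) (t : Fin n → ℝ) :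
    starFn c t ≤ sig A t := by
  classical
  have hv : ∀ x ∈ newtonVertices c, ∃ α ∈ A, x = fun i => (α i : ℝ) := by
    intro x hx
    obtain ⟨α, hα, hαx⟩ := extremePoints_convexHull_subset hx
    obtain ⟨b, hb, hbα⟩ := hA α hα
    refine ⟨b, hb, ?_⟩
    have hbx : ∀ i, (b i : ℝ) ≤ x i := fun i => le_trans (by exact_mod_cast hbα i) (hαx i)
    have h1 : (fun i => (b i : ℝ)) ∈ newtonPolyhedron c := subset_convexHull ℝ _ ⟨b, hA1 b hb, fun i => le_rfl⟩
    have h2 : (fun i => 2 * x i - (b i : ℝ)) ∈ newtonPolyhedron c :=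
      subset_convexHull ℝ _ ⟨b, hA1 b hb, fun i => by have := hbx i; simp only; linarith⟩
    have := hx.2 h1 h2 (by
      rw [openSegment_eq_image]
      refine ⟨1/2, by norm_num, ?_⟩
      ext i; simp; ring)
    exact this.symm
  choose f hf1 hf2 using hv
  have hinj : Function.Injective (fun v : newtonVertices c => (⟨f v.1 v.2, hf1 v.1 v.2⟩ : A)) := by
    intro v w hvw
    simp only [Subtype.mk.injEq] at hvw
    ext i
    rw [hf2 v.1 v.2, hf2 w.1 w.2, hvw]
  haveI : Finite (newtonVertices c) := Finite.of_injective _ hinj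
  haveI := Fintype.ofFinite (newtonVertices c)
  unfold starFn sig
  rw [tsum_fintype, ← Finset.sum_coe_sort A]
  have : ∀ v : newtonVertices c, ∏ i, |t i| ^ ((v : Fin n → ℝ) i) =
      (fun b : A => ∏ i, |t i| ^ (b.1 i)) ⟨f v.1 v.2, hf1 v.1 v.2⟩ := by
    intro v
    refine Finset.prod_congr rfl fun i _ => ?_
    conv_lhs => rw [hf2 v.1 v.2]
    simp
  simp_rw [this]
  rw [← Finset.sum_image (f := fun b : A => ∏ i, |t i| ^ (b.1 i)) (g := fun v : newtonVertices c => (⟨f v.1 v.2, hf1 v.1 v.2⟩ : A))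
    (fun a _ b _ h => hinj h)]
  exact Finset.sum_le_sum_of_subset_of_nonneg (Finset.subset_univ _) fun b _ _ => by positivity

end

section

lemma poly_power_series {F' : Finset (Fin n → ℕ)} {c : (Fin n → ℕ) → ℝ} {x : Fin n → ℝ}
    {p : FormalMultilinearSeries ℝ (Fin n → ℝ) ℝ} {r : ℝ≥0∞}
    (hp : HasFPowerSeriesOnBall (fun t => ∑ α ∈ F', c α * monomial α t) p x r) (k : ℕ) (y : Fin n → ℝ) :
    p k (fun _ => y) = ∑ α ∈ F', c α * (lp α x y).coeff k := by
  set g : ℝ → ℝ := fun s => ∑ α ∈ F', c α * monomial α (fun i => x i + s * y i) with hg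
  set P : Polynomial ℝ := ∑ α ∈ F', Polynomial.C (c α) * lp α x y with hP
  have hgP : ∀ s, g s = P.eval s := by
    intro s
    rw [hP, Polynomial.eval_finset_sum]
    refine Finset.sum_congr rfl fun α _ => ?_
    rw [Polynomial.eval_mul, Polynomial.eval_C, eval_lp]
  have h1 : HasFPowerSeriesAt g (FormalMultilinearSeries.ofScalars ℝ (fun k => p k (fun _ => y))) 0 := by
    rw [hasFPowerSeriesAt_iff]
    have : ∀ᶠ z : ℝ in 𝓝 0, z • y ∈ EMetric.ball (0 : Fin n → ℝ) r := by
      have hc : Tendsto (fun z : ℝ => z • y) (𝓝 0) (𝓝 0) := by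
        have : Continuous (fun z : ℝ => z • y) := by fun_prop
        simpa using this.tendsto 0
      exact hc (EMetric.ball_mem_nhds _ hp.r_pos)
    filter_upwards [this] with z hz
    have := hp.hasSum hz
    simp only [zero_add, FormalMultilinearSeries.coeff_ofScalars]
    convert this using 1
    · ext k
      exact ((p k).map_smul_univ (fun _ => z) (fun _ => y)).symm.trans (by rfl) |>.symm ▸ by simp
    · rfl
  have h2 : HasFPowerSeriesAt g (FormalMultilinearSeries.ofScalars ℝ (fun k => P.coeff k)) 0 := by
    rw [hasFPowerSeriesAt_iff]
    refine Eventually.of_forall fun z => ?_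
    simp only [zero_add, FormalMultilinearSeries.coeff_ofScalars, hgP, smul_eq_mul]
    rw [Polynomial.eval_eq_sum_range]
    simp only [mul_comm (z ^ _)]
    refine hasSum_sum_of_ne_finset_zero fun k hk => ?_
    rw [Finset.mem_range] at hk
    rw [Polynomial.coeff_eq_zero_of_natDegree_lt (by omega), zero_mul]
  have h3 := congrArg (fun q => FormalMultilinearSeries.coeff q k) (h1.eq_formalMultilinearSeries h2)
  simp only [FormalMultilinearSeries.coeff_ofScalars] at h3
  rw [h3, hP, Polynomial.finset_sum_coeff]
  simp

lemma iter_zero {F' : Finset (Fin n → ℕ)} {c : (Fin n → ℕ) → ℝ} {x : Fin n → ℝ} {N : ℕ}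
    (h : ∀ k ≤ N, ∀ y : Fin n → ℝ, ∑ α ∈ F', c α * (lp α x y).coeff k = 0) :
    ∀ j ≤ N, iteratedFDeriv ℝ j (fun t => ∑ α ∈ F', c α * monomial α t) x = 0 := by
  have han : AnalyticAt ℝ (fun t : Fin n → ℝ => ∑ α ∈ F', c α * monomial α t) x := by
    unfold monomial
    refine Finset.analyticAt_fun_sum _ fun α _ => analyticAt_const.mul ?_
    refine Finset.analyticAt_fun_prod _ fun i _ => ?_
    exact ((ContinuousLinearMap.proj (R := ℝ) (φ := fun _ : Fin n => ℝ) i).analyticAt x).pow _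
  obtain ⟨p, r, hp⟩ := han
  set p' : FormalMultilinearSeries ℝ (Fin n → ℝ) ℝ := fun k => if k ≤ N then 0 else p k with hp'
  have hp2 : HasFPowerSeriesOnBall (fun t => ∑ α ∈ F', c α * monomial α t) p' x r := by
    refine ⟨?_, hp.r_pos, fun {y} hy => ?_⟩
    · refine hp.r_le.trans ?_
      refine FormalMultilinearSeries.radius_le_of_le (fun k => ?_)
      simp only [hp']
      split_ifs
      · rw [norm_zero]; exact norm_nonneg _
      · exact le_rfl
    · convert hp.hasSum hy using 1
      ext k
      simp only [hp']
      split_ifs with hk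
      · rw [poly_power_series hp, h k hk]; rfl
      · rfl
  intro j hj
  ext v
  rw [hp2.iteratedFDeriv_eq_sum_of_completeSpace]
  simp [hp', hj]

def QF (p : Polynomial ℝ) (a b : ℝ) : Prop := p.coeff 0 = 1 ∧ p.coeff 1 = a ∧ 2 * p.coeff 2 = a ^ 2 - b

lemma QF.mul {p q : Polynomial ℝ} {a b a' b' : ℝ} (h : QF p a b) (h' : QF q a' b') : QF (p * q) (a + a') (b + b') := by
  obtain ⟨h0, h1, h2⟩ := h
  obtain ⟨h0', h1', h2'⟩ := h'
  refine ⟨?_, ?_, ?_⟩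
  · rw [Polynomial.mul_coeff_zero, h0, h0', one_mul]
  · rw [Polynomial.mul_coeff_one, h0, h1, h0', h1']; ring
  · rw [Polynomial.coeff_mul]
    simp only [Finset.Nat.antidiagonal_succ, Finset.Nat.antidiagonal_zero]
    simp [h0, h1, h0', h1']
    linear_combination h2 + h2'

lemma QF.one : QF 1 0 0 := by
  refine ⟨?_, ?_, ?_⟩ <;> simp [Polynomial.coeff_one]

lemma QF.pow {p : Polynomial ℝ} {a b : ℝ} (h : QF p a b) (k : ℕ) : QF (p ^ k) (k * a) (k * b) := by
  induction k with
  | zero => simpa using QF.one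
  | succ k ih =>
    rw [pow_succ]
    have := ih.mul h
    push_cast
    rwa [add_mul, add_mul, one_mul, one_mul]

lemma QF.prod {ι : Type*} (s : Finset ι) {p : ι → Polynomial ℝ} {a b : ι → ℝ} (h : ∀ i, QF (p i) (a i) (b i)) :
    QF (∏ i ∈ s, p i) (∑ i ∈ s, a i) (∑ i ∈ s, b i) := by
  classical
  induction s using Finset.induction_on with
  | empty => simpa using QF.one
  | insert j s ha ih => rw [Finset.prod_insert ha, Finset.sum_insert ha, Finset.sum_insert ha]; exact (h j).mul ih

lemma QF_lp (α : Fin n → ℕ) (v : Fin n → ℝ) :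
    QF (lp α (fun _ => 1) v) (∑ i, α i * v i) (∑ i, α i * v i ^ 2) := by
  refine QF.prod _ fun i => QF.pow ?_ _
  refine ⟨?_, ?_, ?_⟩ <;> simp [Polynomial.coeff_one, Polynomial.coeff_X, Polynomial.coeff_C]

lemma face_low {F' : Finset (Fin n → ℕ)} {b : (Fin n → ℕ) → ℝ} {w : Fin n → ℝ} {W : ℝ}
    (hw : ∀ i, 0 < w i) (hW : ∀ α ∈ F', ∑ i, w i * α i = W) (h2 : ∀ α ∈ F', 2 ≤ ∑ i, α i)
    (h : ∀ v : Fin n → ℝ, ∑ α ∈ F', b α * (lp α (fun _ => 1) v).coeff 2 = 0) :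
    ∀ k < 2, ∀ v : Fin n → ℝ, ∑ α ∈ F', b α * (lp α (fun _ => 1) v).coeff k = 0 := by
  have hq : ∀ v : Fin n → ℝ, ∑ α ∈ F', b α * ((∑ i, α i * v i) ^ 2 - ∑ i, α i * v i ^ 2) = 0 := by
    intro v
    have := congrArg (fun z => 2 * z) (h v)
    simp only [Finset.mul_sum, mul_zero] at this
    rw [← this]
    refine Finset.sum_congr rfl fun α _ => ?_
    rw [← (QF_lp α v).2.2]; ring
  have hB : ∀ v v' : Fin n → ℝ, ∑ α ∈ F', b α * ((∑ i, α i * v i) * (∑ i, α i * v' i) - ∑ i, α i * (v i * v' i)) = 0 := by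
    intro v v'
    have e := hq (v + v')
    have e1 := hq v
    have e2 := hq v'
    have : ∑ α ∈ F', b α * ((∑ i, α i * (v + v') i) ^ 2 - ∑ i, α i * (v + v') i ^ 2) =
        ∑ α ∈ F', b α * ((∑ i, α i * v i) ^ 2 - ∑ i, α i * v i ^ 2) +
        ∑ α ∈ F', b α * ((∑ i, α i * v' i) ^ 2 - ∑ i, α i * v' i ^ 2) +
        2 * ∑ α ∈ F', b α * ((∑ i, α i * v i) * (∑ i, α i * v' i) - ∑ i, α i * (v i * v' i)) := by
      rw [Finset.mul_sum, ← Finset.sum_add_distrib, ← Finset.sum_add_distrib]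
      refine Finset.sum_congr rfl fun α _ => ?_
      have f1 : ∑ i, (α i : ℝ) * (v + v') i = ∑ i, α i * v i + ∑ i, α i * v' i := by
        rw [← Finset.sum_add_distrib]; refine Finset.sum_congr rfl fun i _ => ?_
        simp; ring
      have f2 : ∑ i, (α i : ℝ) * (v + v') i ^ 2 = ∑ i, α i * v i ^ 2 + ∑ i, α i * v' i ^ 2 + 2 * ∑ i, α i * (v i * v' i) := by
        rw [Finset.mul_sum, ← Finset.sum_add_distrib, ← Finset.sum_add_distrib]; refine Finset.sum_congr rfl fun i _ => ?_
        simp; ring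
      rw [f1, f2]; ring
    linarith
  have hs : ∀ j, ∑ α ∈ F', b α * α j = 0 := by
    intro j
    by_cases hj : w j = W
    · refine Finset.sum_eq_zero fun α hα => ?_
      have : α j = 0 := by
        by_contra hne
        have h1 := hW α hα
        rw [← Finset.add_sum_erase _ _ (Finset.mem_univ j)] at h1
        have hα1 : (1:ℝ) ≤ α j := by exact_mod_cast Nat.one_le_iff_ne_zero.2 hne
        have h3 : ∀ i ∈ Finset.univ.erase j, 0 ≤ w i * (α i : ℝ) := fun i _ => mul_nonneg (hw i).le (Nat.cast_nonneg _)
        have h4 := Finset.sum_nonneg h3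
        have h5 : w j * 1 ≤ w j * α j := mul_le_mul_of_nonneg_left hα1 (hw j).le
        have h6 : ∑ i ∈ Finset.univ.erase j, w i * (α i : ℝ) = 0 := by linarith
        have h7 : w j * α j = w j * 1 := by linarith
        have h8 : (α j : ℝ) = 1 := mul_left_cancel₀ (hw j).ne' h7
        have h9 := (Finset.sum_eq_zero_iff_of_nonneg h3).1 h6
        have h10 : ∑ i ∈ Finset.univ.erase j, α i = 0 := by
          refine Finset.sum_eq_zero fun i hi => ?_
          have := h9 i hi
          rcases mul_eq_zero.1 this with h | h
          · exact absurd h (hw i).ne'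
          · exact_mod_cast h
        have h11 := h2 α hα
        rw [← Finset.add_sum_erase _ _ (Finset.mem_univ j), h10] at h11
        have : α j = 1 := by exact_mod_cast h8
        omega
      simp [this]
    · have e := hB w (Pi.single j 1)
      have e2 : ∑ α ∈ F', b α * ((∑ i, α i * w i) * (∑ i, α i * (Pi.single j 1 : Fin n → ℝ) i) -
          ∑ i, α i * (w i * (Pi.single j 1 : Fin n → ℝ) i)) = (W - w j) * ∑ α ∈ F', b α * α j := by
        rw [Finset.mul_sum]
        refine Finset.sum_congr rfl fun α hα => ?_
        have f1 : ∑ i, (α i : ℝ) * w i = W := by rw [← hW α hα]; exact Finset.sum_congr rfl fun i _ => mul_comm _ _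
        rw [f1]
        simp [Pi.single_apply]
        ring
      rw [e2] at e
      rcases mul_eq_zero.1 e with h | h
      · exact absurd (by linarith) hj
      · exact h
  have hs0 : ∑ α ∈ F', b α = 0 := by
    rcases F'.eq_empty_or_nonempty with rfl | ⟨α₀, hα₀⟩
    · simp
    have hWpos : 0 < W := by
      rw [← hW α₀ hα₀]
      obtain ⟨i, hi⟩ : ∃ i, α₀ i ≠ 0 := by
        by_contra! hh
        have := h2 α₀ hα₀
        simp [hh] at this
      refine Finset.sum_pos' (fun i _ => mul_nonneg (hw i).le (Nat.cast_nonneg _)) ⟨i, Finset.mem_univ _, ?_⟩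
      exact mul_pos (hw i) (by exact_mod_cast Nat.pos_of_ne_zero hi)
    have : W * ∑ α ∈ F', b α = ∑ j, w j * ∑ α ∈ F', b α * α j := by
      simp only [Finset.mul_sum]
      rw [Finset.sum_comm]
      refine Finset.sum_congr rfl fun α hα => ?_
      rw [← hW α hα, Finset.sum_mul]
      exact Finset.sum_congr rfl fun i _ => by ring
    simp only [hs, mul_zero, Finset.sum_const_zero] at this
    exact (mul_eq_zero.1 this).resolve_left hWpos.ne'
  intro k hk v
  interval_cases k
  · simp only [fun α => (QF_lp α v).1, mul_one]; exact hs0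
  · simp only [fun α => (QF_lp α v).2.1, Finset.mul_sum]
    rw [Finset.sum_comm]
    refine Finset.sum_eq_zero fun i _ => ?_
    have : ∑ α ∈ F', b α * (α i * v i) = (∑ α ∈ F', b α * α i) * v i := by
      rw [Finset.sum_mul]; exact Finset.sum_congr rfl fun _ _ => by ring
    rw [this, hs, zero_mul]

lemma face_contra {c : (Fin n → ℕ) → ℝ} {oS k0 : ℕ} (hoS : newtonOrder c = (oS : ℕ∞)) (hk0 : k0 = max oS 2)
    {A F' : Finset (Fin n → ℕ)} (hA1 : ∀ α ∈ A, c α ≠ 0) (hA : ∀ α, c α ≠ 0 → ∃ b ∈ A, b ≤ α)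
    (hc2 : ∀ α, c α ≠ 0 → 2 ≤ ∑ i, α i)
    (hF : F' ⊆ A) (hne : F'.Nonempty) {w : Fin n → ℝ} {W : ℝ} (hw : ∀ i, 0 < w i)
    (hW : ∀ α ∈ F', ∑ i, w i * α i = W) (hW2 : ∀ α ∈ A, α ∉ F' → W < ∑ i, w i * α i)
    {x : Fin n → ℝ} (hx : ∀ i, x i ≠ 0)
    (h : ∀ k, 2 ≤ k → k ≤ k0 → ∀ v : Fin n → ℝ,
      ∑ α ∈ F', (c α * monomial α x) * (lp α (fun _ => 1) v).coeff k = 0) : False := by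
  classical
  -- the face
  set l : (Fin n → ℝ) → ℝ := fun x => ∑ i, w i * x i with hl
  have hladd : ∀ (a b : ℝ) (x y : Fin n → ℝ), l (a • x + b • y) = a * l x + b * l y := by
    intro a b x y
    simp only [hl, Finset.mul_sum]
    rw [← Finset.sum_add_distrib]
    refine Finset.sum_congr rfl fun i _ => ?_
    simp; ring
  set e : (Fin n → ℕ) → (Fin n → ℝ) := fun α i => (α i : ℝ) with he
  set H : Set (Fin n → ℝ) := convexHull ℝ (e '' (F' : Set (Fin n → ℕ))) with hH
  have hHW : ∀ y ∈ H, l y = W := by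
    intro y hy
    have hcv : Convex ℝ {y : Fin n → ℝ | l y = W} := by
      intro a ha b hb s t hs ht hst
      simp only [Set.mem_ofPred_eq] at *
      rw [hladd, ha, hb, ← add_mul, hst, one_mul]
    refine convexHull_min ?_ hcv hy
    rintro _ ⟨α, hα, rfl⟩
    exact hW α hα
  have hTc : Convex ℝ ({y : Fin n → ℝ | W < l y} ∪ H) := by
    have hge : ∀ y ∈ ({y : Fin n → ℝ | W < l y} ∪ H), W ≤ l y := by
      rintro y (hy | hy)
      · exact le_of_lt hy
      · exact (hHW y hy).ge
    have hHc : Convex ℝ H := convex_convexHull ℝ _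
    intro a ha b hb s t hs ht hst
    by_cases hab : a ∈ H ∧ b ∈ H
    · exact Or.inr (hHc hab.1 hab.2 hs ht hst)
    rcases hs.eq_or_lt with rfl | hs'
    · rw [zero_add] at hst; subst hst; simpa using hb
    rcases ht.eq_or_lt with rfl | ht'
    · rw [add_zero] at hst; subst hst; simpa using ha
    left
    rw [Set.mem_ofPred_eq, hladd]
    have h1 := hge a ha
    have h2 := hge b hb
    have : W < l a ∨ W < l b := by
      rcases ha with ha | ha
      · exact Or.inl ha
      rcases hb with hb | hb
      · exact Or.inr hb
      exact absurd ⟨ha, hb⟩ hab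
    have e1 : W = s * W + t * W := by rw [← add_mul, hst, one_mul]
    rcases this with h | h
    · have := mul_lt_mul_of_pos_left h hs'
      have := mul_le_mul_of_nonneg_left h2 ht
      linarith
    · have := mul_lt_mul_of_pos_left h ht'
      have := mul_le_mul_of_nonneg_left h1 hs
      linarith
  have hoct : ∀ y : Fin n → ℝ, ∀ α, c α ≠ 0 → (∀ i, (α i : ℝ) ≤ y i) → W < l y ∨ (∃ b ∈ F', b ≤ α ∧ y = e b) := by
    intro y α hα hy
    obtain ⟨b, hb, hbα⟩ := hA α hα
    have hby : ∀ i, (b i : ℝ) ≤ y i := fun i => le_trans (by exact_mod_cast hbα i) (hy i)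
    have hle : l (e b) ≤ l y := Finset.sum_le_sum fun i _ => mul_le_mul_of_nonneg_left (hby i) (hw i).le
    by_cases hbF : b ∈ F'
    · by_cases hyb : y = e b
      · exact Or.inr ⟨b, hbF, hbα, hyb⟩
      left
      obtain ⟨i, hi⟩ := Function.ne_iff.1 hyb
      have : l (e b) < l y := by
        refine Finset.sum_lt_sum (fun i _ => mul_le_mul_of_nonneg_left (hby i) (hw i).le) ⟨i, Finset.mem_univ _, ?_⟩
        exact mul_lt_mul_of_pos_left (lt_of_le_of_ne (hby i) (Ne.symm hi)) (hw i)
      calc W = l (e b) := (hW b hbF).symm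
        _ < _ := this
    · left
      exact (hW2 b hb hbF).trans_le hle
  have hN : newtonPolyhedron c ⊆ {y : Fin n → ℝ | W < l y} ∪ H := by
    refine convexHull_min ?_ hTc
    rintro y ⟨α, hα, hy⟩
    rcases hoct y α hα hy with h | ⟨b, hb, -, h⟩
    · exact Or.inl h
    · right; rw [h]; exact subset_convexHull ℝ _ ⟨b, hb, rfl⟩
  have hHN : H ⊆ newtonPolyhedron c := by
    refine convexHull_min ?_ (convex_convexHull ℝ _)
    rintro _ ⟨α, hα, rfl⟩
    exact subset_convexHull ℝ _ ⟨α, hA1 α (hF hα), fun i => le_rfl⟩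
  have hface : IsCompactFace c H := by
    refine ⟨?_, ?_, ?_⟩
    · intro _
      set L : (Fin n → ℝ) →L[ℝ] ℝ := ∑ i, (- w i) • ContinuousLinearMap.proj i with hL
      have hLl : ∀ y, L y = - l y := by intro y; simp [hL, hl]
      refine ⟨L, ?_⟩
      ext y
      constructor
      · intro hy
        refine ⟨hHN hy, fun z hz => ?_⟩
        rw [hLl, hLl, hHW y hy]
        rcases hN hz with h | h
        · have : W < l z := h
          linarith
        · rw [hHW z h]
      · rintro ⟨hy, hmax⟩
        obtain ⟨α, hα⟩ := hne
        have h1 := hmax (e α) (hHN (subset_convexHull ℝ _ ⟨α, hα, rfl⟩))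
        rw [hLl, hLl] at h1
        have h2 : l (e α) = W := hW α hα
        rcases hN hy with h | h
        · have : W < l y := h
          linarith
        · exact h
    · obtain ⟨α, hα⟩ := hne
      exact ⟨e α, subset_convexHull ℝ _ ⟨α, hα, rfl⟩⟩
    · exact (F'.finite_toSet.image e).isCompact_convexHull ℝ
  have hfp : facePoly c H = fun t => ∑ α ∈ F', c α * monomial α t := by
    ext t
    unfold facePoly
    have hmem : ∀ α ∈ F', e α ∈ H := fun α hα => subset_convexHull ℝ _ ⟨α, hα, rfl⟩
    have h1 : ∑' α : {α : Fin n → ℕ // (fun i => (α i : ℝ)) ∈ H}, c α.1 * monomial α.1 t =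
        ∑' α : Fin n → ℕ, Set.indicator {α : Fin n → ℕ | e α ∈ H} (fun α => c α * monomial α t) α :=
      tsum_subtype {α : Fin n → ℕ | e α ∈ H} (fun α => c α * monomial α t)
    rw [h1, tsum_eq_sum (s := F')]
    · refine Finset.sum_congr rfl fun α hα => ?_
      rw [Set.indicator_of_mem]
      exact hmem α hα
    · intro α hα
      by_cases hαH : e α ∈ H
      · rw [Set.indicator_of_mem (by exact hαH)]
        by_cases h0 : c α = 0
        · simp [h0]
        exfalso
        rcases hoct (e α) α h0 (fun i => le_rfl) with h | ⟨b, hb, hbα, h⟩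
        · exact absurd (hHW _ hαH) h.ne'
        · refine hα ?_
          have : α = b := by
            ext i
            have := congrFun h i
            simpa [he] using this
          rwa [this]
      · rw [Set.indicator_of_notMem (by exact hαH)]
  -- vanishing
  have hk02 : 2 ≤ k0 := by rw [hk0]; exact le_max_right _ _
  have hlow := face_low (b := fun α => c α * monomial α x) hw hW (fun α hα => hc2 α (hA1 α (hF hα)))
    (fun v => h 2 le_rfl hk02 v)
  have hall : ∀ k ≤ k0, ∀ y : Fin n → ℝ, ∑ α ∈ F', c α * (lp α x y).coeff k = 0 := by
    intro k hk y
    have h1 : ∑ α ∈ F', (c α * monomial α x) * (lp α (fun _ => 1) (fun i => y i / x i)).coeff k = 0 := by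
      by_cases h2 : 2 ≤ k
      · exact h k h2 hk _
      · exact hlow k (by omega) _
    rw [← h1]
    refine Finset.sum_congr rfl fun α _ => ?_
    have := lp_scale α x (fun _ => 1) (fun i => y i / x i)
    have e1 : (fun i => x i * (y i / x i)) = y := by
      ext i; rw [mul_div_cancel₀ _ (hx i)]
    simp only [mul_one, e1] at this
    have e2 : lp α x y = lp α (fun i => x i) y := rfl
    rw [e2, this, Polynomial.coeff_C_mul]; ring
  have hiter := iter_zero hall
  have hle : ((k0 + 1 : ℕ) : ℕ∞) ≤ newtonOrder c := by
    unfold newtonOrder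
    refine le_sSup ⟨H, hface, x, hx, ?_, ?_⟩
    · rw [hfp]
      have := hall 0 (by omega) 0
      rw [← this]
      refine Finset.sum_congr rfl fun α _ => ?_
      rw [Polynomial.coeff_zero_eq_eval_zero, eval_lp]
      simp
    · unfold vanishingOrder
      refine le_sSup ?_
      intro j hj
      rw [hfp]
      refine hiter j ?_
      have : j < k0 + 1 := by exact_mod_cast hj
      omega
  rw [hoS] at hle
  have h1 : k0 + 1 ≤ oS := by exact_mod_cast hle
  have h2 := le_max_left oS 2
  omega

end

section

def PC {X : Type*} [TopologicalSpace X] (p : X → Polynomial ℝ) : Prop := ∀ k, Continuous fun x => (p x).coeff k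

lemma PC.mul {X : Type*} [TopologicalSpace X] {p q : X → Polynomial ℝ} (h : PC p) (h' : PC q) :
    PC (fun x => p x * q x) := by
  intro k
  simp only [Polynomial.coeff_mul]
  exact continuous_finsetSum _ fun i _ => (h _).mul (h' _)

lemma PC.const {X : Type*} [TopologicalSpace X] (p : Polynomial ℝ) : PC (fun _ : X => p) := fun _ => continuous_const

lemma PC.pow {X : Type*} [TopologicalSpace X] {p : X → Polynomial ℝ} (h : PC p) (j : ℕ) : PC (fun x => p x ^ j) := by
  induction j with
  | zero => simpa using PC.const (X := X) 1
  | succ j ih => simp only [pow_succ]; exact ih.mul h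

lemma PC.prod {X ι : Type*} [TopologicalSpace X] (s : Finset ι) {p : ι → X → Polynomial ℝ} (h : ∀ i, PC (p i)) :
    PC (fun x => ∏ i ∈ s, p i x) := by
  classical
  induction s using Finset.induction_on with
  | empty => simpa using PC.const (X := X) 1
  | insert a s ha ih => simp only [Finset.prod_insert ha]; exact (h a).mul ih

lemma continuous_dc (k : ℕ) (α : Fin n → ℕ) {X : Type*} [TopologicalSpace X] {t v : X → Fin n → ℝ}
    (ht : Continuous t) (hv : Continuous v) : Continuous fun x => dc k α (t x) (v x) := by
  unfold dc
  refine continuous_const.mul ?_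
  refine PC.prod (X := X) (p := fun i x => (Polynomial.C (t x i) + Polynomial.C (v x i) * Polynomial.X) ^ α i) Finset.univ (fun i => PC.pow ?_ _) k
  intro k
  simp only [Polynomial.coeff_add, Polynomial.coeff_C, Polynomial.coeff_C_mul, Polynomial.coeff_X]
  split_ifs <;> fun_prop

lemma monomial_split {α b : Fin n → ℕ} (h : b ≤ α) (t : Fin n → ℝ) :
    monomial α t = monomial b t * monomial (α - b) t := by
  unfold monomial
  rw [← Finset.prod_mul_distrib]
  refine Finset.prod_congr rfl fun i _ => ?_
  rw [← pow_add, Pi.sub_apply, Nat.add_sub_cancel' (h i)]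

lemma abs_monomial (α : Fin n → ℕ) (t : Fin n → ℝ) : |monomial α t| = ∏ i, |t i| ^ α i := by
  unfold monomial; rw [Finset.abs_prod]; simp [abs_pow]

lemma abs_monomial_le_sig {A : Finset (Fin n → ℕ)} {b : Fin n → ℕ} (hb : b ∈ A) (t : Fin n → ℝ) :
    |monomial b t| ≤ sig A t := by
  rw [abs_monomial]
  exact Finset.single_le_sum (f := fun b => ∏ i, |t i| ^ b i) (fun b _ => by positivity) hb

lemma ratio_le {A : Finset (Fin n → ℕ)} {α b : Fin n → ℕ} (hb : b ∈ A) (h : b ≤ α) {t : Fin n → ℝ} (ht : ∀ i, t i ≠ 0)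
    {r : ℝ} (hr : ∀ i, |t i| ≤ r) : |monomial α t / sig A t| ≤ r ^ (∑ i, (α - b) i) := by
  have hs := sig_pos ⟨b, hb⟩ ht
  rw [abs_div, abs_of_pos hs, div_le_iff₀ hs, monomial_split h, abs_mul, mul_comm]
  exact mul_le_mul (monomial_abs_le _ hr) (abs_monomial_le_sig hb t) (abs_nonneg _)
    ((abs_nonneg _).trans (monomial_abs_le (α - b) hr))

lemma dS_tendsto {S : (Fin n → ℝ) → ℝ} {c : (Fin n → ℕ) → ℝ} {R : ℝ} (hR : GoodR S c R) {A : Finset (Fin n → ℕ)}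
    (hA : ∀ α, c α ≠ 0 → ∃ b ∈ A, b ≤ α)
    {δ : ℝ} (hδ : 0 < δ) (hδ1 : δ ≤ 1) (hδR : 2 * δ ≤ R) {U : Filter ℕ} {τ : ℕ → Fin n → ℝ}
    (hτ : ∀ N i, τ N i ≠ 0 ∧ |τ N i| ≤ δ) {E : (Fin n → ℕ) → ℝ}
    (hE : ∀ α, c α ≠ 0 → Tendsto (fun N => monomial α (τ N) / sig A (τ N)) U (𝓝 (E α)))
    {u : ℕ → Fin n → ℝ} (hu : ∀ N i, |u N i| ≤ 1) (hu1 : Tendsto u U (𝓝 (fun _ => 1))) {v : Fin n → ℝ}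
    (hv : ∀ i, |v i| ≤ 1) (k : ℕ) :
    Tendsto (fun N => dS c k (fun i => τ N i * u N i) (fun i => τ N i * v i) / sig A (τ N)) U
      (𝓝 (∑' α, c α * E α * dc k α (fun _ => 1) v)) := by
  have e : ∀ N, dS c k (fun i => τ N i * u N i) (fun i => τ N i * v i) / sig A (τ N) =
      ∑' α, c α * (monomial α (τ N) / sig A (τ N)) * dc k α (u N) v := by
    intro N
    unfold dS
    rw [← tsum_div_const]
    refine tsum_congr fun α => ?_
    rw [dc_scale]; ring
  simp only [e]
  set D := A.sup (fun b => ∑ i, b i) with hD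
  refine tendsto_tsum_of_dominated_convergence
    (bound := fun α => (k.factorial / δ ^ D) * (|c α| * R ^ (∑ i, α i))) (hR.2.1.mul_left _) ?_ ?_
  · intro α
    by_cases h0 : c α = 0
    · simp [h0]; exact tendsto_const_nhds
    refine ((hE α h0).const_mul _).mul ?_
    have h1 : Continuous (fun u => dc k α u v) := continuous_dc k α continuous_id continuous_const
    exact (h1.tendsto _).comp hu1
  · refine Eventually.of_forall fun N α => ?_
    by_cases h0 : c α = 0
    · simp [h0]
    obtain ⟨b, hb, hbα⟩ := hA α h0
    have h1 := ratio_le hb hbα (fun i => (hτ N i).1) (fun i => (hτ N i).2)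
    have h2 : |dc k α (u N) v| ≤ k.factorial * 2 ^ (∑ i, α i) := dc_le k α fun i => by linarith [hu N i, hv i]
    have h3 : δ ^ (∑ i, (α - b) i) ≤ δ ^ (∑ i, α i) / δ ^ D := by
      rw [le_div_iff₀ (by positivity)]
      have : ∑ i, α i = ∑ i, (α - b) i + ∑ i, b i := by
        rw [← Finset.sum_add_distrib]
        exact Finset.sum_congr rfl fun i _ => by rw [Pi.sub_apply, Nat.sub_add_cancel (hbα i)]
      rw [this, pow_add]
      refine mul_le_mul_of_nonneg_left ?_ (by positivity)
      exact pow_le_pow_of_le_one hδ.le hδ1 (Finset.le_sup (f := fun b => ∑ i, b i) hb)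
    rw [Real.norm_eq_abs, abs_mul, abs_mul]
    calc |c α| * |monomial α (τ N) / sig A (τ N)| * |dc k α (u N) v|
        ≤ |c α| * (δ ^ (∑ i, α i) / δ ^ D) * (k.factorial * 2 ^ (∑ i, α i)) := by
          gcongr
          exact h1.trans h3
      _ = (k.factorial / δ ^ D) * (|c α| * (2 * δ) ^ (∑ i, α i)) := by rw [mul_pow]; ring
      _ ≤ _ := by gcongr

lemma exists_pinv {V W : Type*} [AddCommGroup V] [Module ℝ V] [AddCommGroup W] [Module ℝ W] (L : V →ₗ[ℝ] W) :
    ∃ g : W →ₗ[ℝ] V, ∀ y, L (g (L y)) = L y := by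
  obtain ⟨g0, hg0⟩ := L.rangeRestrict.exists_rightInverse_of_surjective L.range_rangeRestrict
  obtain ⟨g, hg⟩ := g0.exists_extend
  refine ⟨g, fun y => ?_⟩
  have h1 : g (L y) = g0 (L.rangeRestrict y) := by
    rw [← hg]; rfl
  have h2 := congrArg (fun f => ((f (L.rangeRestrict y) : L.range) : W)) hg0
  rw [h1]
  simpa using h2

/-- Structure of the dominating face. -/
lemma face_structure {A F' : Finset (Fin n → ℕ)} {U : Ultrafilter ℕ} {τ : ℕ → Fin n → ℝ}
    (hτ : ∀ N i, τ N i ≠ 0) (hτ0 : ∀ i, Tendsto (fun N => |τ N i|) U (𝓝 0)) {E : (Fin n → ℕ) → ℝ}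
    (hE : ∀ α ∈ A, Tendsto (fun N => monomial α (τ N) / sig A (τ N)) U (𝓝 (E α)))
    (hF : ∀ α, α ∈ F' ↔ α ∈ A ∧ E α ≠ 0) (hne : F'.Nonempty) :
    ∃ (w x : Fin n → ℝ) (W κ : ℝ), (∀ i, 0 < w i) ∧ (∀ i, x i ≠ 0) ∧ κ ≠ 0 ∧ (∀ α ∈ F', ∑ i, w i * α i = W) ∧
      (∀ α ∈ A, α ∉ F' → W < ∑ i, w i * α i) ∧ ∀ α ∈ F', E α = κ * monomial α x := by
  classical
  obtain ⟨α₀, hα₀⟩ := hne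
  have hα₀A := ((hF α₀).1 hα₀).1
  have hE₀ := ((hF α₀).1 hα₀).2
  -- signs
  have hsign : ∀ i, ∃ s : ℝ, s ≠ 0 ∧ ∀ᶠ N in (U : Filter ℕ), τ N i = s * |τ N i| := by
    intro i
    have : ∀ᶠ N in (U : Filter ℕ), 0 < τ N i ∨ τ N i < 0 := Eventually.of_forall fun N => (lt_or_gt_of_ne (hτ N i)).symm
    rcases Ultrafilter.eventually_or.1 this with h | h
    · exact ⟨1, one_ne_zero, h.mono fun N hN => by rw [abs_of_pos hN, one_mul]⟩
    · exact ⟨-1, by norm_num, h.mono fun N hN => by rw [abs_of_neg hN]; ring⟩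
  choose s hs0 hs using hsign
  have hs' : ∀ᶠ N in (U : Filter ℕ), ∀ i, τ N i = s i * |τ N i| := eventually_all.2 hs
  set ℓ : ℕ → Fin n → ℝ := fun N i => - Real.log |τ N i| with hℓ
  have hℓinf : ∀ i, Tendsto (fun N => ℓ N i) U atTop := by
    intro i
    refine tendsto_neg_atBot_atTop.comp ?_
    have h1 : Tendsto (fun N => |τ N i|) U (𝓝[>] 0) :=
      tendsto_nhdsWithin_iff.2 ⟨hτ0 i, Eventually.of_forall fun N => abs_pos.2 (hτ N i)⟩
    exact Real.tendsto_log_nhdsGT_zero.comp h1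
  set dot : (Fin n → ℝ) → (Fin n → ℕ) → ℝ := fun y α => ∑ i, y i * α i with hdot
  have hms : ∀ (y : Fin n → ℝ) (α : Fin n → ℕ), monomial α (fun i => s i * Real.exp (- y i)) = monomial α s * Real.exp (- dot y α) := by
    intro y α
    unfold monomial
    simp only [hdot]
    rw [← Finset.sum_neg_distrib, Real.exp_sum, ← Finset.prod_mul_distrib]
    refine Finset.prod_congr rfl fun i _ => ?_
    rw [mul_pow, ← Real.exp_nat_mul]
    congr 2; ring
  have hms0 : ∀ α, monomial α s ≠ 0 := fun α => Finset.prod_ne_zero_iff.2 fun i _ => pow_ne_zero _ (hs0 i)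
  have hmono : ∀ᶠ N in (U : Filter ℕ), ∀ α, monomial α (τ N) = monomial α s * Real.exp (- dot (ℓ N) α) := by
    filter_upwards [hs'] with N hN α
    rw [← hms]
    congr 1
    ext i
    rw [hN i]
    simp only [hℓ, neg_neg]
    rw [Real.exp_log (abs_pos.2 (hτ N i)), ← hN i]
  -- ratios
  have hrat : ∀ α ∈ A, Tendsto (fun N => Real.exp (-(dot (ℓ N) α - dot (ℓ N) α₀))) U
      (𝓝 (E α / E α₀ * (monomial α₀ s / monomial α s))) := by
    intro α hα
    have h1 := ((hE α hα).div (hE α₀ hα₀A) hE₀).mul_const (monomial α₀ s / monomial α s)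
    refine h1.congr' ?_
    filter_upwards [hmono] with N hN
    simp only [Pi.div_apply]
    rw [hN α, hN α₀]
    have hsg := sig_pos ⟨α, hα⟩ (hτ N)
    have e1 : -(dot (ℓ N) α - dot (ℓ N) α₀) = - dot (ℓ N) α - (- dot (ℓ N) α₀) := by ring
    rw [e1, Real.exp_sub]
    have h2 := hms0 α
    have h3 := hms0 α₀
    field_simp
  have hpos : ∀ α ∈ F', 0 < E α / E α₀ * (monomial α₀ s / monomial α s) := by
    intro α hα
    have h1 := hrat α ((hF α).1 hα).1
    have h2 : 0 ≤ E α / E α₀ * (monomial α₀ s / monomial α s) :=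
      ge_of_tendsto h1 (Eventually.of_forall fun N => (Real.exp_pos _).le)
    refine lt_of_le_of_ne h2 (Ne.symm ?_)
    exact mul_ne_zero (div_ne_zero ((hF α).1 hα).2 hE₀) (div_ne_zero (hms0 _) (hms0 _))
  set r : F' → ℝ := fun α => - Real.log (E α.1 / E α₀ * (monomial α₀ s / monomial α.1 s)) with hr
  let L : (Fin n → ℝ) →ₗ[ℝ] (F' → ℝ) :=
    { toFun := fun y α => dot y α.1 - dot y α₀
      map_add' := by
        intro x y; ext α
        simp only [hdot, Pi.add_apply, add_mul, Finset.sum_add_distrib]; ring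
      map_smul' := by
        intro a y; ext α
        simp only [hdot, Pi.smul_apply, smul_eq_mul, RingHom.id_apply, mul_assoc, ← Finset.mul_sum]; ring }
  have hL : ∀ y α, L y α = dot y α.1 - dot y α₀ := fun y α => rfl
  have hLr : Tendsto (fun N => L (ℓ N)) U (𝓝 r) := by
    rw [tendsto_pi_nhds]
    intro α
    have h1 := ((hrat α.1 ((hF α.1).1 α.2).1).log (hpos α.1 α.2).ne').neg
    refine h1.congr fun N => ?_
    rw [Real.log_exp, neg_neg, hL]
  obtain ⟨g, hg⟩ := exists_pinv L
  have hgc : Continuous g := g.continuous_of_finiteDimensional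
  have hLc : Continuous L := L.continuous_of_finiteDimensional
  set y := g r with hy
  have hz : Tendsto (fun N => g (L (ℓ N))) U (𝓝 y) := (hgc.tendsto r).comp hLr
  have hLy : L y = r := by
    have h1 := (hLc.tendsto y).comp hz
    have h2 : (L ∘ fun N => g (L (ℓ N))) = fun N => L (ℓ N) := by ext N; simp [hg]
    rw [h2] at h1
    exact tendsto_nhds_unique h1 hLr
  have hdotc : ∀ α, Continuous fun y => dot y α := fun α => by simp only [hdot]; fun_prop
  have hev1 : ∀ᶠ N in (U : Filter ℕ), ∀ i, 0 < ℓ N i - g (L (ℓ N)) i := by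
    refine eventually_all.2 fun i => ?_
    have h1 : Tendsto (fun N => ℓ N i + - g (L (ℓ N)) i) U atTop :=
      (hℓinf i).atTop_add ((tendsto_pi_nhds.1 hz i).neg)
    filter_upwards [h1.eventually_gt_atTop 0] with N hN
    linarith
  have hev2 : ∀ᶠ N in (U : Filter ℕ), ∀ α ∈ A, α ∉ F' →
      0 < (dot (ℓ N) α - dot (ℓ N) α₀) - (dot (g (L (ℓ N))) α - dot (g (L (ℓ N))) α₀) := by
    refine (Finset.eventually_all A).2 fun α hα => ?_
    by_cases hαF : α ∈ F'
    · exact Eventually.of_forall fun N h => absurd hαF h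
    have hE0 : E α = 0 := by
      by_contra h; exact hαF ((hF α).2 ⟨hα, h⟩)
    have h1 := hrat α hα
    rw [hE0, zero_div, zero_mul, Real.tendsto_exp_comp_nhds_zero] at h1
    have h2 := tendsto_neg_atBot_atTop.comp h1
    have h3 : Tendsto (fun N => - (dot (g (L (ℓ N))) α - dot (g (L (ℓ N))) α₀)) U (𝓝 (-(dot y α - dot y α₀))) :=
      (((((hdotc α).sub (hdotc α₀)).neg).tendsto y).comp hz)
    have h4 := h2.atTop_add h3
    filter_upwards [h4.eventually_gt_atTop 0] with N hN _
    simp only [Function.comp_apply, neg_neg] at hN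
    linarith
  obtain ⟨N, hN1, hN2⟩ := (hev1.and hev2).exists
  have hdsub : ∀ (a b : Fin n → ℝ) α, dot (a - b) α = dot a α - dot b α := by
    intro a b α; simp [hdot, sub_mul, Finset.sum_sub_distrib]
  refine ⟨ℓ N - g (L (ℓ N)), fun i => s i * Real.exp (- y i), dot (ℓ N - g (L (ℓ N))) α₀,
    E α₀ / monomial α₀ (fun i => s i * Real.exp (- y i)), fun i => hN1 i, fun i => mul_ne_zero (hs0 i) (Real.exp_pos _).ne',
    div_ne_zero hE₀ ?_, ?_, ?_, ?_⟩
  · rw [hms]; exact mul_ne_zero (hms0 _) (Real.exp_pos _).ne'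
  · intro α hα
    have h1 := congrFun (hg (ℓ N)) ⟨α, hα⟩
    simp only [hL] at h1
    change dot _ α = dot _ α₀
    rw [hdsub, hdsub]; linarith
  · intro α hα hαF
    have h1 := hN2 α hα hαF
    change dot _ α₀ < dot _ α
    rw [hdsub, hdsub]; linarith
  · intro α hα
    have h1 := congrFun hLy ⟨α, hα⟩
    simp only [hL, hr] at h1
    have h2 := hpos α hα
    have h3 : Real.exp (-(dot y α - dot y α₀)) = E α / E α₀ * (monomial α₀ s / monomial α s) := by
      rw [h1, neg_neg, Real.exp_log h2]
    have e1 : -(dot y α - dot y α₀) = - dot y α - (- dot y α₀) := by ring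
    rw [e1, Real.exp_sub, div_eq_iff (Real.exp_pos _).ne'] at h3
    rw [hms, hms, h3]
    have h4 := hms0 α
    have h5 := hms0 α₀
    have h6 := (Real.exp_pos (- dot y α₀)).ne'
    field_simp


lemma key_limit {c : (Fin n → ℕ) → ℝ} {oS k0 : ℕ} (hoS : newtonOrder c = oS) (hk0 : k0 = max oS 2)
    {S : (Fin n → ℝ) → ℝ} {R : ℝ} (hR : GoodR S c R) {A : Finset (Fin n → ℕ)}
    (hA1 : ∀ α ∈ A, c α ≠ 0) (hA : ∀ α, c α ≠ 0 → ∃ b ∈ A, b ≤ α) (hAne : A.Nonempty)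
    (hc2 : ∀ α, c α ≠ 0 → 2 ≤ ∑ i, α i)
    {δ : ℝ} (hδ : 0 < δ) (hδ1 : δ ≤ 1) (hδR : 2 * δ ≤ R) {U : Ultrafilter ℕ} {τ : ℕ → Fin n → ℝ}
    (hτ : ∀ N i, τ N i ≠ 0 ∧ |τ N i| ≤ δ) (hτ0 : ∀ i, Tendsto (fun N => |τ N i|) U (𝓝 0))
    (h : ∀ v : Fin n → ℝ, (∀ i, |v i| ≤ 1) → ∀ k, 2 ≤ k → k ≤ k0 →
      ∃ u₁ u₂ : ℕ → Fin n → ℝ, (∀ N i, |u₁ N i| ≤ 1) ∧ (∀ N i, |u₂ N i| ≤ 1) ∧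
        Tendsto u₁ U (𝓝 (fun _ => 1)) ∧ Tendsto u₂ U (𝓝 (fun _ => 1)) ∧ ∃ ε : ℕ → ℝ, Tendsto ε U (𝓝 0) ∧ ∀ N,
        dS c k (fun i => τ N i * u₁ N i) (fun i => τ N i * v i) ≤ ε N * sig A (τ N) ∧
        - (ε N * sig A (τ N)) ≤ dS c k (fun i => τ N i * u₂ N i) (fun i => τ N i * v i)) : False := by
  classical
  have hsp : ∀ N, 0 < sig A (τ N) := fun N => sig_pos hAne fun i => (hτ N i).1
  have hlim : ∀ α, ∃ e : ℝ, (α ∈ A → Tendsto (fun N => monomial α (τ N) / sig A (τ N)) U (𝓝 e)) ∧ (α ∉ A → e = 0) := by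
    intro α
    by_cases hα : α ∈ A
    · have hK : IsCompact (Icc (-1:ℝ) 1) := isCompact_Icc
      have h1 : ∀ N, monomial α (τ N) / sig A (τ N) ∈ Icc (-1:ℝ) 1 := by
        intro N
        rw [Set.mem_Icc, ← abs_le, abs_div, abs_of_pos (hsp N), div_le_one (hsp N)]
        exact abs_monomial_le_sig hα _
      obtain ⟨e, -, he⟩ := hK.ultrafilter_le_nhds (U.map fun N => monomial α (τ N) / sig A (τ N))
        (le_principal_iff.2 (Filter.mem_map.2 (Filter.univ_mem' h1)))
      exact ⟨e, fun _ => he, fun h => absurd hα h⟩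
    · exact ⟨0, fun h => absurd h hα, fun _ => rfl⟩
  choose E hE1 hE0 using hlim
  have hE : ∀ α, c α ≠ 0 → Tendsto (fun N => monomial α (τ N) / sig A (τ N)) U (𝓝 (E α)) := by
    intro α hα
    by_cases hαA : α ∈ A
    · exact hE1 α hαA
    rw [hE0 α hαA]
    obtain ⟨b, hb, hbα⟩ := hA α hα
    have hne : b ≠ α := fun h => hαA (h ▸ hb)
    obtain ⟨j, hj⟩ : ∃ j, b j < α j := by
      by_contra hcon
      push Not at hcon
      exact hne (le_antisymm hbα hcon)
    refine squeeze_zero_norm (a := fun N => |τ N j|) (fun N => ?_) (hτ0 j)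
    rw [Real.norm_eq_abs, abs_div, abs_of_pos (hsp N), div_le_iff₀ (hsp N), monomial_split hbα, abs_mul, mul_comm]
    refine mul_le_mul ?_ (abs_monomial_le_sig hb _) (abs_nonneg _) (abs_nonneg _)
    rw [abs_monomial, ← Finset.mul_prod_erase _ _ (Finset.mem_univ j)]
    have h1 : ∀ i, |τ N i| ≤ 1 := fun i => (hτ N i).2.trans hδ1
    have h2 : |τ N j| ^ (α - b) j ≤ |τ N j| := by
      have : (α - b) j ≠ 0 := by simp only [Pi.sub_apply]; omega
      exact pow_le_of_le_one (abs_nonneg _) (h1 j) this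
    have h3 : ∏ i ∈ Finset.univ.erase j, |τ N i| ^ (α - b) i ≤ 1 :=
      Finset.prod_le_one (fun i _ => by positivity) fun i _ => pow_le_one₀ (abs_nonneg _) (h1 i)
    calc _ ≤ |τ N j| * 1 := mul_le_mul h2 h3 (Finset.prod_nonneg fun i _ => by positivity) (abs_nonneg _)
      _ = _ := mul_one _
  set F' := A.filter (fun α => E α ≠ 0) with hF'
  have hFmem : ∀ α, α ∈ F' ↔ α ∈ A ∧ E α ≠ 0 := fun α => by rw [hF', Finset.mem_filter]
  have hFne : F'.Nonempty := by
    by_contra hcon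
    rw [Finset.not_nonempty_iff_eq_empty] at hcon
    have hz : ∀ α ∈ A, E α = 0 := by
      intro α hα
      by_contra h0
      have : α ∈ F' := (hFmem α).2 ⟨hα, h0⟩
      rw [hcon] at this; simp at this
    have h1 : Tendsto (fun N => ∑ α ∈ A, |monomial α (τ N) / sig A (τ N)|) U (𝓝 (∑ α ∈ A, |E α|)) :=
      tendsto_finsetSum _ fun α hα => (hE1 α hα).abs
    have h2 : ∑ α ∈ A, |E α| = 0 := Finset.sum_eq_zero fun α hα => by rw [hz α hα, abs_zero]
    have h3 : (fun N => ∑ α ∈ A, |monomial α (τ N) / sig A (τ N)|) = fun _ => (1:ℝ) := by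
      ext N
      simp only [abs_div, abs_of_pos (hsp N)]
      rw [← Finset.sum_div, div_eq_one_iff_eq (hsp N).ne']
      unfold sig
      exact Finset.sum_congr rfl fun α _ => abs_monomial _ _
    rw [h2, h3] at h1
    exact one_ne_zero (tendsto_nhds_unique tendsto_const_nhds h1)
  have hzero : ∀ v : Fin n → ℝ, (∀ i, |v i| ≤ 1) → ∀ k, 2 ≤ k → k ≤ k0 →
      ∑ α ∈ F', c α * E α * dc k α (fun _ => 1) v = 0 := by
    intro v hv k hk hkk
    obtain ⟨u₁, u₂, hu₁, hu₂, ht₁, ht₂, ε, hε, hN⟩ := h v hv k hk hkk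
    have l1 := dS_tendsto hR hA hδ hδ1 hδR hτ hE hu₁ ht₁ hv k
    have l2 := dS_tendsto hR hA hδ hδ1 hδR hτ hE hu₂ ht₂ hv k
    have e : ∑' α, c α * E α * dc k α (fun _ => 1) v = ∑ α ∈ F', c α * E α * dc k α (fun _ => 1) v := by
      refine tsum_eq_sum fun α hα => ?_
      have : E α = 0 := by
        by_contra h0
        by_cases hαA : α ∈ A
        · exact hα ((hFmem α).2 ⟨hαA, h0⟩)
        · exact h0 (hE0 α hαA)
      rw [this]; ring
    rw [← e]
    refine le_antisymm ?_ ?_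
    · refine le_of_tendsto_of_tendsto l1 hε (Eventually.of_forall fun N => ?_)
      rw [div_le_iff₀ (hsp N)]; exact (hN N).1
    · have hε' := hε.neg
      rw [neg_zero] at hε'
      refine le_of_tendsto_of_tendsto hε' l2 (Eventually.of_forall fun N => ?_)
      rw [le_div_iff₀ (hsp N)]; linarith [(hN N).2]
  obtain ⟨w, x, W, κ, hw, hx, hκ, hW, hW2, hEx⟩ := face_structure (fun N i => (hτ N i).1) hτ0 hE1 hFmem hFne
  refine face_contra (F' := F') (w := w) (W := W) (x := x) hoS hk0 hA1 hA hc2 (Finset.filter_subset _ _) hFne hw hW hW2 hx ?_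
  intro k hk hkk v
  -- scale v
  set M := 1 + ∑ i, |v i| with hM
  have hMp : 0 < M := by positivity
  have h1 := hzero (fun i => M⁻¹ * v i) (fun i => by
    rw [abs_mul, abs_inv, abs_of_pos hMp, inv_mul_le_iff₀ hMp, mul_one]
    have := Finset.single_le_sum (f := fun i => |v i|) (fun i _ => abs_nonneg _) (Finset.mem_univ i)
    linarith) k hk hkk
  have h2 : ∑ α ∈ F', c α * E α * dc k α (fun _ => 1) (fun i => M⁻¹ * v i) =
      (κ * (M⁻¹) ^ k * k.factorial) * ∑ α ∈ F', (c α * monomial α x) * (lp α (fun _ => 1) v).coeff k := by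
    rw [Finset.mul_sum]
    refine Finset.sum_congr rfl fun α hα => ?_
    rw [dc_homog, hEx α hα]; unfold dc; ring
  rw [h2] at h1
  refine (mul_eq_zero.1 h1).resolve_left ?_
  have : (k.factorial : ℝ) ≠ 0 := by exact_mod_cast k.factorial_ne_zero
  positivity

/-- The key nondegeneracy lemma. -/
lemma key {c : (Fin n → ℕ) → ℝ} {oS k0 : ℕ} (hoS : newtonOrder c = oS) (hk0 : k0 = max oS 2)
    {S : (Fin n → ℝ) → ℝ} {R : ℝ} (hR : GoodR S c R) {A : Finset (Fin n → ℕ)}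
    (hA1 : ∀ α ∈ A, c α ≠ 0) (hA : ∀ α, c α ≠ 0 → ∃ b ∈ A, b ≤ α) (hAne : A.Nonempty)
    (hc2 : ∀ α, c α ≠ 0 → 2 ≤ ∑ i, α i) :
    ∃ δ > 0, ∃ c0 > 0, ∃ r : ℝ, 0 < r ∧ r < 1 ∧ ∀ τ : Fin n → ℝ, (∀ i, 0 < |τ i| ∧ |τ i| < δ) →
      ∃ v : Fin n → ℝ, (∀ i, |v i| ≤ 1) ∧ ∃ k, 2 ≤ k ∧ k ≤ k0 ∧
        ((∀ u : Fin n → ℝ, (∀ i, u i ∈ Icc r 1) → c0 * sig A τ ≤ dS c k (fun i => τ i * u i) (fun i => τ i * v i)) ∨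
         (∀ u : Fin n → ℝ, (∀ i, u i ∈ Icc r 1) → dS c k (fun i => τ i * u i) (fun i => τ i * v i) ≤ -(c0 * sig A τ))) := by
  by_contra hcon
  push Not at hcon
  set δ := min 1 (R / 2) with hδ
  have hRp := hR.1
  have hδp : 0 < δ := lt_min one_pos (by linarith)
  have hδ1 : δ ≤ 1 := min_le_left _ _
  have hδR : 2 * δ ≤ R := by linarith [min_le_right 1 (R/2)]
  have hN1 : ∀ N : ℕ, (0:ℝ) < N + 1 := fun N => by positivity
  have hr : ∀ N : ℕ, 0 < 1 - 1 / ((N:ℝ) + 2) := fun N => by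
    rw [sub_pos, div_lt_one (by positivity)]; linarith [Nat.cast_nonneg (α := ℝ) N]
  have hr1 : ∀ N : ℕ, 1 - 1 / ((N:ℝ) + 2) < 1 := fun N => by
    have : 0 < 1 / ((N:ℝ) + 2) := by positivity
    linarith
  have H := fun N : ℕ => hcon (δ / (N + 1)) (by have := hN1 N; positivity) (1 / (N + 1)) (by have := hN1 N; positivity)
    (1 - 1 / (N + 2)) (hr N) (hr1 N)
  choose τ hτ Hτ using H
  set U : Ultrafilter ℕ := hyperfilter ℕ
  have hU : (U : Filter ℕ) ≤ atTop := Nat.hyperfilter_le_atTop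
  have hle : ∀ N : ℕ, δ / (N + 1) ≤ δ := fun N => div_le_self hδp.le (by linarith [Nat.cast_nonneg (α := ℝ) N])
  have t1 : Tendsto (fun N : ℕ => 1 / ((N:ℝ) + 1)) U (𝓝 0) := tendsto_one_div_add_atTop_nhds_zero_nat.mono_left hU
  have hu1 : ∀ u : ℕ → Fin n → ℝ, (∀ (N : ℕ) i, u N i ∈ Icc (1 - 1 / ((N:ℝ) + 2)) 1) → Tendsto u U (𝓝 fun _ => 1) := by
    intro u hu
    rw [tendsto_pi_nhds]
    intro i
    have t2 : Tendsto (fun N : ℕ => 1 - 1 / ((N:ℝ) + 1)) U (𝓝 1) := by simpa using t1.const_sub 1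
    refine tendsto_of_tendsto_of_tendsto_of_le_of_le t2 tendsto_const_nhds (fun N => ?_) (fun N => (hu N i).2)
    refine le_trans ?_ (hu N i).1
    have : 1 / ((N:ℝ) + 2) ≤ 1 / ((N:ℝ) + 1) := one_div_le_one_div_of_le (hN1 N) (by linarith)
    linarith
  have hu2 : ∀ (N : ℕ) (x : ℝ), x ∈ Icc (1 - 1 / ((N:ℝ) + 2)) 1 → |x| ≤ 1 := fun N x hx =>
    abs_le.2 ⟨by linarith [hx.1, hr N], hx.2⟩
  refine key_limit hoS hk0 hR hA1 hA hAne hc2 hδp hδ1 hδR (U := U) (τ := τ)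
    (fun N i => ⟨abs_pos.1 (hτ N i).1, (hτ N i).2.le.trans (hle N)⟩) (fun i => ?_) ?_
  · have t2 : Tendsto (fun N : ℕ => δ / ((N:ℝ) + 1)) U (𝓝 0) := by
      have := t1.const_mul δ
      simpa [div_eq_mul_inv] using this
    exact squeeze_zero (fun N => abs_nonneg _) (fun N => (hτ N i).2.le) t2
  · intro v hv k hk hkk
    have H2 := fun N => Hτ N v hv k hk hkk
    choose u₁ hu₁ hd₁ using fun N => (H2 N).1
    choose u₂ hu₂ hd₂ using fun N => (H2 N).2
    exact ⟨u₁, u₂, fun N i => hu2 N _ (hu₁ N i), fun N i => hu2 N _ (hu₂ N i), hu1 _ hu₁, hu1 _ hu₂,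
      fun N => 1 / (N + 1), t1, fun N => ⟨(hd₁ N).le, (hd₂ N).le⟩⟩

end

section

/-- The dyadic-type box attached to `τ`. -/
def RB (r : ℝ) (τ : Fin n → ℝ) : Set (Fin n → ℝ) := {t | ∀ i, t i / τ i ∈ Icc r 1}

lemma RB_eq_pi (r : ℝ) (τ : Fin n → ℝ) : RB r τ = Set.pi univ (fun i => (fun x => x * (τ i)⁻¹) ⁻¹' Icc r 1) := by
  ext t; simp only [RB, Set.mem_ofPred_eq, Set.mem_pi, Set.mem_univ, true_imp_iff, Set.mem_preimage, div_eq_mul_inv]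

lemma isClosed_RB (r : ℝ) (τ : Fin n → ℝ) : IsClosed (RB r τ) := by
  rw [RB_eq_pi]
  exact isClosed_set_pi fun i _ => isClosed_Icc.preimage (by fun_prop)

lemma isCompact_RB (r : ℝ) {τ : Fin n → ℝ} (hτ : ∀ i, τ i ≠ 0) : IsCompact (RB r τ) := by
  rw [RB_eq_pi]
  refine isCompact_univ_pi fun i => ?_
  exact (Homeomorph.mulRight₀ (τ i)⁻¹ (inv_ne_zero (hτ i))).isCompact_preimage.2 isCompact_Icc

lemma volume_box3 {τ : Fin n → ℝ} (hτ : ∀ i, τ i ≠ 0) :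
    volume {t : Fin n → ℝ | ∀ i, t i / τ i ∈ Icc (-1:ℝ) 2} = ENNReal.ofReal (3 ^ n * ∏ i, |τ i|) := by
  have : {t : Fin n → ℝ | ∀ i, t i / τ i ∈ Icc (-1:ℝ) 2} = Set.pi univ (fun i => (fun x => x * (τ i)⁻¹) ⁻¹' Icc (-1) 2) := by
    ext t; simp only [Set.mem_ofPred_eq, Set.mem_pi, Set.mem_univ, true_imp_iff, Set.mem_preimage, div_eq_mul_inv]
  rw [this, volume_pi_pi]
  simp only [Real.volume_preimage_mul_right (inv_ne_zero (hτ _)), inv_inv, Real.volume_Icc]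
  have : ∀ i, ENNReal.ofReal |τ i| * ENNReal.ofReal (2 - -1) = ENNReal.ofReal (|τ i| * 3) := by
    intro i; rw [← ENNReal.ofReal_mul (abs_nonneg _)]; norm_num
  simp only [this]
  rw [← ENNReal.ofReal_prod_of_nonneg (fun i _ => by positivity), Finset.prod_mul_distrib]
  simp [mul_comm]

lemma avg {r : ℝ} (hr : 0 < r) {τ v : Fin n → ℝ} (hτ : ∀ i, τ i ≠ 0) (hv : ∀ i, |v i| ≤ 1)
    {F : (Fin n → ℝ) → ℂ} (hF : ContinuousOn F (RB r τ)) {E : ℝ} (hE : 0 ≤ E)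
    (h : ∀ (t : Fin n → ℝ) (a b : ℝ), 0 ≤ a → a ≤ b → b ≤ 1 → (∀ s ∈ Icc a b, (fun i => t i + s * (τ i * v i)) ∈ RB r τ) →
      ‖∫ s in a..b, F (fun i => t i + s * (τ i * v i))‖ ≤ E) :
    ‖∫ t in RB r τ, F t‖ ≤ E * (3 ^ n * ∏ i, |τ i|) := by
  classical
  have hcl := isClosed_RB r τ
  have hco := isCompact_RB r hτ
  set G := (RB r τ).indicator F with hG
  have hGm : Measurable G := by
    rw [hG, ← Set.piecewise_eq_indicator]
    exact hF.measurable_piecewise continuousOn_const hcl.measurableSet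
  have hGi : Integrable G := by
    rw [hG, integrable_indicator_iff hcl.measurableSet]
    exact hF.integrableOn_compact hco
  set sh : (Fin n → ℝ) × ℝ → (Fin n → ℝ) := fun z i => z.1 i + z.2 * (τ i * v i) with hsh
  have hshm : Measurable sh := by
    refine Continuous.measurable ?_
    rw [hsh]; fun_prop
  have hshs : ∀ s, ∫ t, G (sh (t, s)) = ∫ t, G t := by
    intro s
    exact integral_add_right_eq_self G (fun i => s * (τ i * v i))
  set η : Measure ℝ := volume.restrict (Icc 0 1) with hη
  have hηu : η.real univ = 1 := by simp [hη]
  have hintegr : Integrable (fun z : (Fin n → ℝ) × ℝ => G (sh z)) (volume.prod η) := by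
    refine (integrable_prod_iff' (hGm.comp hshm).aestronglyMeasurable).2 ⟨?_, ?_⟩
    · refine Eventually.of_forall fun s => ?_
      exact hGi.comp_add_right (fun i => s * (τ i * v i))
    · have : ∀ s, ∫ t, ‖G (sh (t, s))‖ = ∫ t, ‖G t‖ := fun s =>
        integral_add_right_eq_self (fun t => ‖G t‖) (fun i => s * (τ i * v i))
      exact (integrable_const (∫ t, ‖G t‖)).congr (Eventually.of_forall fun s => (this s).symm)
  have e1 : ∫ t in RB r τ, F t = ∫ t, ∫ s, G (sh (t, s)) ∂η := by
    rw [← integral_prod _ hintegr, integral_prod_symm _ hintegr]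
    simp only [hshs, integral_const, hηu, one_smul]
    rw [hG, integral_indicator hcl.measurableSet]
  rw [e1]
  set B3 := {t : Fin n → ℝ | ∀ i, t i / τ i ∈ Icc (-1:ℝ) 2} with hB3
  have hvol := volume_box3 hτ
  have hinner : ∀ t, ‖∫ s, G (sh (t, s)) ∂η‖ ≤ E := by
    intro t
    set J := {s : ℝ | s ∈ Icc (0:ℝ) 1 ∧ sh (t, s) ∈ RB r τ} with hJ
    have hshc : Continuous fun s => sh (t, s) := by rw [hsh]; fun_prop
    have hJc : IsCompact J := isCompact_Icc.inter_right (hcl.preimage hshc)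
    have hJm : MeasurableSet J := hJc.isClosed.measurableSet
    have e2 : ∫ s, G (sh (t, s)) ∂η = ∫ s in J, F (sh (t, s)) := by
      rw [hη, ← integral_indicator measurableSet_Icc, ← integral_indicator hJm]
      congr 1
      ext s
      by_cases h1 : s ∈ Icc (0:ℝ) 1
      · by_cases h2 : sh (t, s) ∈ RB r τ
        · rw [Set.indicator_of_mem h1, hG, Set.indicator_of_mem h2, Set.indicator_of_mem (show s ∈ J from ⟨h1, h2⟩)]
        · rw [Set.indicator_of_mem h1, hG, Set.indicator_of_notMem h2, Set.indicator_of_notMem (show s ∉ J from fun h => h2 h.2)]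
      · rw [Set.indicator_of_notMem h1, Set.indicator_of_notMem (show s ∉ J from fun h => h1 h.1)]
    rw [e2]
    rcases J.eq_empty_or_nonempty with h0 | hne
    · rw [h0]; simpa using hE
    have hJconv : Convex ℝ J := by
      refine (convex_Icc 0 1).inter ?_
      intro x hx y hy p q hp hq hpq i
      have h1 := hx i
      have h2 := hy i
      have e : sh (t, p • x + q • y) i / τ i = p • (sh (t, x) i / τ i) + q • (sh (t, y) i / τ i) := by
        have : q = 1 - p := by linarith
        subst this
        simp only [hsh, smul_eq_mul]; ring
      rw [e]
      exact convex_Icc r 1 h1 h2 hp hq hpq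
    have hJe := eq_Icc_of_connected_compact ⟨hne, hJconv.isPreconnected⟩ hJc
    have hab : sInf J ≤ sSup J := by
      obtain ⟨x, hx⟩ := hne
      rw [hJe] at hx; exact hx.1.trans hx.2
    have hA : sInf J ∈ J := hJc.sInf_mem hne
    have hB : sSup J ∈ J := hJc.sSup_mem hne
    have h3 := h t (sInf J) (sSup J) hA.1.1 hab hB.1.2 (fun s hs => by
      rw [← hJe] at hs; exact hs.2)
    rw [intervalIntegral.integral_of_le hab, ← integral_Icc_eq_integral_Ioc, ← hJe] at h3
    exact h3
  have hzero : ∀ t, t ∉ B3 → ∫ s, G (sh (t, s)) ∂η = 0 := by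
    intro t ht
    rw [hη]
    refine setIntegral_eq_zero_of_forall_eq_zero fun s hs => ?_
    rw [hG]
    refine Set.indicator_of_notMem (fun hmem => ht fun i => ?_) _
    have h1 := hmem i
    have e : sh (t, s) i / τ i = t i / τ i + s * v i := by
      simp only [hsh]; have := hτ i; field_simp
    rw [e] at h1
    have h2 : |s * v i| ≤ 1 := by
      rw [abs_mul, abs_of_nonneg hs.1]
      exact mul_le_one₀ hs.2 (abs_nonneg _) (hv i)
    have h3 := abs_le.1 h2
    exact ⟨by linarith [h1.1], by linarith [h1.2]⟩
  have e3 : ∫ t, ∫ s, G (sh (t, s)) ∂η = ∫ t in B3, ∫ s, G (sh (t, s)) ∂η :=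
    (setIntegral_eq_integral_of_forall_compl_eq_zero hzero).symm
  rw [e3]
  have h4 := norm_setIntegral_le_of_norm_le_const (μ := volume) (s := B3) (C := E) (f := fun t => ∫ s, G (sh (t, s)) ∂η)
    (by rw [hvol]; exact ENNReal.ofReal_lt_top) (fun t _ => hinner t)
  refine h4.trans_eq ?_
  rw [measureReal_def, hvol, ENNReal.toReal_ofReal (by positivity)]

lemma RB_ne {r : ℝ} (hr : 0 < r) {τ t : Fin n → ℝ} (ht : t ∈ RB r τ) (i : Fin n) : t i ≠ 0 := by
  intro h
  have := (ht i).1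
  rw [h, zero_div] at this
  linarith

lemma RB_abs {r : ℝ} (hr : 0 < r) {τ t : Fin n → ℝ} (hτ : ∀ i, τ i ≠ 0) (ht : t ∈ RB r τ) (i : Fin n) :
    r * |τ i| ≤ |t i| ∧ |t i| ≤ |τ i| := by
  have h1 := ht i
  have h2 : |t i| = (t i / τ i) * |τ i| := by
    have h0 : 0 ≤ t i / τ i := hr.le.trans h1.1
    rw [← abs_of_nonneg h0, ← abs_mul, div_mul_cancel₀ _ (hτ i)]
  have h3 := abs_nonneg (τ i)
  rw [h2]
  exact ⟨mul_le_mul_of_nonneg_right h1.1 h3, mul_le_of_le_one_left h3 h1.2⟩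

lemma kw_RB (grp : Fin n → Fin m) (hgrp : Function.Surjective grp) {a : Fin m → ℝ} (ha : ∀ k, 0 ≤ a k) {r : ℝ}
    (hr : 0 < r) {τ t : Fin n → ℝ} (hτ : ∀ i, τ i ≠ 0) (ht : t ∈ RB r τ) :
    kernelWeight grp a t ≤ r ^ (-∑ k, a k) * kernelWeight grp a τ := by
  unfold kernelWeight
  rw [← Finset.sum_neg_distrib, Real.rpow_sum_of_pos hr, ← Finset.prod_mul_distrib]
  refine Finset.prod_le_prod (fun k _ => Real.rpow_nonneg (Real.sqrt_nonneg _) _) fun k _ => ?_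
  have hp : 0 < grpNorm grp k τ := grpNorm_pos grp hgrp k hτ
  rw [← Real.mul_rpow hr.le hp.le]
  refine Real.rpow_le_rpow_of_nonpos (mul_pos hr hp) ?_ (by linarith [ha k])
  unfold grpNorm
  rw [← Real.sqrt_sq hr.le, ← Real.sqrt_mul (sq_nonneg r), Finset.mul_sum]
  refine Real.sqrt_le_sqrt (Finset.sum_le_sum fun i _ => ?_)
  have h1 := (RB_abs hr hτ ht i).1
  rw [← mul_pow, ← sq_abs, ← sq_abs (t i), abs_mul, abs_of_pos hr]
  exact pow_le_pow_left₀ (by positivity) h1 2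

/-- Behaviour of the kernel along a segment. -/
lemma K_seg (grp : Fin n → Fin m) (hgrp : Function.Surjective grp) {a : Fin m → ℝ} (ha : ∀ k, 0 ≤ a k) {r : ℝ}
    (hr : 0 < r) {K : (Fin n → ℝ) → ℝ} (hK : ContDiffOn ℝ 1 K {t | ∀ i, t i ≠ 0}) {C : ℝ} (hC : 0 ≤ C)
    (hKC : ∀ t : Fin n → ℝ, (∀ i, t i ≠ 0) → |K t| ≤ C * kernelWeight grp a t ∧
      ∀ i : Fin n, |fderiv ℝ K t (Pi.single i 1)| ≤ C / |t i| * kernelWeight grp a t)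
    {τ v t : Fin n → ℝ} (hτ : ∀ i, τ i ≠ 0) (hv : ∀ i, |v i| ≤ 1) {x y : ℝ}
    (hseg : ∀ s ∈ Icc x y, (fun i => t i + s * (τ i * v i)) ∈ RB r τ) :
    ∃ q' : ℝ → ℝ, ContinuousOn q' (Icc x y) ∧ ∀ s ∈ Icc x y,
      HasDerivAt (fun s => K (fun i => t i + s * (τ i * v i))) (q' s) s ∧
      |K (fun i => t i + s * (τ i * v i))| ≤ (1 + n / r) * (C * r ^ (-∑ k, a k) * kernelWeight grp a τ) ∧
      |q' s| ≤ (1 + n / r) * (C * r ^ (-∑ k, a k) * kernelWeight grp a τ) := by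
  have hop : IsOpen {t : Fin n → ℝ | ∀ i, t i ≠ 0} := by
    have : {t : Fin n → ℝ | ∀ i, t i ≠ 0} = ⋂ i, {t | t i ≠ 0} := by ext t; simp
    rw [this]
    exact isOpen_iInter_of_finite fun i => isOpen_ne_fun (continuous_apply i) continuous_const
  set γ : ℝ → Fin n → ℝ := fun s i => t i + s * (τ i * v i) with hγ
  set w : Fin n → ℝ := fun i => τ i * v i with hw
  have hγc : Continuous γ := by rw [hγ]; fun_prop
  have hγd : ∀ s, HasDerivAt γ w s := by
    intro s
    rw [hasDerivAt_pi]
    intro i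
    simpa [hγ, hw] using ((hasDerivAt_id s).mul_const (τ i * v i)).const_add (t i)
  have hmem : ∀ s ∈ Icc x y, γ s ∈ {t : Fin n → ℝ | ∀ i, t i ≠ 0} := fun s hs i => RB_ne hr (hseg s hs) i
  have hkw0 : 0 ≤ kernelWeight grp a τ := kernelWeight_nonneg grp a τ
  set X := C * r ^ (-∑ k, a k) * kernelWeight grp a τ with hX
  have hX0 : 0 ≤ X := by positivity
  have hCX : ∀ s ∈ Icc x y, C * kernelWeight grp a (γ s) ≤ X := by
    intro s hs
    rw [hX, mul_assoc]
    exact mul_le_mul_of_nonneg_left (kw_RB grp hgrp ha hr hτ (hseg s hs)) hC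
  refine ⟨fun s => fderiv ℝ K (γ s) w, ?_, fun s hs => ⟨?_, ?_, ?_⟩⟩
  · have h1 : ContinuousOn (fderiv ℝ K) {t | ∀ i, t i ≠ 0} := hK.continuousOn_fderiv_of_isOpen hop le_rfl
    exact (h1.comp hγc.continuousOn hmem).clm_apply continuousOn_const
  · have h1 : DifferentiableAt ℝ K (γ s) := (hK.differentiableOn one_ne_zero).differentiableAt (hop.mem_nhds (hmem s hs))
    exact h1.hasFDerivAt.comp_hasDerivAt s (hγd s)
  · have h1 := ((hKC _ (hmem s hs)).1).trans (hCX s hs)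
    refine h1.trans (le_mul_of_one_le_left hX0 ?_)
    have : 0 ≤ (n:ℝ) / r := by positivity
    linarith
  · have e : w = ∑ i, w i • (Pi.single i (1:ℝ) : Fin n → ℝ) := by
      ext j
      simp [Finset.sum_apply, Pi.single_apply]
    have h1 : |fderiv ℝ K (γ s) w| ≤ ∑ i : Fin n, X / r := by
      rw [e, map_sum]
      refine (Finset.abs_sum_le_sum_abs _ _).trans (Finset.sum_le_sum fun i _ => ?_)
      rw [map_smul, smul_eq_mul, abs_mul]
      have h2 := (hKC _ (hmem s hs)).2 i
      have h3 := (RB_abs hr hτ (hseg s hs) i).1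
      have h4 : |w i| ≤ |τ i| := by
        rw [hw]; simp only [abs_mul]; exact mul_le_of_le_one_right (abs_nonneg _) (hv i)
      have h5 : 0 < |τ i| := abs_pos.2 (hτ i)
      have h6 : 0 < |γ s i| := abs_pos.2 (hmem s hs i)
      calc |w i| * |fderiv ℝ K (γ s) (Pi.single i 1)| ≤ |τ i| * (C / |γ s i| * kernelWeight grp a (γ s)) := by gcongr
        _ = (|τ i| / |γ s i|) * (C * kernelWeight grp a (γ s)) := by ring
        _ ≤ (1 / r) * X := by
          refine mul_le_mul ?_ (hCX s hs) (mul_nonneg hC (kernelWeight_nonneg grp a _)) (by positivity)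
          rw [div_le_div_iff₀ h6 hr]; linarith
        _ = X / r := by ring
    refine h1.trans ?_
    rw [Finset.sum_const, Finset.card_univ, Fintype.card_fin, nsmul_eq_mul]
    have : (1 + n / r) * X = X + n * (X / r) := by ring
    rw [this]; linarith

lemma S_cont {S : (Fin n → ℝ) → ℝ} {c : (Fin n → ℕ) → ℝ} {R : ℝ} (hR : GoodR S c R) :
    ContinuousOn S {t | ∀ i, |t i| ≤ R} := by
  have h1 : ContinuousOn (fun t => ∑' α, c α * monomial α t) {t : Fin n → ℝ | ∀ i, |t i| ≤ R} := by
    refine continuousOn_tsum (fun α => ?_) hR.2.1 (fun α t ht => ?_)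
    · unfold monomial; fun_prop
    · rw [Real.norm_eq_abs, abs_mul]
      exact mul_le_mul_of_nonneg_left (monomial_abs_le α ht) (abs_nonneg _)
  exact h1.congr fun t ht => (hR.2.2 t ht).tsum_eq.symm

/-- The phase. -/
def ph (S : (Fin n → ℝ) → ℝ) (lam : Fin n → ℝ) (mu : ℝ) (t : Fin n → ℝ) : ℝ := ∑ i, lam i * t i + mu * S t

lemma RB_small {r R δ : ℝ} (hr : 0 < r) {τ t : Fin n → ℝ} (hτ : ∀ i, 0 < |τ i| ∧ |τ i| < δ) (ht : t ∈ RB r τ) (i : Fin n) :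
    |t i| < δ := (RB_abs hr (fun i => abs_pos.1 (hτ i).1) ht i).2.trans_lt (hτ i).2

lemma decay_gen (grp : Fin n → Fin m) (hgrp : Function.Surjective grp) {a : Fin m → ℝ} (ha : ∀ k, 0 ≤ a k) {r : ℝ}
    (hr : 0 < r) {K : (Fin n → ℝ) → ℝ} (hK : ContDiffOn ℝ 1 K {t | ∀ i, t i ≠ 0}) {C : ℝ} (hC : 0 ≤ C)
    (hKC : ∀ t : Fin n → ℝ, (∀ i, t i ≠ 0) → |K t| ≤ C * kernelWeight grp a t ∧
      ∀ i : Fin n, |fderiv ℝ K t (Pi.single i 1)| ≤ C / |t i| * kernelWeight grp a t)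
    {S : (Fin n → ℝ) → ℝ} {c : (Fin n → ℕ) → ℝ} {R : ℝ} (hR : GoodR S c R)
    {τ v : Fin n → ℝ} (hτ : ∀ i, 0 < |τ i| ∧ |τ i| < R) (hv : ∀ i, |v i| ≤ 1) (lam : Fin n → ℝ) (mu : ℝ)
    {E : ℝ} (hE : 0 ≤ E)
    (h : ∀ (t : Fin n → ℝ) (x y : ℝ), 0 ≤ x → x ≤ y → y ≤ 1 → (∀ s ∈ Icc x y, (fun i => t i + s * (τ i * v i)) ∈ RB r τ) →
      ‖∫ s in x..y, Complex.exp (Complex.I * (ph S lam mu (fun i => t i + s * (τ i * v i)) : ℝ))‖ ≤ E) :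
    ‖∫ t in RB r τ, Complex.exp (Complex.I * (ph S lam mu t : ℝ)) * (K t : ℂ)‖ ≤
      2 * E * ((1 + n / r) * (C * r ^ (-∑ k, a k) * kernelWeight grp a τ)) * (3 ^ n * ∏ i, |τ i|) := by
  have hτ0 : ∀ i, τ i ≠ 0 := fun i => abs_pos.1 (hτ i).1
  have hSc : ContinuousOn S (RB r τ) := (S_cont hR).mono fun t ht i => (RB_small (R := R) hr hτ ht i).le
  have hph : ContinuousOn (ph S lam mu) (RB r τ) := by
    unfold ph
    refine ContinuousOn.add (by fun_prop) (continuousOn_const.mul hSc)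
  have hkw0 : 0 ≤ kernelWeight grp a τ := kernelWeight_nonneg grp a τ
  have hKc : ContinuousOn K (RB r τ) := hK.continuousOn.mono fun t ht i => RB_ne hr ht i
  refine avg hr hτ0 hv (F := fun t => Complex.exp (Complex.I * (ph S lam mu t : ℝ)) * (K t : ℂ)) ?_ (by positivity) ?_
  · refine ContinuousOn.mul ?_ (Complex.continuous_ofReal.comp_continuousOn hKc)
    exact Complex.continuous_exp.comp_continuousOn
      (continuousOn_const.mul (Complex.continuous_ofReal.comp_continuousOn hph))
  · intro t x y hx hxy hy hseg
    obtain ⟨q', hq'c, hq'⟩ := K_seg grp hgrp ha hr hK hC hKC hτ0 hv hseg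
    have hγc : Continuous fun (s : ℝ) (i : Fin n) => t i + s * (τ i * v i) := by fun_prop
    refine vdc_amp (p := fun s => ph S lam mu (fun i => t i + s * (τ i * v i)))
      (q := fun s => K (fun i => t i + s * (τ i * v i))) (q' := q') hxy (by linarith) ?_ hE ?_
      (fun s hs => (hq' s hs).1) hq'c (fun s hs => (hq' s hs).2.1) (fun s hs => (hq' s hs).2.2)
    · exact hph.comp hγc.continuousOn hseg
    · intro z hz
      exact h t x z hx hz.1 (hz.2.trans hy) fun s hs => hseg s ⟨hs.1, hs.2.trans hz.2⟩

/-- The phase derivatives along a segment. -/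
def phd (S : (Fin n → ℝ) → ℝ) (c : (Fin n → ℕ) → ℝ) (lam : Fin n → ℝ) (mu : ℝ) (t w : Fin n → ℝ) (k : ℕ) (s : ℝ) : ℝ :=
  if k = 0 then ∑ i, lam i * (t i + s * w i) + mu * dS c 0 (fun i => t i + s * w i) w
  else if k = 1 then ∑ i, lam i * w i + mu * dS c 1 (fun i => t i + s * w i) w
  else mu * dS c k (fun i => t i + s * w i) w

lemma phd_deriv {S : (Fin n → ℝ) → ℝ} {c : (Fin n → ℕ) → ℝ} {R : ℝ} (hR : GoodR S c R) (lam : Fin n → ℝ) (mu : ℝ)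
    {t w : Fin n → ℝ} (k : ℕ) {s : ℝ} (h : ∀ i, |t i + s * w i| + |w i| < R) :
    HasDerivAt (phd S c lam mu t w k) (phd S c lam mu t w (k+1) s) s := by
  have h1 := (hasDerivAt_dS hR k h).const_mul mu
  rcases Nat.lt_or_ge k 2 with hk | hk
  · interval_cases k
    · have h2 : HasDerivAt (fun s : ℝ => ∑ i, lam i * (t i + s * w i)) (∑ i, lam i * w i) s := by
        refine HasDerivAt.fun_sum fun i _ => ?_
        simpa using (((hasDerivAt_id s).mul_const (w i)).const_add (t i)).const_mul (lam i)
      exact h2.add h1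
    · exact h1.const_add _
  · have e : phd S c lam mu t w k = fun s => mu * dS c k (fun i => t i + s * w i) w := by
      ext s; unfold phd; rw [if_neg (by omega), if_neg (by omega)]
    have e' : phd S c lam mu t w (k+1) s = mu * dS c (k+1) (fun i => t i + s * w i) w := by
      unfold phd; rw [if_neg (by omega), if_neg (by omega)]
    rw [e, e']
    exact h1

lemma phd_zero {S : (Fin n → ℝ) → ℝ} {c : (Fin n → ℕ) → ℝ} {R : ℝ} (hR : GoodR S c R) (lam : Fin n → ℝ) (mu : ℝ)
    {t w : Fin n → ℝ} {s : ℝ} (h : ∀ i, |t i + s * w i| ≤ R) :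
    phd S c lam mu t w 0 s = ph S lam mu (fun i => t i + s * w i) := by
  unfold phd ph; rw [if_pos rfl, dS_zero hR w h]

/-- exponent comparison -/
lemma exp_cmp {x δ' κ : ℝ} (hx : 0 < x) (h0 : 0 ≤ δ') (h1 : δ' ≤ κ) {y P : ℝ} (hP : 0 ≤ P) (hy1 : y ≤ P) (hy2 : y ≤ P * x ^ (-κ)) :
    y ≤ P * x ^ (-δ') := by
  rcases le_total 1 x with h | h
  · exact hy2.trans (mul_le_mul_of_nonneg_left (Real.rpow_le_rpow_of_exponent_le h (by linarith)) hP)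
  · refine hy1.trans (le_mul_of_one_le_right hP ?_)
    exact Real.one_le_rpow_of_pos_of_le_one_of_nonpos hx h (by linarith)

lemma mmin_pos (hn : 0 < n) {A : Finset (Fin n → ℕ)} (hA : A.Nonempty) {τ : Fin n → ℝ} (hτ : ∀ i, τ i ≠ 0) : 0 < mmin (sig A) τ := by
  haveI : Nonempty (Fin n) := ⟨⟨0, hn⟩⟩
  refine lt_min ?_ (sig_pos hA hτ)
  obtain ⟨i, hi⟩ := exists_eq_ciInf_of_finite (f := fun i => |τ i|)
  rw [← hi]; exact abs_pos.2 (hτ i)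

lemma mmin_le_abs (σ : (Fin n → ℝ) → ℝ) (τ : Fin n → ℝ) (i : Fin n) : mmin σ τ ≤ |τ i| :=
  (min_le_left _ _).trans (ciInf_le (Set.finite_range _).bddBelow i)

lemma mmin_le_sig (σ : (Fin n → ℝ) → ℝ) (τ : Fin n → ℝ) : mmin σ τ ≤ σ τ := min_le_right _ _

set_option maxHeartbeats 1600000 in
/-- Decay of the localized pieces. -/
lemma decay (hn : 0 < n) (grp : Fin n → Fin m) (hgrp : Function.Surjective grp) {a : Fin m → ℝ} (ha : ∀ k, 0 ≤ a k)
    {c : (Fin n → ℕ) → ℝ} {oS k0 : ℕ} (hoS : newtonOrder c = oS) (hk0 : k0 = max oS 2)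
    {S : (Fin n → ℝ) → ℝ} {R : ℝ} (hR : GoodR S c R) {A : Finset (Fin n → ℕ)}
    (hA1 : ∀ α ∈ A, c α ≠ 0) (hA : ∀ α, c α ≠ 0 → ∃ b ∈ A, b ≤ α) (hAne : A.Nonempty)
    (hc2 : ∀ α, c α ≠ 0 → 2 ≤ ∑ i, α i) :
    ∃ δ > 0, δ ≤ 1 ∧ δ ≤ R ∧ ∃ r : ℝ, 0 < r ∧ r < 1 ∧ ∃ C1 > 0, ∀ (K : (Fin n → ℝ) → ℝ) (C : ℝ),
      ContDiffOn ℝ 1 K {t | ∀ i, t i ≠ 0} → 0 ≤ C →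
      (∀ t : Fin n → ℝ, (∀ i, t i ≠ 0) → |K t| ≤ C * kernelWeight grp a t ∧
        ∀ i : Fin n, |fderiv ℝ K t (Pi.single i 1)| ≤ C / |t i| * kernelWeight grp a t) →
      ∀ τ : Fin n → ℝ, (∀ i, 0 < |τ i| ∧ |τ i| < δ) → ∀ (lam : Fin n → ℝ) (mu : ℝ),
        (‖∫ t in RB r τ, Complex.exp (Complex.I * (ph S lam mu t : ℝ)) * (K t : ℂ)‖ ≤
          C1 * (C * kernelWeight grp a τ * ∏ i, |τ i|)) ∧
        ∀ Λ > 0, (|mu| = Λ ∨ ∃ i, |lam i| = Λ ∧ |mu| ≤ Λ) → ∀ δ' : ℝ, 0 ≤ δ' → δ' ≤ 1 / k0 →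
          ‖∫ t in RB r τ, Complex.exp (Complex.I * (ph S lam mu t : ℝ)) * (K t : ℂ)‖ ≤
          C1 * (C * kernelWeight grp a τ * ∏ i, |τ i|) * (Λ * mmin (sig A) τ) ^ (-δ') := by
  obtain ⟨δ1, hδ1, c0, hc0, r, hr, hr1, hkey⟩ := key hoS hk0 hR hA1 hA hAne hc2
  obtain ⟨r1, hr1p, B, hB, hdir⟩ := dS_dir hR hc2
  choose! Ck hCk0 hCk using fun k (hk : 2 ≤ k) => vdc k hk
  have hRp := hR.1
  set CS := ∑ k ∈ Finset.Icc 2 k0, Ck k with hCS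
  have hCS0 : 0 ≤ CS := Finset.sum_nonneg fun k hk => hCk0 k (Finset.mem_Icc.1 hk).1
  have hCSk : ∀ k, 2 ≤ k → k ≤ k0 → Ck k ≤ CS := fun k h2 hk =>
    Finset.single_le_sum (f := Ck) (fun k hk => hCk0 k (Finset.mem_Icc.1 hk).1) (Finset.mem_Icc.2 ⟨h2, hk⟩)
  set E1 := 1 + (4 + 4 * B) + CS * (1 + c0⁻¹) with hE1
  have hE10 : 0 < E1 := by positivity
  set Q := (1 + n / r) * r ^ (-∑ k, a k) * 3 ^ n with hQ
  have hQ0 : 0 < Q := by positivity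
  set δ := min (min δ1 r1) (min 1 (R / 2)) with hδ
  have hδp : 0 < δ := lt_min (lt_min hδ1 hr1p) (lt_min one_pos (by linarith))
  have hδ_1 : δ ≤ 1 := (min_le_right _ _).trans (min_le_left _ _)
  have hδ_R : δ ≤ R / 2 := (min_le_right _ _).trans (min_le_right _ _)
  have hδ_δ1 : δ ≤ δ1 := (min_le_left _ _).trans (min_le_left _ _)
  have hδ_r1 : δ ≤ r1 := (min_le_left _ _).trans (min_le_right _ _)
  refine ⟨δ, hδp, hδ_1, by linarith, r, hr, hr1, 2 * E1 * Q, by positivity, ?_⟩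
  intro K C hK hC hKC τ hτ lam mu
  have hτ0 : ∀ i, τ i ≠ 0 := fun i => abs_pos.1 (hτ i).1
  have hτR : ∀ i, 0 < |τ i| ∧ |τ i| < R := fun i => ⟨(hτ i).1, by linarith [(hτ i).2]⟩
  have hkw0 : 0 ≤ kernelWeight grp a τ := kernelWeight_nonneg grp a τ
  set X := C * kernelWeight grp a τ * ∏ i, |τ i| with hX
  have hX0 : 0 ≤ X := by positivity
  set I0 := ‖∫ t in RB r τ, Complex.exp (Complex.I * (ph S lam mu t : ℝ)) * (K t : ℂ)‖ with hI0
  have hgen : ∀ (v : Fin n → ℝ), (∀ i, |v i| ≤ 1) → ∀ E, 0 ≤ E →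
      (∀ (t : Fin n → ℝ) (x y : ℝ), 0 ≤ x → x ≤ y → y ≤ 1 → (∀ s ∈ Icc x y, (fun i => t i + s * (τ i * v i)) ∈ RB r τ) →
      ‖∫ s in x..y, Complex.exp (Complex.I * (ph S lam mu (fun i => t i + s * (τ i * v i)) : ℝ))‖ ≤ E) →
      I0 ≤ 2 * E * Q * X := by
    intro v hv E hE h
    refine (decay_gen grp hgrp ha hr hK hC hKC hR hτR hv lam mu hE h).trans_eq ?_
    rw [hQ, hX]; ring
  have hτs : ∀ t ∈ RB r τ, ∀ i, |t i| < δ := fun t ht i => RB_small (R := R) hr hτ ht i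
  have htriv : I0 ≤ 2 * E1 * Q * X := by
    refine hgen 0 (fun i => by simp) E1 hE10.le fun t x y hx hxy hy hseg => ?_
    have h1 := intervalIntegral.norm_integral_le_of_norm_le_const (a := x) (b := y) (C := 1)
      (f := fun s => Complex.exp (Complex.I * (ph S lam mu (fun i => t i + s * (τ i * (0 : Fin n → ℝ) i)) : ℝ)))
      (fun s _ => by rw [mul_comm, Complex.norm_exp_ofReal_mul_I])
    refine h1.trans ?_
    rw [one_mul, abs_of_nonneg (by linarith)]
    have : 0 ≤ CS * (1 + c0⁻¹) := by positivity
    rw [hE1]; linarith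
  refine ⟨htriv, ?_⟩
  intro Λ hΛ hcase δ' hδ'0 hδ'
  have hmp := mmin_pos hn hAne hτ0
  have hk02 : 2 ≤ k0 := by rw [hk0]; exact le_max_right _ _
  have hderiv : ∀ (v : Fin n → ℝ), (∀ i, |v i| ≤ 1) → ∀ (t : Fin n → ℝ) (s : ℝ), (fun i => t i + s * (τ i * v i)) ∈ RB r τ →
      ∀ i, |t i + s * (τ i * v i)| + |τ i * v i| < R := by
    intro v hv t s hs i
    have h1 := hτs _ hs i
    have h2 : |τ i * v i| ≤ |τ i| := by rw [abs_mul]; exact mul_le_of_le_one_right (abs_nonneg _) (hv i)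
    linarith [(hτ i).2]
  rcases hcase with hmu | ⟨i, hi, hmu⟩
  · obtain ⟨v, hv, k, hk2, hkk, hd⟩ := hkey τ fun i => ⟨(hτ i).1, (hτ i).2.trans_le hδ_δ1⟩
    have hsp := sig_pos hAne hτ0
    have hx : 0 < Λ * sig A τ := by positivity
    have hmu0 : mu ≠ 0 := by intro h; rw [h, abs_zero] at hmu; linarith
    have hκ : (1:ℝ) / k0 ≤ 1 / k := one_div_le_one_div_of_le (by positivity) (by exact_mod_cast hkk)
    have hb : I0 ≤ 2 * E1 * Q * X * (Λ * sig A τ) ^ (-(1 / k : ℝ)) := by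
      have h1 : I0 ≤ 2 * (Ck k * (Λ * (c0 * sig A τ)) ^ (-(1:ℝ) / k)) * Q * X := by
        refine hgen v hv _ (mul_nonneg (hCk0 k hk2) (by positivity)) fun t x y hx hxy hy hseg => ?_
        have h2 := hCk k hk2 x y (phd S c lam mu t (fun i => τ i * v i)) (Λ * (c0 * sig A τ)) hxy (by positivity)
          (fun j s hs => phd_deriv hR lam mu j (hderiv v hv t s (hseg s hs))) ?_
        · refine le_trans (le_of_eq ?_) h2
          congr 1
          refine intervalIntegral.integral_congr fun s hs => ?_
          rw [uIcc_of_le hxy] at hs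
          rw [phd_zero hR lam mu fun i => by linarith [hderiv v hv t s (hseg s hs) i, abs_nonneg (τ i * v i)]]
        · have e : ∀ s, phd S c lam mu t (fun i => τ i * v i) k s = mu * dS c k (fun i => t i + s * (τ i * v i)) (fun i => τ i * v i) := by
            intro s; unfold phd; rw [if_neg (by omega), if_neg (by omega)]
          have hu : ∀ s ∈ Icc x y, (fun i => t i + s * (τ i * v i)) = fun i => τ i * ((t i + s * (τ i * v i)) / τ i) := by
            intro s hs; ext i; rw [mul_div_cancel₀ _ (hτ0 i)]
          have hcs : 0 < c0 * sig A τ := by positivity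
          have hd' : (∀ s ∈ Icc x y, c0 * sig A τ ≤ dS c k (fun i => t i + s * (τ i * v i)) (fun i => τ i * v i)) ∨
              (∀ s ∈ Icc x y, dS c k (fun i => t i + s * (τ i * v i)) (fun i => τ i * v i) ≤ - (c0 * sig A τ)) := by
            rcases hd with hd | hd
            · left; intro s hs; rw [hu s hs]; exact hd _ (fun i => hseg s hs i)
            · right; intro s hs; rw [hu s hs]; exact hd _ (fun i => hseg s hs i)
          simp only [e]
          rcases lt_or_gt_of_ne hmu0 with hneg | hpos
          · rw [abs_of_neg hneg] at hmu
            rcases hd' with hd' | hd'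
            · right; intro s hs; have := hd' s hs; have := mul_le_mul_of_nonpos_left this hneg.le; rw [← hmu]; linarith
            · left; intro s hs; have := hd' s hs; have := mul_le_mul_of_nonpos_left this hneg.le; rw [← hmu]; linarith
          · rw [abs_of_pos hpos] at hmu
            rcases hd' with hd' | hd'
            · left; intro s hs; have := hd' s hs; have := mul_le_mul_of_nonneg_left this hpos.le; rw [← hmu]; linarith
            · right; intro s hs; have := hd' s hs; have := mul_le_mul_of_nonneg_left this hpos.le; rw [← hmu]; linarith
      refine h1.trans ?_
      have e1 : Λ * (c0 * sig A τ) = c0 * (Λ * sig A τ) := by ring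
      have e2 : -(1:ℝ) / k = -(1 / k : ℝ) := by ring
      rw [e1, e2, Real.mul_rpow hc0.le hx.le]
      have h3 : c0 ^ (-(1 / k : ℝ)) ≤ 1 + c0⁻¹ := by
        have hk1 : (1:ℝ) / k ≤ 1 := by
          rw [div_le_one (by positivity)]; exact_mod_cast (by omega : 1 ≤ k)
        have hk0' : 0 ≤ (1:ℝ) / k := by positivity
        rcases le_total 1 c0 with h | h
        · have : c0 ^ (-(1 / k : ℝ)) ≤ 1 := Real.rpow_le_one_of_one_le_of_nonpos h (by linarith)
          have : 0 ≤ c0⁻¹ := by positivity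
          linarith
        · have : c0 ^ (-(1 / k : ℝ)) ≤ c0 ^ (-1 : ℝ) := Real.rpow_le_rpow_of_exponent_ge hc0 h (by linarith)
          rw [Real.rpow_neg_one] at this
          linarith
      have h4 : Ck k * c0 ^ (-(1 / k : ℝ)) ≤ E1 := by
        have h5 : Ck k * c0 ^ (-(1 / k : ℝ)) ≤ CS * (1 + c0⁻¹) :=
          mul_le_mul (hCSk k hk2 hkk) h3 (by positivity) hCS0
        rw [hE1]; linarith
      calc 2 * (Ck k * (c0 ^ (-(1 / k : ℝ)) * (Λ * sig A τ) ^ (-(1 / k : ℝ)))) * Q * X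
          = 2 * (Ck k * c0 ^ (-(1 / k : ℝ))) * Q * X * (Λ * sig A τ) ^ (-(1 / k : ℝ)) := by ring
        _ ≤ _ := by gcongr
    have h5 := exp_cmp hx hδ'0 (hδ'.trans hκ) (by positivity) htriv hb
    refine h5.trans (mul_le_mul_of_nonneg_left ?_ (by positivity))
    exact Real.rpow_le_rpow_of_nonpos (by positivity) (mul_le_mul_of_nonneg_left (mmin_le_sig _ _) hΛ.le) (by linarith)
  · have hti := (hτ i).1
    have hx : 0 < Λ * |τ i| := by positivity
    have hb : I0 ≤ 2 * E1 * Q * X * (Λ * |τ i|) ^ (-(1:ℝ)) := by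
      have h1 : I0 ≤ 2 * ((4 + 4 * B) * (Λ * |τ i|)⁻¹) * Q * X := by
        set v : Fin n → ℝ := Pi.single i 1 with hvdef
        have hv : ∀ j, |v j| ≤ 1 := by
          intro j; rw [hvdef, Pi.single_apply]; split_ifs <;> simp
        refine hgen v hv _ (by positivity) fun t x y hx0 hxy hy hseg => ?_
        have ew : (fun j => τ j * v j) = fun j => τ i * v j := by
          ext j; rw [hvdef]
          by_cases hj : j = i
          · subst hj; rfl
          · simp [Pi.single_apply, hj]
        have hD := fun s hs j => phd_deriv (lam := lam) (mu := mu) hR j (hderiv v hv t s (hseg s hs))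
        have hlow : ∀ s ∈ Icc x y, Λ * |τ i| / 2 ≤ |phd S c lam mu t (fun i => τ i * v i) 1 s| := by
          intro s hs
          unfold phd
          rw [if_neg one_ne_zero, if_pos rfl]
          have h2 : ∑ j, lam j * (τ j * v j) = lam i * τ i := by
            rw [hvdef]; simp [Pi.single_apply]
          rw [h2, ew, dS_homog, pow_one]
          have h3 := (hdir (fun j => t j + s * (τ i * v j)) i (fun j => by
            have := hτs _ (hseg s hs) j
            simp only [congrFun ew j] at this
            linarith)).1
          rw [← hvdef] at h3
          have h4 : lam i * τ i + mu * (τ i * dS c 1 (fun j => t j + s * (τ i * v j)) v) =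
              τ i * (lam i + mu * dS c 1 (fun j => t j + s * (τ i * v j)) v) := by ring
          rw [h4, abs_mul]
          have h5 : |mu * dS c 1 (fun j => t j + s * (τ i * v j)) v| ≤ Λ * (1 / 2) := by
            rw [abs_mul]; exact mul_le_mul hmu h3 (abs_nonneg _) hΛ.le
          have h6 : Λ / 2 ≤ |lam i + mu * dS c 1 (fun j => t j + s * (τ i * v j)) v| := by
            have := abs_sub_abs_le_abs_add (lam i) (mu * dS c 1 (fun j => t j + s * (τ i * v j)) v)
            rw [hi] at this; linarith
          calc Λ * |τ i| / 2 = |τ i| * (Λ / 2) := by ring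
            _ ≤ _ := mul_le_mul_of_nonneg_left h6 (abs_nonneg _)
        have hup : ∀ s ∈ Icc x y, |phd S c lam mu t (fun i => τ i * v i) 2 s| ≤ Λ * |τ i| ^ 2 * B := by
          intro s hs
          unfold phd
          rw [if_neg two_ne_zero, if_neg (by norm_num), ew, dS_homog]
          have h3 := (hdir (fun j => t j + s * (τ i * v j)) i (fun j => by
            have := hτs _ (hseg s hs) j
            simp only [congrFun ew j] at this
            linarith)).2
          rw [← hvdef] at h3
          rw [abs_mul, abs_mul, abs_pow]
          calc |mu| * (|τ i| ^ 2 * |dS c 2 (fun j => t j + s * (τ i * v j)) v|) ≤ Λ * (|τ i| ^ 2 * B) := by gcongr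
            _ = _ := by ring
        have hne : ∀ s ∈ Icc x y, phd S c lam mu t (fun i => τ i * v i) 1 s ≠ 0 := by
          intro s hs h0
          have := hlow s hs
          rw [h0, abs_zero] at this
          linarith
        have hc2' : ContinuousOn (phd S c lam mu t (fun i => τ i * v i) 2) (Icc x y) :=
          fun s hs => (hD s hs 2).continuousAt.continuousWithinAt
        have h2 := vdc_base hxy (fun s hs => hD s hs 0) (fun s hs => hD s hs 1) hc2' (fun s hs => hne s hs)
        have e3 : ∫ s in x..y, Complex.exp (Complex.I * (ph S lam mu (fun i => t i + s * (τ i * v i)) : ℝ)) =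
            ∫ s in x..y, Complex.exp (Complex.I * (phd S c lam mu t (fun i => τ i * v i) 0 s : ℝ)) := by
          refine intervalIntegral.integral_congr fun s hs => ?_
          rw [uIcc_of_le hxy] at hs
          rw [phd_zero hR lam mu fun i => by linarith [hderiv v hv t s (hseg s hs) i, abs_nonneg (τ i * v i)]]
        rw [e3]
        refine h2.trans ?_
        have hx' : 0 < Λ * |τ i| / 2 := by positivity
        have h3 : ∀ s ∈ Icc x y, 1 / |phd S c lam mu t (fun i => τ i * v i) 1 s| ≤ 2 * (Λ * |τ i|)⁻¹ := by
          intro s hs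
          refine (one_div_le_one_div_of_le hx' (hlow s hs)).trans_eq ?_
          field_simp
        have h4 : ∫ s in x..y, |phd S c lam mu t (fun i => τ i * v i) 2 s| / (phd S c lam mu t (fun i => τ i * v i) 1 s) ^ 2 ≤
            4 * B * (Λ * |τ i|)⁻¹ := by
          have h5 := intervalIntegral.norm_integral_le_of_norm_le_const (a := x) (b := y) (C := 4 * B * (Λ * |τ i|)⁻¹)
            (f := fun s => |phd S c lam mu t (fun i => τ i * v i) 2 s| / (phd S c lam mu t (fun i => τ i * v i) 1 s) ^ 2) ?_
          · refine (le_abs_self _).trans (h5.trans ?_)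
            refine mul_le_of_le_one_right (by positivity) ?_
            rw [abs_of_nonneg (by linarith)]; linarith
          · intro s hs
            rw [uIoc_of_le hxy] at hs
            have hs' : s ∈ Icc x y := ⟨hs.1.le, hs.2⟩
            rw [Real.norm_eq_abs, abs_div, abs_abs, abs_pow]
            have h6 := hlow s hs'
            calc |phd S c lam mu t (fun i => τ i * v i) 2 s| / |phd S c lam mu t (fun i => τ i * v i) 1 s| ^ 2
                ≤ (Λ * |τ i| ^ 2 * B) / (Λ * |τ i| / 2) ^ 2 := by
                  gcongr
                  exact hup s hs'
              _ = 4 * B * (Λ * |τ i|)⁻¹ * |τ i| := by field_simp; ring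
              _ ≤ 4 * B * (Λ * |τ i|)⁻¹ * 1 := by
                  gcongr
                  linarith [(hτ i).2]
              _ = _ := mul_one _
        have h5 := h3 x ⟨le_rfl, hxy⟩
        have h6 := h3 y ⟨hxy, le_rfl⟩
        calc _ ≤ 2 * (Λ * |τ i|)⁻¹ + 2 * (Λ * |τ i|)⁻¹ + 4 * B * (Λ * |τ i|)⁻¹ := by gcongr
          _ = _ := by ring
      refine h1.trans ?_
      rw [Real.rpow_neg_one]
      calc 2 * ((4 + 4 * B) * (Λ * |τ i|)⁻¹) * Q * X = 2 * (4 + 4 * B) * Q * X * (Λ * |τ i|)⁻¹ := by ring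
        _ ≤ 2 * E1 * Q * X * (Λ * |τ i|)⁻¹ := by
          gcongr
          have : 0 ≤ CS * (1 + c0⁻¹) := by positivity
          rw [hE1]; linarith
    have hk1 : (1:ℝ) / k0 ≤ 1 := by
      rw [div_le_one (by positivity)]; exact_mod_cast (by omega : 1 ≤ k0)
    have h5 := exp_cmp hx hδ'0 (hδ'.trans hk1) (by positivity) htriv hb
    refine h5.trans (mul_le_mul_of_nonneg_left ?_ (by positivity))
    exact Real.rpow_le_rpow_of_nonpos (by positivity) (mul_le_mul_of_nonneg_left (mmin_le_abs _ _ i) hΛ.le) (by linarith)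

end

section

lemma schwartz_ft {N : ℕ} (f : SchwartzMap (Fin N → ℝ) ℂ) :
    Integrable (fun ξ : Fin N → ℝ => (1 + nsq ξ) * ‖fourierTransform f ξ‖) := by
  set L : EuclideanSpace ℝ (Fin N) ≃L[ℝ] (Fin N → ℝ) := PiLp.continuousLinearEquiv 2 ℝ (fun _ : Fin N => ℝ) with hL
  set g : SchwartzMap (EuclideanSpace ℝ (Fin N)) ℂ := SchwartzMap.compCLMOfContinuousLinearEquiv ℝ L f with hg
  set G : SchwartzMap (EuclideanSpace ℝ (Fin N)) ℂ := FourierTransform.fourier g with hG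
  have hmp := PiLp.volume_preserving_toLp (Fin N)
  have hme : MeasurableEmbedding (WithLp.toLp 2 : (Fin N → ℝ) → EuclideanSpace ℝ (Fin N)) :=
    (MeasurableEquiv.toLp 2 (Fin N → ℝ)).measurableEmbedding
  have key : ∀ ξ : Fin N → ℝ, fourierTransform f ξ = G (WithLp.toLp 2 ξ) := by
    intro ξ
    rw [hG, SchwartzMap.fourier_coe, Real.fourier_eq']
    rw [← hmp.integral_comp hme]
    unfold fourierTransform
    congr 1
    ext x
    rw [smul_eq_mul]
    congr 1
    congr 1
    have : inner ℝ (WithLp.toLp 2 x : EuclideanSpace ℝ (Fin N)) (WithLp.toLp 2 ξ) = ∑ i, x i * ξ i := by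
      simp [PiLp.inner_apply, mul_comm]
    rw [this]
    push_cast; ring
  have hnorm : ∀ ξ : Fin N → ℝ, nsq ξ = ‖(WithLp.toLp 2 ξ : EuclideanSpace ℝ (Fin N))‖ ^ 2 := by
    intro ξ
    rw [EuclideanSpace.norm_sq_eq]
    simp [nsq]
  have h1 : Integrable (fun x : EuclideanSpace ℝ (Fin N) => ‖x‖ ^ 0 * ‖G x‖ + ‖x‖ ^ 2 * ‖G x‖) :=
    (G.integrable_pow_mul volume 0).add (G.integrable_pow_mul volume 2)
  have h2 := (hmp.integrable_comp_emb hme).2 h1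
  refine h2.congr (Eventually.of_forall fun ξ => ?_)
  simp only [Function.comp_apply, hnorm, key]; ring

/-- the heat difference -/
def gam {N : ℕ} (s : ℝ) (ξ : Fin N → ℝ) : ℝ := Real.exp (-s * (1 + nsq ξ)) - Real.exp (-(2 * s) * (1 + nsq ξ))

lemma gam_eq {N : ℕ} (s : ℝ) (ξ : Fin N → ℝ) : gam s ξ = Real.exp (-s * (1 + nsq ξ)) * (1 - Real.exp (-(s * (1 + nsq ξ)))) := by
  unfold gam
  rw [mul_sub, mul_one, ← Real.exp_add]; ring_nf

lemma gam_nonneg {N : ℕ} {s : ℝ} (hs : 0 < s) (ξ : Fin N → ℝ) : 0 ≤ gam s ξ := by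
  rw [gam_eq]
  have : 0 ≤ s * (1 + nsq ξ) := mul_nonneg hs.le (by linarith [nsq_nonneg ξ])
  have h2 : Real.exp (-(s * (1 + nsq ξ))) ≤ 1 := Real.exp_le_one_iff.2 (by linarith)
  exact mul_nonneg (Real.exp_pos _).le (by linarith)

lemma gam_le {N : ℕ} {s κ : ℝ} (hs : 0 < s) (hκ : 0 ≤ κ) (hκ1 : κ ≤ 1) (ξ : Fin N → ℝ) :
    gam s ξ ≤ Real.exp (-s) * (s * (1 + nsq ξ)) ^ κ := by
  rw [gam_eq]
  have h0 := nsq_nonneg ξ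
  have h1 : 0 < s * (1 + nsq ξ) := mul_pos hs (by linarith)
  refine mul_le_mul ?_ ?_ ?_ (Real.exp_pos _).le
  · rw [Real.exp_le_exp]; nlinarith
  · rcases le_total 1 (s * (1 + nsq ξ)) with h | h
    · have : 1 ≤ (s * (1 + nsq ξ)) ^ κ := Real.one_le_rpow h hκ
      linarith [Real.exp_pos (-(s * (1 + nsq ξ)))]
    · have h2 : (s * (1 + nsq ξ)) ^ (1:ℝ) ≤ (s * (1 + nsq ξ)) ^ κ := Real.rpow_le_rpow_of_exponent_ge h1 h hκ1
      rw [Real.rpow_one] at h2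
      linarith [Real.add_one_le_exp (-(s * (1 + nsq ξ)))]
  · have : Real.exp (-(s * (1 + nsq ξ))) ≤ 1 := Real.exp_le_one_iff.2 (by linarith)
    linarith

lemma gam_split {N : ℕ} (s : ℝ) (ξ : Fin N → ℝ) :
    gam s ξ = Real.exp (-s) * Real.exp (-s * nsq ξ) - Real.exp (-(2 * s)) * Real.exp (-(2 * s) * nsq ξ) := by
  unfold gam; rw [← Real.exp_add, ← Real.exp_add]; ring_nf

lemma integrable_gam {N : ℕ} {s : ℝ} (hs : 0 < s) : Integrable (fun ξ : Fin N → ℝ => gam s ξ) := by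
  simp only [gam_split]
  exact ((integrable_gauss hs).const_mul _).sub ((integrable_gauss (by linarith : 0 < 2 * s)).const_mul _)

lemma continuous_gam {N : ℕ} : Continuous (fun z : ℝ × (Fin N → ℝ) => gam z.1 z.2) := by
  unfold gam
  have := continuous_nsq (N := N)
  fun_prop

lemma fourierInv_gam {N : ℕ} {s : ℝ} (hs : 0 < s) (x : Fin N → ℝ) :
    fourierInv (fun ξ => (gam s ξ : ℂ)) x = ((Real.exp (-s) * gk s x - Real.exp (-(2 * s)) * gk (2 * s) x : ℝ) : ℂ) := by
  rw [fourierInv_eq]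
  have h2s : 0 < 2 * s := by linarith
  have e : ∀ ξ : Fin N → ℝ, ew x ξ * (gam s ξ : ℂ) = (Real.exp (-s) : ℂ) * (ew ξ x * ((Real.exp (-s * nsq ξ) : ℝ) : ℂ)) -
      (Real.exp (-(2 * s)) : ℂ) * (ew ξ x * ((Real.exp (-(2 * s) * nsq ξ) : ℝ) : ℂ)) := by
    intro ξ; rw [gam_split, ew_comm x ξ]; push_cast; ring
  simp only [e]
  have hi : ∀ b : ℝ, 0 < b → Integrable (fun ξ : Fin N → ℝ => ew ξ x * ((Real.exp (-b * nsq ξ) : ℝ) : ℂ)) := by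
    intro b hb
    have := integrable_ew_mul (integrable_gauss (N := N) hb).ofReal x
    refine this.congr (Eventually.of_forall fun ξ => ?_)
    simp only [ew_comm x ξ]
    rfl
  rw [integral_sub ((hi s hs).const_mul _) ((hi (2*s) h2s).const_mul _), integral_const_mul, integral_const_mul,
    gauss_ft hs, gauss_ft h2s]
  push_cast; ring

lemma fourierInv_gam_l1 {N : ℕ} {s : ℝ} (hs : 0 < s) :
    ∫⁻ x : Fin N → ℝ, ‖fourierInv (fun ξ => (gam s ξ : ℂ)) x‖ₑ ≤ ENNReal.ofReal (2 * Real.exp (-s)) := by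
  have h2s : 0 < 2 * s := by linarith
  calc ∫⁻ x : Fin N → ℝ, ‖fourierInv (fun ξ => (gam s ξ : ℂ)) x‖ₑ
      ≤ ∫⁻ x : Fin N → ℝ, ENNReal.ofReal (Real.exp (-s)) * ENNReal.ofReal (gk s x) +
          ENNReal.ofReal (Real.exp (-(2 * s))) * ENNReal.ofReal (gk (2 * s) x) := by
        refine lintegral_mono fun x => ?_
        rw [fourierInv_gam hs, ← ofReal_norm, Complex.norm_real, Real.norm_eq_abs]
        rw [← ENNReal.ofReal_mul (Real.exp_pos _).le, ← ENNReal.ofReal_mul (Real.exp_pos _).le,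
          ← ENNReal.ofReal_add (mul_nonneg (Real.exp_pos _).le (gk_nonneg hs x)) (mul_nonneg (Real.exp_pos _).le (gk_nonneg h2s x))]
        refine ENNReal.ofReal_le_ofReal ?_
        have h1 := mul_nonneg (Real.exp_pos (-s)).le (gk_nonneg hs x)
        have h2 := mul_nonneg (Real.exp_pos (-(2*s))).le (gk_nonneg h2s x)
        rw [abs_le]; constructor <;> linarith
    _ = ENNReal.ofReal (Real.exp (-s)) + ENNReal.ofReal (Real.exp (-(2 * s))) := by
        have m1 : Measurable fun x : Fin N → ℝ => ENNReal.ofReal (gk s x) := (continuous_gk s).measurable.ennreal_ofReal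
        have m2 : Measurable fun x : Fin N → ℝ => ENNReal.ofReal (gk (2*s) x) := (continuous_gk (2*s)).measurable.ennreal_ofReal
        rw [lintegral_add_left (show Measurable fun x : Fin N → ℝ => ENNReal.ofReal (Real.exp (-s)) * ENNReal.ofReal (gk s x) from m1.const_mul _),
          lintegral_const_mul _ m1, lintegral_const_mul _ m2, lintegral_gk hs, lintegral_gk h2s, mul_one, mul_one]
    _ ≤ _ := by
        rw [← ENNReal.ofReal_add (Real.exp_pos _).le (Real.exp_pos _).le]
        refine ENNReal.ofReal_le_ofReal ?_
        have : Real.exp (-(2 * s)) ≤ Real.exp (-s) := Real.exp_le_exp.2 (by linarith)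
        linarith

/-- Subordination formula. -/
lemma subord {b : ℝ} (hb : 0 < b) (hb1 : b < 1) : ∃ I > 0, ∀ {N : ℕ} (ξ : Fin N → ℝ),
    ∫ s in Ioi (0:ℝ), s ^ (-b - 1) * gam s ξ = (1 + nsq ξ) ^ b * I := by
  set g : ℝ → ℝ := fun x => x ^ (-b - 1) * (Real.exp (-x) - Real.exp (-(2 * x))) with hg
  have hdec : ∀ x, 0 < x → 0 < Real.exp (-x) - Real.exp (-(2 * x)) := fun x hx =>
    sub_pos.2 (Real.exp_lt_exp.2 (by linarith))
  have hgpos : ∀ x ∈ Ioi (0:ℝ), 0 < g x := fun x hx => mul_pos (Real.rpow_pos_of_pos hx _) (hdec x hx)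
  have hgm : Measurable g := by
    rw [hg]; fun_prop
  have hgi : IntegrableOn g (Ioi 0) := by
    have h1 := Real.GammaIntegral_convergent (s := 1 - b) (by linarith)
    refine Integrable.mono' h1 hgm.aestronglyMeasurable ?_
    filter_upwards [ae_restrict_mem measurableSet_Ioi] with x hx
    have hx0 : 0 < x := hx
    rw [Real.norm_eq_abs, abs_of_pos (hgpos x hx), hg]
    have h2 : Real.exp (-x) - Real.exp (-(2 * x)) ≤ Real.exp (-x) * x := by
      have : Real.exp (-(2 * x)) = Real.exp (-x) * Real.exp (-x) := by rw [← Real.exp_add]; ring_nf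
      rw [this]
      nlinarith [Real.add_one_le_exp (-x), Real.exp_pos (-x)]
    calc x ^ (-b - 1) * (Real.exp (-x) - Real.exp (-(2 * x))) ≤ x ^ (-b - 1) * (Real.exp (-x) * x) := by gcongr
      _ = Real.exp (-x) * x ^ (1 - b - 1) := by
        have : x ^ (1 - b - 1) = x ^ (-b - 1) * x := by
          rw [← Real.rpow_add_one hx0.ne']; ring_nf
        rw [this]; ring
  refine ⟨∫ x in Ioi (0:ℝ), g x, ?_, ?_⟩
  · show 0 < ∫ x in Ioi (0:ℝ), g x
    rw [setIntegral_pos_iff_support_of_nonneg_ae ((ae_restrict_mem measurableSet_Ioi).mono fun x hx => (hgpos x hx).le) hgi]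
    have : Ioi (0:ℝ) ⊆ Function.support g ∩ Ioi 0 := fun x hx => ⟨(hgpos x hx).ne', hx⟩
    refine lt_of_lt_of_le ?_ (measure_mono this)
    simp
  · intro N ξ
    have hA : 0 < 1 + nsq ξ := by linarith [nsq_nonneg ξ]
    have h1 := integral_comp_mul_left_Ioi g 0 hA
    rw [mul_zero, smul_eq_mul] at h1
    have h2 : ∫ s in Ioi (0:ℝ), g ((1 + nsq ξ) * s) = (1 + nsq ξ) ^ (-b - 1) * ∫ s in Ioi (0:ℝ), s ^ (-b - 1) * gam s ξ := by
      rw [← integral_const_mul]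
      refine setIntegral_congr_fun measurableSet_Ioi fun s hs => ?_
      have hs0 : 0 < s := hs
      simp only [hg]
      rw [Real.mul_rpow hA.le hs0.le]
      unfold gam
      rw [show -((1 + nsq ξ) * s) = -s * (1 + nsq ξ) by ring, show -(2 * ((1 + nsq ξ) * s)) = -(2 * s) * (1 + nsq ξ) by ring]
      ring
    rw [h2] at h1
    have h3 : (1 + nsq ξ) ^ b * (1 + nsq ξ) ^ (-b - 1) = (1 + nsq ξ)⁻¹ := by
      rw [← Real.rpow_add hA, ← Real.rpow_neg_one]; ring_nf
    have h4 : (1 + nsq ξ) ^ (-b - 1) ≠ 0 := (Real.rpow_pos_of_pos hA _).ne'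
    apply mul_left_cancel₀ h4
    rw [h1, ← h3]; ring

section fub
variable {N : ℕ} {T : Type*} [MeasurableSpace T] {μ : Measure T} [SFinite μ]

lemma ew_shift (x ξ y : Fin N → ℝ) : ew x ξ * ew (-ξ) y = ew (x - y) ξ := by
  rw [sub_eq_add_neg, ew_add_left, ew_neg_left ξ y, ew_comm ξ y, ew_neg_left y ξ]

lemma measurable_ew_comp {X : Type*} [MeasurableSpace X] {f g : X → (Fin N → ℝ)} (hf : Measurable f) (hg : Measurable g) :
    Measurable (fun x => ew (f x) (g x)) :=
  continuous_ew.measurable.comp (hf.prodMk hg)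

/-- The multiplier of a measure carried by `Γ`. -/
def mult (μ : Measure T) (Γ : T → (Fin N → ℝ)) (K1 : T → ℂ) (ξ : Fin N → ℝ) : ℂ :=
  ∫ t, ew (-ξ) (Γ t) * K1 t ∂μ

lemma norm_mult_le (Γ : T → (Fin N → ℝ)) (K1 : T → ℂ) (ξ : Fin N → ℝ) :
    ‖mult μ Γ K1 ξ‖ ≤ ∫ t, ‖K1 t‖ ∂μ := by
  refine (norm_integral_le_integral_norm _).trans (le_of_eq ?_)
  simp only [norm_mul, norm_ew, one_mul]

lemma mult_measurable {Γ : T → (Fin N → ℝ)} (hΓ : Measurable Γ) {K1 : T → ℂ} (hK : Measurable K1) :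
    StronglyMeasurable (mult μ Γ K1) := by
  unfold mult
  refine StronglyMeasurable.integral_prod_right' (f := fun z : (Fin N → ℝ) × T => ew (-z.1) (Γ z.2) * K1 z.2) ?_
  exact ((measurable_ew_comp measurable_fst.neg (hΓ.comp measurable_snd)).mul (hK.comp measurable_snd)).stronglyMeasurable

lemma mult_inv {Γ : T → (Fin N → ℝ)} (hΓ : Measurable Γ) {K1 : T → ℂ} (hK : Integrable K1 μ)
    {φ : (Fin N → ℝ) → ℂ} (hφ : Integrable φ) (x : Fin N → ℝ) :
    fourierInv (fun ξ => mult μ Γ K1 ξ * φ ξ) x = ∫ t, K1 t * fourierInv φ (x - Γ t) ∂μ := by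
  rw [fourierInv_eq]
  have e1 : ∀ ξ, ew x ξ * (mult μ Γ K1 ξ * φ ξ) = ∫ t, ew (x - Γ t) ξ * (φ ξ * K1 t) ∂μ := by
    intro ξ
    unfold mult
    rw [mul_comm _ (φ ξ), ← mul_assoc, ← integral_const_mul]
    refine integral_congr_ae (Eventually.of_forall fun t => ?_)
    simp only []
    rw [← ew_shift x ξ (Γ t)]; ring
  have e2 : ∀ t, K1 t * fourierInv φ (x - Γ t) = ∫ ξ, ew (x - Γ t) ξ * (φ ξ * K1 t) := by
    intro t
    rw [fourierInv_eq, ← integral_const_mul]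
    refine integral_congr_ae (Eventually.of_forall fun t => ?_)
    simp only []
    ring
  simp only [e1, e2]
  refine integral_integral_swap ?_
  have h1 : Integrable (fun z : (Fin N → ℝ) × T => φ z.1 * K1 z.2) ((volume : Measure (Fin N → ℝ)).prod μ) := hφ.mul_prod hK
  have h2 : Measurable (fun z : (Fin N → ℝ) × T => ew (x - Γ z.2) z.1) :=
    measurable_ew_comp ((hΓ.comp measurable_snd).const_sub x) measurable_fst
  exact h1.bdd_mul (c := 1) h2.aestronglyMeasurable (Eventually.of_forall fun z => (norm_ew _ _).le)

lemma mult_l1 {Γ : T → (Fin N → ℝ)} (hΓ : Measurable Γ) {K1 : T → ℂ} (hKm : Measurable K1) (hK : Integrable K1 μ)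
    {φ : (Fin N → ℝ) → ℂ} (hφ : Integrable φ) :
    ∫⁻ x, ‖fourierInv (fun ξ => mult μ Γ K1 ξ * φ ξ) x‖ₑ ≤ (∫⁻ t, ‖K1 t‖ₑ ∂μ) * ∫⁻ x, ‖fourierInv φ x‖ₑ := by
  have hc := continuous_fourierInv hφ
  have hm : Measurable fun x => ‖fourierInv φ x‖ₑ := hc.measurable.enorm
  calc ∫⁻ x, ‖fourierInv (fun ξ => mult μ Γ K1 ξ * φ ξ) x‖ₑ
      ≤ ∫⁻ x, ∫⁻ t, ‖K1 t‖ₑ * ‖fourierInv φ (x - Γ t)‖ₑ ∂μ := by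
        refine lintegral_mono fun x => ?_
        rw [mult_inv hΓ hK hφ]
        refine (enorm_integral_le_lintegral_enorm _).trans (le_of_eq ?_)
        simp only [enorm_mul]
    _ = ∫⁻ t, (∫⁻ x, ‖K1 t‖ₑ * ‖fourierInv φ (x - Γ t)‖ₑ) ∂μ := by
        refine lintegral_lintegral_swap ?_
        refine Measurable.aemeasurable ?_
        exact (hKm.comp measurable_snd).enorm.mul (hm.comp (measurable_fst.sub (hΓ.comp measurable_snd)))
    _ = ∫⁻ t, ‖K1 t‖ₑ * (∫⁻ x, ‖fourierInv φ x‖ₑ) ∂μ := by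
        refine lintegral_congr fun t => ?_
        rw [lintegral_const_mul _ (show Measurable fun x => ‖fourierInv φ (x - Γ t)‖ₑ from hm.comp (measurable_id.sub_const (Γ t))),
          lintegral_sub_right_eq_self (fun x => ‖fourierInv φ x‖ₑ) (Γ t)]
    _ = _ := by
        rw [lintegral_mul_const _ hKm.enorm]

lemma mult_conv_ft {Γ : T → (Fin N → ℝ)} (hΓ : Measurable Γ) {K1 : T → ℂ} (hK : Integrable K1 μ)
    {f : (Fin N → ℝ) → ℂ} (hf : Integrable f) (hfm : Measurable f) (ξ : Fin N → ℝ) :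
    fourierTransform (fun x => ∫ t, K1 t * f (x - Γ t) ∂μ) ξ = mult μ Γ K1 ξ * fourierTransform f ξ := by
  rw [fourierTransform_eq]
  have e1 : ∀ x, ew (-ξ) x * (∫ t, K1 t * f (x - Γ t) ∂μ) = ∫ t, ew (-ξ) x * (K1 t * f (x - Γ t)) ∂μ := by
    intro x; rw [integral_const_mul]
  simp only [e1]
  rw [integral_integral_swap]
  · unfold mult
    rw [← integral_mul_const]
    refine integral_congr_ae (Eventually.of_forall fun t => ?_)
    simp only []
    rw [fourierTransform_eq, ← integral_const_mul]
    rw [← integral_sub_right_eq_self (fun y => ew (-ξ) (Γ t) * K1 t * (ew (-ξ) y * f y)) (Γ t)]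
    refine integral_congr_ae (Eventually.of_forall fun x => ?_)
    simp only []
    have : ew (-ξ) x = ew (-ξ) (x - Γ t) * ew (-ξ) (Γ t) := by rw [← ew_add]; congr 1; abel
    rw [this]; ring
  · have hmeas : AEStronglyMeasurable (fun z : (Fin N → ℝ) × T => K1 z.2 * f (z.1 - Γ z.2)) ((volume : Measure (Fin N → ℝ)).prod μ) :=
      (hK.aestronglyMeasurable.comp_snd).mul (hfm.comp (measurable_fst.sub (hΓ.comp measurable_snd))).aestronglyMeasurable
    have h1 : Integrable (fun z : (Fin N → ℝ) × T => K1 z.2 * f (z.1 - Γ z.2)) ((volume : Measure (Fin N → ℝ)).prod μ) := by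
      rw [integrable_prod_iff' hmeas]
      refine ⟨Eventually.of_forall fun t => ?_, ?_⟩
      · exact (hf.comp_sub_right (Γ t)).const_mul (K1 t)
      · refine (hK.norm.mul_const (∫ x, ‖f x‖)).congr (Eventually.of_forall fun t => ?_)
        simp only [norm_mul]
        rw [integral_const_mul, integral_sub_right_eq_self (fun x => ‖f x‖) (Γ t)]
    have h2 : Measurable (fun z : (Fin N → ℝ) × T => ew (-ξ) z.1) :=
      measurable_ew_comp measurable_const measurable_fst
    exact h1.bdd_mul (c := 1) h2.aestronglyMeasurable (Eventually.of_forall fun z => (norm_ew _ _).le)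
end fub

/-- one dimensional averaging weight -/
def lw (r u s : ℝ) : ℝ := if u / s ∈ Icc r 1 then |s|⁻¹ else 0

lemma lw_pos_eq {r u : ℝ} (hr : 0 < r) (hu : 0 < u) : lw r u = indicator (Icc u (u / r)) (fun s => s⁻¹) := by
  ext s
  unfold lw
  by_cases hs : 0 < s
  · have : u / s ∈ Icc r 1 ↔ s ∈ Icc u (u / r) := by
      rw [mem_Icc, mem_Icc, le_div_iff₀ hs, div_le_one hs, le_div_iff₀ hr, mul_comm s r]
      tauto
    by_cases h : s ∈ Icc u (u / r)
    · rw [if_pos (this.2 h), indicator_of_mem h, abs_of_pos hs]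
    · rw [if_neg (fun h' => h (this.1 h')), indicator_of_notMem h]
  · have h1 : ¬ (u / s ∈ Icc r 1) := by
      rintro ⟨h, _⟩
      have : u / s ≤ 0 := div_nonpos_of_nonneg_of_nonpos hu.le (not_lt.1 hs)
      linarith
    have h2 : s ∉ Icc u (u / r) := fun h => hs (lt_of_lt_of_le hu h.1)
    rw [if_neg h1, indicator_of_notMem h2]

lemma lw_neg (r u s : ℝ) : lw r (-u) (-s) = lw r u s := by
  unfold lw; rw [neg_div_neg_eq, abs_neg]

lemma lw_int_pos {r u : ℝ} (hr : 0 < r) (hr1 : r < 1) (hu : 0 < u) :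
    Integrable (lw r u) ∧ ∫ s, lw r u s = Real.log (1 / r) := by
  rw [lw_pos_eq hr hu]
  have hle : u ≤ u / r := by rw [le_div_iff₀ hr]; nlinarith
  constructor
  · rw [integrable_indicator_iff measurableSet_Icc]
    refine ContinuousOn.integrableOn_Icc ?_
    refine continuousOn_inv₀.mono fun s hs => ?_
    exact (lt_of_lt_of_le hu hs.1).ne'
  · rw [integral_indicator measurableSet_Icc, integral_Icc_eq_integral_Ioc, ← intervalIntegral.integral_of_le hle,
      integral_inv_of_pos hu (lt_of_lt_of_le hu hle)]
    congr 1
    field_simp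

lemma lw_int {r u : ℝ} (hr : 0 < r) (hr1 : r < 1) (hu : u ≠ 0) :
    Integrable (lw r u) ∧ ∫ s, lw r u s = Real.log (1 / r) := by
  rcases lt_or_gt_of_ne hu with h | h
  · have h1 := lw_int_pos hr hr1 (neg_pos.2 h)
    have e : lw r u = fun s => lw r (-u) (-s) := by ext s; rw [lw_neg]
    rw [e]
    exact ⟨h1.1.comp_neg, by rw [integral_neg_eq_self (fun s => lw r (-u) s)]; exact h1.2⟩
  · exact lw_int_pos hr hr1 h

lemma lw_prod (r : ℝ) (t τ : Fin n → ℝ) [Decidable (t ∈ RB r τ)] :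
    ∏ i, lw r (t i) (τ i) = if t ∈ RB r τ then (∏ i, |τ i|)⁻¹ else 0 := by
  split_ifs with h
  · rw [← Finset.prod_inv_distrib]
    refine Finset.prod_congr rfl fun i _ => ?_
    unfold lw; rw [if_pos (h i)]
  · have : ∃ i, ¬ (t i / τ i ∈ Icc r 1) := by
      by_contra hc; push Not at hc; exact h hc
    obtain ⟨i, hi⟩ := this
    refine Finset.prod_eq_zero (Finset.mem_univ i) ?_
    unfold lw; rw [if_neg hi]

lemma measurable_lw (r : ℝ) : Measurable (fun z : ℝ × ℝ => lw r z.1 z.2) := by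
  unfold lw
  refine Measurable.ite ?_ (by fun_prop) measurable_const
  exact (measurable_fst.div measurable_snd) measurableSet_Icc

lemma avg_rep {r δ : ℝ} (hr : 0 < r) (hr1 : r < 1) (hδ : 0 < δ) {F : (Fin n → ℝ) → ℂ} (hF : Integrable F)
    (hs : ∀ t, F t ≠ 0 → t ∈ pbox n (δ * r)) :
    ∫ τ in pbox n δ, (((∏ i, |τ i|)⁻¹ : ℝ) : ℂ) * ∫ t in RB r τ, F t = ((Real.log (1 / r) ^ n : ℝ) : ℂ) * ∫ t, F t := by
  classical
  set Φ : (Fin n → ℝ) → (Fin n → ℝ) → ℝ := fun τ t => ∏ i, lw r (t i) (τ i) with hΦ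
  have hΦm : Measurable (fun z : (Fin n → ℝ) × (Fin n → ℝ) => Φ z.1 z.2) := by
    refine Finset.measurable_prod _ fun i _ => ?_
    exact (measurable_lw r).comp (f := fun z : (Fin n → ℝ) × (Fin n → ℝ) => (z.2 i, z.1 i)) (by fun_prop)
  have hΦ0 : ∀ τ t, 0 ≤ Φ τ t := by
    intro τ t
    refine Finset.prod_nonneg fun i _ => ?_
    unfold lw; split_ifs <;> positivity
  have hΦi : ∀ t : Fin n → ℝ, (∀ i, t i ≠ 0) → Integrable (fun τ => Φ τ t) ∧ ∫ τ, Φ τ t = Real.log (1 / r) ^ n := by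
    intro t ht
    constructor
    · exact Integrable.fintype_prod (f := fun i s => lw r (t i) s) fun i => (lw_int hr hr1 (ht i)).1
    · simp only [hΦ]
      rw [integral_fintype_prod_volume_eq_prod (fun i s => lw r (t i) s)]
      simp [fun i => (lw_int hr hr1 (ht i)).2]
  have hL : 0 ≤ Real.log (1 / r) ^ n := pow_nonneg (Real.log_nonneg (by rw [le_div_iff₀ hr]; linarith)) _
  have hintegr : Integrable (fun z : (Fin n → ℝ) × (Fin n → ℝ) => (Φ z.1 z.2 : ℂ) * F z.2)
      ((volume : Measure (Fin n → ℝ)).prod (volume : Measure (Fin n → ℝ))) := by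
    have hm : AEStronglyMeasurable (fun z : (Fin n → ℝ) × (Fin n → ℝ) => (Φ z.1 z.2 : ℂ) * F z.2)
      ((volume : Measure (Fin n → ℝ)).prod (volume : Measure (Fin n → ℝ))) :=
      (Complex.measurable_ofReal.comp hΦm).aestronglyMeasurable.mul hF.aestronglyMeasurable.comp_snd
    rw [integrable_prod_iff' hm]
    constructor
    · refine Eventually.of_forall fun t => ?_
      by_cases h : F t = 0
      · simp [h]
      · exact ((hΦi t fun i => abs_pos.1 (hs t h i).1).1.ofReal (𝕜 := ℂ)).mul_const (F t)
    · refine (hF.norm.const_mul (Real.log (1 / r) ^ n)).congr (Eventually.of_forall fun t => ?_)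
      simp only [norm_mul, Complex.norm_real, Real.norm_eq_abs, abs_of_nonneg (hΦ0 _ _)]
      rw [integral_mul_const]
      by_cases h : F t = 0
      · simp [h]
      · rw [(hΦi t fun i => abs_pos.1 (hs t h i).1).2]
  have hpt : ∀ τ, (((∏ i, |τ i|)⁻¹ : ℝ) : ℂ) * ∫ t in RB r τ, F t = ∫ t, (Φ τ t : ℂ) * F t := by
    intro τ
    rw [← integral_indicator (isClosed_RB r τ).measurableSet, ← integral_const_mul]
    refine integral_congr_ae (Eventually.of_forall fun t => ?_)
    simp only [hΦ]
    rw [lw_prod r t τ]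
    by_cases h : t ∈ RB r τ
    · rw [indicator_of_mem h, if_pos h]
    · rw [indicator_of_notMem h, if_neg h]; simp
  simp only [hpt]
  rw [setIntegral_eq_integral_of_forall_compl_eq_zero]
  · rw [integral_integral_swap hintegr, ← integral_const_mul]
    refine integral_congr_ae (Eventually.of_forall fun t => ?_)
    simp only []
    rw [integral_mul_const]
    by_cases h : F t = 0
    · simp [h]
    · rw [← (hΦi t fun i => abs_pos.1 (hs t h i).1).2]
      congr 1
      exact integral_ofReal (𝕜 := ℂ)
  · intro τ hτ
    refine integral_eq_zero_of_ae (Eventually.of_forall fun t => ?_)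
    show (Φ τ t : ℂ) * F t = 0
    by_cases h : F t = 0
    · simp [h]
    · simp only [hΦ]
      rw [lw_prod r t τ, if_neg]
      · simp
      · intro hc
        apply hτ
        intro i
        have h1 := hc i
        have h2 := hs t h i
        have h3 : τ i ≠ 0 := by
          intro h0; rw [h0, div_zero] at h1; linarith [h1.1]
        refine ⟨abs_pos.2 h3, ?_⟩
        have h4 : r ≤ |t i / τ i| := h1.1.trans (le_abs_self _)
        rw [abs_div, le_div_iff₀ (abs_pos.2 h3)] at h4
        have h5 : r * |τ i| < r * δ := by linarith [h2.2]
        exact lt_of_mul_lt_mul_left h5 hr.le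

end

section

lemma measurable_rb (r : ℝ) : MeasurableSet {z : (Fin n → ℝ) × (Fin n → ℝ) | z.2 ∈ RB r z.1} := by
  have : {z : (Fin n → ℝ) × (Fin n → ℝ) | z.2 ∈ RB r z.1} = ⋂ i, {z | z.2 i / z.1 i ∈ Icc r 1} := by
    ext z; simp [RB]
  rw [this]
  refine MeasurableSet.iInter fun i => ?_
  have hm : Measurable (fun z : (Fin n → ℝ) × (Fin n → ℝ) => z.2 i / z.1 i) := by fun_prop
  exact hm measurableSet_Icc

/-- The localized multiplier. -/
def aT {N : ℕ} (r : ℝ) (Γ : (Fin n → ℝ) → (Fin N → ℝ)) (K1 : (Fin n → ℝ) → ℂ) (τ : Fin n → ℝ) (ξ : Fin N → ℝ) : ℂ :=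
  mult (volume.restrict (RB r τ)) Γ K1 ξ

lemma aT_measurable {N : ℕ} (r : ℝ) {Γ : (Fin n → ℝ) → (Fin N → ℝ)} (hΓ : Measurable Γ) {K1 : (Fin n → ℝ) → ℂ}
    (hK : Measurable K1) : StronglyMeasurable (fun z : (Fin n → ℝ) × (Fin N → ℝ) => aT r Γ K1 z.1 z.2) := by
  have e : (fun z : (Fin n → ℝ) × (Fin N → ℝ) => aT r Γ K1 z.1 z.2) =
      fun z => ∫ t, ({w : (Fin n → ℝ) × (Fin n → ℝ) | w.2 ∈ RB r w.1}.indicator (fun _ => (1:ℂ)) (z.1, t)) * (ew (-z.2) (Γ t) * K1 t) := by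
    ext z
    unfold aT mult
    rw [← integral_indicator (isClosed_RB r z.1).measurableSet]
    refine integral_congr_ae (Eventually.of_forall fun t => ?_)
    simp only []
    by_cases h : t ∈ RB r z.1
    · rw [indicator_of_mem h, indicator_of_mem (show (z.1, t) ∈ {w : (Fin n → ℝ) × (Fin n → ℝ) | w.2 ∈ RB r w.1} from h), one_mul]
    · rw [indicator_of_notMem h, indicator_of_notMem (show (z.1, t) ∉ {w : (Fin n → ℝ) × (Fin n → ℝ) | w.2 ∈ RB r w.1} from h), zero_mul]
  rw [e]
  refine StronglyMeasurable.integral_prod_right' (f := fun q : ((Fin n → ℝ) × (Fin N → ℝ)) × (Fin n → ℝ) =>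
    ({w : (Fin n → ℝ) × (Fin n → ℝ) | w.2 ∈ RB r w.1}.indicator (fun _ => (1:ℂ)) (q.1.1, q.2)) * (ew (-q.1.2) (Γ q.2) * K1 q.2)) ?_
  refine Measurable.stronglyMeasurable ?_
  refine Measurable.mul ?_ ?_
  · exact (measurable_const.indicator (measurable_rb r)).comp (f := fun q : ((Fin n → ℝ) × (Fin N → ℝ)) × (Fin n → ℝ) => (q.1.1, q.2)) (by fun_prop)
  · exact (measurable_ew_comp (measurable_fst.snd.neg) (hΓ.comp measurable_snd)).mul (hK.comp measurable_snd)

lemma core {N : ℕ} {r δ : ℝ} (hr : 0 < r) (hr1 : r < 1) (hδ : 0 < δ)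
    {Γ : (Fin n → ℝ) → (Fin N → ℝ)} (hΓ : Measurable Γ) {K1 : (Fin n → ℝ) → ℂ} (hKm : Measurable K1) (hK : Integrable K1)
    (hs : ∀ t, K1 t ≠ 0 → t ∈ pbox n (δ * r)) {X M : (Fin n → ℝ) → ℝ} (hXm : Measurable X) (hMm : Measurable M)
    (hX0 : ∀ τ ∈ pbox n δ, 0 < X τ) (hM0 : ∀ τ ∈ pbox n δ, 0 < M τ)
    {D : ℝ} (hD : 0 < D)
    (h1 : ∀ τ ∈ pbox n δ, ∫ t in RB r τ, ‖K1 t‖ ≤ D * X τ * ∏ i, |τ i|)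
    {p β β' δ' : ℝ} (hp : 1 < p) (hβ : 0 < β) (hββ' : β < β') (hβ1 : β < 2)
    (hδ'0 : 0 ≤ δ') (hδ'1 : δ' ≤ 1) (hθ : δ' * (2 * min (1 / p) (1 - 1 / p)) = β')
    (h2 : ∀ τ ∈ pbox n δ, ∀ ξ, ‖aT r Γ K1 τ ξ‖ ≤ D * X τ * (∏ i, |τ i|) * ((1 + nsq ξ) ^ (-(δ' / 2)) * M τ ^ (-δ')))
    (hX : ∫⁻ τ in pbox n δ, ENNReal.ofReal (X τ) < ⊤)
    (hXM : ∫⁻ τ in pbox n δ, ENNReal.ofReal (X τ) * ENNReal.ofReal (M τ) ^ (-β') < ⊤) :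
    ∃ C : ℝ, 0 ≤ C ∧ ∀ f : SchwartzMap (Fin N → ℝ) ℂ,
      eLpNorm (fourierInv fun ξ => (((1 + nsq ξ) ^ (β / 2) : ℝ) : ℂ) * (mult volume Γ K1 ξ * fourierTransform f ξ))
        (ENNReal.ofReal p) volume ≤ ENNReal.ofReal C * eLpNorm f (ENNReal.ofReal p) volume := by
  obtain ⟨I, hI, hsub⟩ := subord (b := β / 2) (by linarith) (by linarith)
  obtain ⟨C0, hC0, hintegr⟩ := interp (N := N) hp
  set θ := 2 * min (1 / p) (1 - 1 / p) with hθd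
  set b := β / 2 with hb
  set L : ℝ := Real.log (1 / r) ^ n with hL
  have hL0 : 0 < L := pow_pos (Real.log_pos (by rw [lt_div_iff₀ hr]; linarith)) _
  set η : Measure ((Fin n → ℝ) × ℝ) := (volume.restrict (pbox n δ)).prod (volume.restrict (Ioi (0:ℝ))) with hη
  set P : (Fin n → ℝ) → ℝ := fun τ => ∏ i, |τ i| with hP
  have hPm : Measurable P := by rw [hP]; fun_prop
  have hP0 : ∀ τ ∈ pbox n δ, 0 < P τ := fun τ hτ => Finset.prod_pos fun i _ => (hτ i).1
  have hη_mem : ∀ᵐ y ∂η, y.1 ∈ pbox n δ ∧ 0 < y.2 := by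
    rw [hη, Measure.prod_restrict]
    filter_upwards [ae_restrict_mem ((measurableSet_pbox n δ).prod measurableSet_Ioi)] with y hy
    exact ⟨hy.1, hy.2⟩
  -- weights
  set w : (Fin n → ℝ) × ℝ → ℝ≥0∞ := fun y => ENNReal.ofReal (2 * C0 * D) *
    ((ENNReal.ofReal (X y.1) * ENNReal.ofReal (M y.1) ^ (-β')) * ENNReal.ofReal (Real.exp (-y.2) * y.2 ^ (β' / 2 - b - 1))) with hw
  have hwm1 : Measurable fun τ => ENNReal.ofReal (X τ) * ENNReal.ofReal (M τ) ^ (-β') :=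
    hXm.ennreal_ofReal.mul (hMm.ennreal_ofReal.pow_const _)
  have hwm2 : Measurable fun s : ℝ => ENNReal.ofReal (Real.exp (-s) * s ^ (β' / 2 - b - 1)) := by fun_prop
  have hwm : Measurable w := by
    refine Measurable.const_mul ?_ _
    exact (hwm1.comp measurable_fst).mul (hwm2.comp measurable_snd)
  have hwfin : ∫⁻ y, w y ∂η < ⊤ := by
    have hm3 : Measurable fun y : (Fin n → ℝ) × ℝ => (ENNReal.ofReal (X y.1) * ENNReal.ofReal (M y.1) ^ (-β')) *
        ENNReal.ofReal (Real.exp (-y.2) * y.2 ^ (β' / 2 - b - 1)) :=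
      (hwm1.comp measurable_fst).mul (hwm2.comp measurable_snd)
    simp only [hw]
    rw [lintegral_const_mul _ hm3, hη,
      lintegral_prod_mul hwm1.aemeasurable hwm2.aemeasurable]
    refine ENNReal.mul_lt_top ENNReal.ofReal_lt_top (ENNReal.mul_lt_top hXM ?_)
    have hg := Real.GammaIntegral_convergent (s := β' / 2 - b) (by rw [hb]; linarith)
    exact hg.lintegral_lt_top
  refine ⟨(ENNReal.ofReal ((I * L)⁻¹) * ∫⁻ y, w y ∂η).toReal, ENNReal.toReal_nonneg, fun f => ?_⟩
  rw [ENNReal.ofReal_toReal (ENNReal.mul_ne_top ENNReal.ofReal_ne_top hwfin.ne)]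
  have hfi : Integrable f := f.integrable
  have hfm : Measurable f := f.continuous.measurable
  have hfc := continuous_fourierTransform hfi
  have haM := aT_measurable r hΓ hKm
  set H : (Fin N → ℝ) → ((Fin n → ℝ) × ℝ) → ℂ := fun ξ y =>
    ((((P y.1)⁻¹ : ℝ) : ℂ) * aT r Γ K1 y.1 ξ) * ((y.2 ^ (-b - 1) * gam y.2 ξ : ℝ) : ℂ) * fourierTransform f ξ with hH
  have hHm : Measurable (fun z : (Fin N → ℝ) × ((Fin n → ℝ) × ℝ) => H z.1 z.2) := by
    refine Measurable.mul (Measurable.mul (Measurable.mul ?_ ?_) ?_) (hfc.measurable.comp measurable_fst)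
    · exact Complex.measurable_ofReal.comp (hPm.comp measurable_snd.fst).inv
    · exact haM.measurable.comp (f := fun z : (Fin N → ℝ) × ((Fin n → ℝ) × ℝ) => (z.2.1, z.1)) (by fun_prop)
    · refine Complex.measurable_ofReal.comp (Measurable.mul ?_ ?_)
      · exact measurable_snd.snd.pow_const _
      · exact continuous_gam.measurable.comp (f := fun z : (Fin N → ℝ) × ((Fin n → ℝ) × ℝ) => (z.2.2, z.1)) (by fun_prop)
  have haT : ∀ τ ∈ pbox n δ, ∀ ξ, ‖aT r Γ K1 τ ξ‖ ≤ D * X τ * P τ := fun τ hτ ξ => (norm_mult_le _ _ _).trans (h1 τ hτ)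
  have hstep1 : ∀ ξ, ∫ y, H ξ y ∂η = (((I * L : ℝ)) : ℂ) * ((((1 + nsq ξ) ^ b : ℝ) : ℂ) * (mult volume Γ K1 ξ * fourierTransform f ξ)) := by
    intro ξ
    rw [hH]
    simp only []
    rw [integral_mul_const, hη, integral_prod_mul (fun τ => (((P τ)⁻¹ : ℝ) : ℂ) * aT r Γ K1 τ ξ) (fun s : ℝ => ((s ^ (-b - 1) * gam s ξ : ℝ) : ℂ))]
    have ea : ∫ τ in pbox n δ, (((P τ)⁻¹ : ℝ) : ℂ) * aT r Γ K1 τ ξ = ((L : ℝ) : ℂ) * mult volume Γ K1 ξ := by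
      refine avg_rep hr hr1 hδ ?_ ?_
      · exact hK.bdd_mul (c := 1) (measurable_ew_comp measurable_const hΓ).aestronglyMeasurable (Eventually.of_forall fun z => (norm_ew _ _).le)
      · intro t ht
        exact hs t (right_ne_zero_of_mul ht)
    have eb : ∫ s in Ioi (0:ℝ), ((s ^ (-b - 1) * gam s ξ : ℝ) : ℂ) = (((1 + nsq ξ) ^ b * I : ℝ) : ℂ) := by
      rw [← hsub ξ]
      exact integral_ofReal (𝕜 := ℂ)
    rw [ea, eb]
    push_cast; ring
  have hexpi : IntegrableOn (fun s : ℝ => Real.exp (-s) * s ^ (-b)) (Ioi 0) := by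
    have := Real.GammaIntegral_convergent (s := 1 - b) (by rw [hb]; linarith)
    refine this.congr (Eventually.of_forall fun s => ?_)
    simp only []
    congr 2; ring
  have hXi : Integrable X (volume.restrict (pbox n δ)) := by
    refine ⟨hXm.aestronglyMeasurable, ?_⟩
    refine lt_of_le_of_lt (le_of_eq ?_) hX
    refine setLIntegral_congr_fun (measurableSet_pbox n δ) fun τ hτ => ?_
    rw [← ofReal_norm, Real.norm_of_nonneg (hX0 τ hτ).le]
  have hHint : Integrable (fun z : (Fin N → ℝ) × ((Fin n → ℝ) × ℝ) => H z.1 z.2) ((volume : Measure (Fin N → ℝ)).prod η) := by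
    have hdom := (schwartz_ft f).mul_prod ((hXi.const_mul D).mul_prod hexpi)
    refine Integrable.mono' hdom hHm.aestronglyMeasurable ?_
    have := (Measure.quasiMeasurePreserving_snd (μ := (volume : Measure (Fin N → ℝ))) (ν := η)).ae hη_mem
    filter_upwards [this] with z hz
    obtain ⟨hz1, hz2⟩ := hz
    rw [hH]
    simp only [norm_mul, Complex.norm_real]
    have k1 : ‖(P z.2.1)⁻¹‖ * ‖aT r Γ K1 z.2.1 z.1‖ ≤ D * X z.2.1 := by
      have hp0 := hP0 _ hz1
      rw [Real.norm_of_nonneg (inv_pos.2 hp0).le, inv_mul_le_iff₀ hp0, mul_comm]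
      exact haT _ hz1 _
    have k2 : ‖z.2.2 ^ (-b - 1)‖ * ‖gam z.2.2 z.1‖ ≤ Real.exp (-z.2.2) * z.2.2 ^ (-b) * (1 + nsq z.1) := by
      rw [Real.norm_of_nonneg (Real.rpow_nonneg hz2.le _), Real.norm_of_nonneg (gam_nonneg hz2 _)]
      have := gam_le hz2 zero_le_one le_rfl z.1
      rw [Real.rpow_one] at this
      calc z.2.2 ^ (-b - 1) * gam z.2.2 z.1 ≤ z.2.2 ^ (-b - 1) * (Real.exp (-z.2.2) * (z.2.2 * (1 + nsq z.1))) := by gcongr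
        _ = Real.exp (-z.2.2) * (z.2.2 ^ (-b - 1) * z.2.2) * (1 + nsq z.1) := by ring
        _ = _ := by rw [← Real.rpow_add_one hz2.ne']; ring_nf
    calc ‖(P z.2.1)⁻¹‖ * ‖aT r Γ K1 z.2.1 z.1‖ * (‖z.2.2 ^ (-b - 1)‖ * ‖gam z.2.2 z.1‖) * ‖fourierTransform f z.1‖
        ≤ (D * X z.2.1) * (Real.exp (-z.2.2) * z.2.2 ^ (-b) * (1 + nsq z.1)) * ‖fourierTransform f z.1‖ := by
          have := hX0 _ hz1
          gcongr
      _ = _ := by ring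
  set u : ((Fin n → ℝ) × ℝ) → (Fin N → ℝ) → ℂ := fun y x => fourierInv (fun ξ => H ξ y) x with hu
  have hrep : (fourierInv fun ξ => (((1 + nsq ξ) ^ b : ℝ) : ℂ) * (mult volume Γ K1 ξ * fourierTransform f ξ)) =
      ((((I * L)⁻¹ : ℝ)) : ℂ) • (fun x => ∫ y, u y x ∂η) := by
    ext x
    rw [Pi.smul_apply, smul_eq_mul, hu]
    simp only [fourierInv_eq]
    have hsw : ∫ y, (∫ ξ, ew x ξ * H ξ y) ∂η = ∫ ξ, ∫ y, ew x ξ * H ξ y ∂η := by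
      refine (integral_integral_swap ?_).symm
      exact hHint.bdd_mul (c := 1) (measurable_ew_comp (measurable_const) measurable_fst).aestronglyMeasurable (Eventually.of_forall fun z => (norm_ew _ _).le)
    rw [hsw, ← integral_const_mul]
    refine integral_congr_ae (Eventually.of_forall fun ξ => ?_)
    simp only []
    rw [integral_const_mul, hstep1]
    have : ((I * L : ℝ) : ℂ) ≠ 0 := by
      rw [Complex.ofReal_ne_zero]; positivity
    rw [Complex.ofReal_inv]
    field_simp
  have hum : AEStronglyMeasurable (fun z : (Fin N → ℝ) × ((Fin n → ℝ) × ℝ) => u z.2 z.1) ((volume : Measure (Fin N → ℝ)).prod η) := by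
    refine StronglyMeasurable.aestronglyMeasurable ?_
    rw [hu]
    simp only [fourierInv_eq]
    refine StronglyMeasurable.integral_prod_right' (f := fun q : ((Fin N → ℝ) × ((Fin n → ℝ) × ℝ)) × (Fin N → ℝ) => ew q.1.1 q.2 * H q.2 q.1.2) ?_
    refine Measurable.stronglyMeasurable ?_
    refine (measurable_ew_comp measurable_fst.fst measurable_snd).mul ?_
    exact hHm.comp (f := fun q : ((Fin N → ℝ) × ((Fin n → ℝ) × ℝ)) × (Fin N → ℝ) => (q.2, q.1.2)) (by fun_prop)
  have hbound : ∀ᵐ y ∂η, eLpNorm (u y) (ENNReal.ofReal p) volume ≤ w y * eLpNorm f (ENNReal.ofReal p) volume := by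
    filter_upwards [hη_mem] with y hy
    obtain ⟨hτ, hs0⟩ := hy
    obtain ⟨τ, s⟩ := y
    simp only at hτ hs0
    have hXp := hX0 τ hτ
    have hMp := hM0 τ hτ
    have hPp := hP0 τ hτ
    set q : (Fin N → ℝ) → ℂ := fun ξ => aT r Γ K1 τ ξ * ((gam s ξ : ℝ) : ℂ) with hq
    have hgi : Integrable (fun ξ : Fin N → ℝ => ((gam s ξ : ℝ) : ℂ)) := (integrable_gam hs0).ofReal
    have haTm : AEStronglyMeasurable (aT r Γ K1 τ) volume :=
      (haM.comp_measurable (g := fun ξ : Fin N → ℝ => (τ, ξ)) (by fun_prop)).aestronglyMeasurable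
    have hqi : Integrable q := hgi.bdd_mul (c := D * X τ * P τ) haTm (Eventually.of_forall fun ξ => haT τ hτ ξ)
    have hueq : u (τ, s) = (((P τ)⁻¹ * s ^ (-b - 1) : ℝ) : ℂ) • fourierInv (fun ξ => q ξ * fourierTransform f ξ) := by
      ext x
      rw [Pi.smul_apply, smul_eq_mul, hu]
      simp only [fourierInv_eq]
      rw [← integral_const_mul]
      refine integral_congr_ae (Eventually.of_forall fun ξ => ?_)
      simp only [hH, hq]
      push_cast; ring
    set Z : ℝ := 2 * (D * X τ * P τ * Real.exp (-s)) with hZ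
    have hZ0 : 0 < Z := by positivity
    set v : ℝ := M τ ^ (-δ') * s ^ (δ' / 2) with hv
    have hv0 : 0 < v := by positivity
    have hA : ∫⁻ x, ‖fourierInv q x‖ₑ ≤ ENNReal.ofReal Z := by
      have := mult_l1 (μ := volume.restrict (RB r τ)) hΓ hKm hK.integrableOn hgi
      refine this.trans ?_
      have e1 : ∫⁻ t in RB r τ, ‖K1 t‖ₑ ≤ ENNReal.ofReal (D * X τ * P τ) := by
        rw [← ofReal_integral_norm_eq_lintegral_enorm hK.integrableOn]
        exact ENNReal.ofReal_le_ofReal (h1 τ hτ)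
      calc (∫⁻ t in RB r τ, ‖K1 t‖ₑ) * ∫⁻ x, ‖fourierInv (fun ξ : Fin N → ℝ => ((gam s ξ : ℝ) : ℂ)) x‖ₑ
          ≤ ENNReal.ofReal (D * X τ * P τ) * ENNReal.ofReal (2 * Real.exp (-s)) := mul_le_mul' e1 (fourierInv_gam_l1 hs0)
        _ = ENNReal.ofReal Z := by
          rw [← ENNReal.ofReal_mul (by positivity)]; congr 1; rw [hZ]; ring
    have hB : ∀ ξ, ‖q ξ‖ ≤ Z * v := by
      intro ξ
      rw [hq]
      simp only [norm_mul, Complex.norm_real]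
      rw [Real.norm_of_nonneg (gam_nonneg hs0 ξ)]
      have g1 := h2 τ hτ ξ
      have g2 := gam_le hs0 (κ := δ' / 2) (by linarith) (by linarith) ξ
      have hq0 : 0 < 1 + nsq ξ := by linarith [nsq_nonneg ξ]
      calc ‖aT r Γ K1 τ ξ‖ * gam s ξ ≤ (D * X τ * P τ * ((1 + nsq ξ) ^ (-(δ' / 2)) * M τ ^ (-δ'))) *
            (Real.exp (-s) * (s * (1 + nsq ξ)) ^ (δ' / 2)) := mul_le_mul g1 g2 (gam_nonneg hs0 ξ) (by positivity)
        _ = (D * X τ * P τ * Real.exp (-s)) * v := by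
          rw [Real.mul_rpow hs0.le hq0.le, Real.rpow_neg hq0.le, hv]
          have : (1 + nsq ξ) ^ (δ' / 2) ≠ 0 := (Real.rpow_pos_of_pos hq0 _).ne'
          field_simp
        _ ≤ Z * v := by
          refine mul_le_mul_of_nonneg_right ?_ hv0.le
          rw [hZ]
          have : 0 < D * X τ * P τ * Real.exp (-s) := by positivity
          linarith
    have hmain := hintegr q f Z (Z * v) hZ0 (mul_pos hZ0 hv0) hqi hfi hfm hB hA
    have hpow : Z ^ (1 - θ) * (Z * v) ^ θ = Z * (M τ ^ (-β') * s ^ (β' / 2)) := by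
      rw [Real.mul_rpow hZ0.le hv0.le, ← mul_assoc, ← Real.rpow_add hZ0, sub_add_cancel, Real.rpow_one, hv,
        Real.mul_rpow (by positivity) (by positivity), ← Real.rpow_mul hMp.le, ← Real.rpow_mul hs0.le]
      rw [← hθ]; ring_nf
    rw [hpow] at hmain
    rw [hueq, eLpNorm_const_smul]
    refine (mul_le_mul' le_rfl hmain).trans ?_
    rw [← mul_assoc]
    refine mul_le_mul' (le_of_eq ?_) le_rfl
    rw [← ofReal_norm, Complex.norm_real, Real.norm_of_nonneg (by positivity), ← ENNReal.ofReal_mul (by positivity), hw]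
    simp only []
    rw [ENNReal.ofReal_rpow_of_pos hMp, ← ENNReal.ofReal_mul hXp.le, ← ENNReal.ofReal_mul (by positivity), ← ENNReal.ofReal_mul (by positivity)]
    congr 1
    have es : s ^ (β' / 2 - b - 1) = s ^ (-b - 1) * s ^ (β' / 2) := by
      rw [← Real.rpow_add hs0]; ring_nf
    rw [es, hZ]
    field_simp
  have hw0 : ∀ᵐ y ∂η, w y ≠ 0 ∧ w y ≠ ⊤ := by
    filter_upwards [hη_mem] with y hy
    have hXp := hX0 _ hy.1
    have hMp := hM0 _ hy.1
    have hsp := hy.2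
    rw [hw]
    simp only []
    rw [ENNReal.ofReal_rpow_of_pos hMp, ← ENNReal.ofReal_mul hXp.le, ← ENNReal.ofReal_mul (by positivity), ← ENNReal.ofReal_mul (by positivity)]
    refine ⟨?_, ENNReal.ofReal_ne_top⟩
    rw [Ne, ENNReal.ofReal_eq_zero, not_le]
    positivity
  have hmink := minkowski (μ := (volume : Measure (Fin N → ℝ))) (η := η) hp hum hwm.aemeasurable hw0 hbound
  rw [hrep, eLpNorm_const_smul, mul_assoc, ← ofReal_norm, Complex.norm_real, Real.norm_of_nonneg (by positivity)]
  exact mul_le_mul' le_rfl hmink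

end

section

lemma triangle {h x y : ℝ} (hh : 0 < h)
    (hxy : (x, y) ∈ interior (convexHull ℝ {((1 : ℝ) / 2, h), ((0 : ℝ), (0 : ℝ)), ((1 : ℝ), (0 : ℝ))})) :
    0 < y ∧ y < 2 * h * x ∧ y < 2 * h * (1 - x) := by
  set Q : Set (ℝ × ℝ) := {z | 0 ≤ z.2 ∧ z.2 ≤ 2 * h * z.1 ∧ z.2 ≤ 2 * h * (1 - z.1)} with hQ
  have hconv : Convex ℝ Q := by
    rintro ⟨x1, y1⟩ ⟨h1, h2, h3⟩ ⟨x2, y2⟩ ⟨g1, g2, g3⟩ s t hs ht hst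
    simp only at h1 h2 h3 g1 g2 g3
    refine ⟨?_, ?_, ?_⟩
    · simp; positivity
    · simp only [Prod.snd_add, Prod.smul_snd, Prod.fst_add, Prod.smul_fst, smul_eq_mul]
      nlinarith [mul_le_mul_of_nonneg_left h2 hs, mul_le_mul_of_nonneg_left g2 ht]
    · simp only [Prod.snd_add, Prod.smul_snd, Prod.fst_add, Prod.smul_fst, smul_eq_mul]
      have e : 2 * h * (1 - (s * x1 + t * x2)) = s * (2 * h * (1 - x1)) + t * (2 * h * (1 - x2)) := by
        linear_combination (-2 * h) * hst
      rw [e]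
      linarith [mul_le_mul_of_nonneg_left h3 hs, mul_le_mul_of_nonneg_left g3 ht]
  have hsub : convexHull ℝ {((1 : ℝ) / 2, h), ((0 : ℝ), (0 : ℝ)), ((1 : ℝ), (0 : ℝ))} ⊆ Q := by
    refine convexHull_min ?_ hconv
    rintro z (rfl | rfl | rfl)
    · refine ⟨hh.le, ?_, ?_⟩ <;> simp <;> linarith
    · refine ⟨le_rfl, ?_, ?_⟩ <;> simp; linarith
    · refine ⟨le_rfl, ?_, ?_⟩ <;> simp; linarith
  have hm := interior_mono hsub hxy
  have hm2 : ∀ᶠ z in 𝓝 (x, y), z ∈ Q := mem_interior_iff_mem_nhds.1 hm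
  have hc : Tendsto (fun e : ℝ => (x, y + e)) (𝓝 0) (𝓝 (x, y)) := by
    have : Continuous (fun e : ℝ => (x, y + e)) := by fun_prop
    simpa using this.tendsto 0
  obtain ⟨ε, hε, hb⟩ := Metric.eventually_nhds_iff_ball.1 (hc.eventually hm2)
  have hp := hb (ε / 2) (by simp [abs_of_pos hε]; linarith)
  have hn := hb (-(ε / 2)) (by simp [abs_of_pos hε]; linarith)
  obtain ⟨p1, p2, p3⟩ := hp
  obtain ⟨n1, n2, n3⟩ := hn
  simp only at p1 p2 p3 n1 n2 n3
  refine ⟨by linarith, by linarith, by linarith⟩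

lemma meas_ind {s : Set (Fin n → ℝ)} (hs : MeasurableSet s) {f : (Fin n → ℝ) → ℝ} (hf : ContinuousOn f s) :
    Measurable (s.indicator f) := by
  classical
  rw [← Set.piecewise_eq_indicator]
  exact hf.measurable_piecewise continuousOn_const hs

lemma ae_ne : ∀ᵐ t : Fin n → ℝ, ∀ i, t i ≠ 0 := by
  rw [ae_all_iff]
  intro i
  have := Measure.pi_hyperplane (fun _ : Fin n => (volume : Measure ℝ)) i (0:ℝ)
  rw [← volume_pi] at this
  exact measure_eq_zero_iff_ae_notMem.1 this

lemma aT_eq {S K : (Fin n → ℝ) → ℝ} {Γ : (Fin n → ℝ) → (Fin (n+1) → ℝ)} {K1 : (Fin n → ℝ) → ℂ} {r : ℝ} {τ : Fin n → ℝ}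
    (hΓ : ∀ t ∈ RB r τ, Γ t = Fin.snoc (α := fun _ => ℝ) t (S t)) (hK : ∀ t ∈ RB r τ, K1 t = (K t : ℂ)) (ξ : Fin (n+1) → ℝ) :
    aT r Γ K1 τ ξ = ∫ t in RB r τ, Complex.exp (Complex.I * (ph S (fun i => -(2 * π * ξ i.castSucc)) (-(2 * π * ξ (Fin.last n))) t : ℝ)) * (K t : ℂ) := by
  unfold aT mult
  refine setIntegral_congr_fun (isClosed_RB r τ).measurableSet fun t ht => ?_
  show ew (-ξ) (Γ t) * K1 t = _
  rw [hΓ t ht, hK t ht]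
  congr 1
  unfold ew ph
  congr 1
  rw [Fin.sum_univ_castSucc]
  simp only [Fin.snoc_castSucc, Fin.snoc_last, Pi.neg_apply]
  push_cast
  rw [mul_add, mul_add, Finset.mul_sum, Finset.mul_sum]
  congr 1
  · refine Finset.sum_congr rfl fun i _ => ?_
    ring
  · ring

lemma decay_num (ξ : Fin (n+1) → ℝ) {m δ' : ℝ} (hm : 0 < m) (hm1 : m ≤ 1) (hδ' : 0 ≤ δ') (hδ1 : δ' ≤ 1) {Q E : ℝ} (hE : 0 ≤ E)
    (h0 : Q ≤ E) (h1 : ∀ Λ > 0, (|-(2 * π * ξ (Fin.last n))| = Λ ∨ ∃ i : Fin n, |-(2 * π * ξ i.castSucc)| = Λ ∧ |-(2 * π * ξ (Fin.last n))| ≤ Λ) →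
      Q ≤ E * (Λ * m) ^ (-δ')) :
    Q ≤ ((n + 2 : ℕ) : ℝ) * E * ((1 + nsq ξ) ^ (-(δ' / 2)) * m ^ (-δ')) := by
  obtain ⟨j, hj⟩ := Finite.exists_max (fun j => |ξ j|)
  set X := |ξ j| with hX
  have hX0 : 0 ≤ X := abs_nonneg _
  have hnsq : nsq ξ ≤ (n + 1) * X ^ 2 := by
    unfold nsq
    have : ∑ i, ξ i ^ 2 ≤ ∑ i : Fin (n+1), X ^ 2 := by
      refine Finset.sum_le_sum fun i _ => ?_
      rw [← sq_abs (ξ i)]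
      exact pow_le_pow_left₀ (abs_nonneg _) (hj i) 2
    refine this.trans ?_
    simp
  have hq := nsq_nonneg ξ
  have hq0 : 0 < 1 + nsq ξ := by linarith
  have hN : (1:ℝ) ≤ ((n + 2 : ℕ) : ℝ) := by push_cast; linarith [(Nat.cast_nonneg n : (0:ℝ) ≤ n)]
  have hNp : ((n + 2 : ℕ) : ℝ) ^ (δ' / 2) ≤ ((n + 2 : ℕ) : ℝ) := by
    calc ((n + 2 : ℕ) : ℝ) ^ (δ' / 2) ≤ ((n + 2 : ℕ) : ℝ) ^ (1:ℝ) := Real.rpow_le_rpow_of_exponent_le hN (by linarith)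
      _ = _ := Real.rpow_one _
  have hmm : 0 < m ^ (-δ') := Real.rpow_pos_of_pos hm _
  have hqq : 0 < (1 + nsq ξ) ^ (δ' / 2) := Real.rpow_pos_of_pos hq0 _
  rcases lt_or_ge X 1 with hX1 | hX1
  · have a1 : 1 + nsq ξ ≤ ((n + 2 : ℕ) : ℝ) := by
      push_cast
      have : (n + 1 : ℝ) * X ^ 2 ≤ (n + 1) * 1 := by
        refine mul_le_mul_of_nonneg_left ?_ (by positivity)
        nlinarith
      linarith
    have a2 : (1 + nsq ξ) ^ (δ' / 2) ≤ ((n + 2 : ℕ) : ℝ) :=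
      (Real.rpow_le_rpow hq0.le a1 (by linarith)).trans hNp
    have a3 : 1 ≤ m ^ (-δ') := Real.one_le_rpow_of_pos_of_le_one_of_nonpos hm hm1 (by linarith)
    have a4 : 1 ≤ ((n + 2 : ℕ) : ℝ) * (1 + nsq ξ) ^ (-(δ' / 2)) := by
      rw [Real.rpow_neg hq0.le, ← div_eq_mul_inv, le_div_iff₀ hqq]; linarith
    calc Q ≤ E * (1 * 1) := by linarith
      _ ≤ E * ((((n + 2 : ℕ) : ℝ) * (1 + nsq ξ) ^ (-(δ' / 2))) * m ^ (-δ')) := by gcongr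
      _ = _ := by ring
  · have hXp : 0 < X := by linarith
    have hpi := Real.pi_pos
    have hΛ : Q ≤ E * ((2 * π * X) * m) ^ (-δ') := by
      refine h1 (2 * π * X) (by positivity) ?_
      have ab : ∀ i, |-(2 * π * ξ i)| = 2 * π * |ξ i| := by
        intro i; rw [abs_neg, abs_mul, abs_of_pos (by positivity)]
      rcases Fin.eq_castSucc_or_eq_last j with ⟨i, hi⟩ | hi
      · right
        refine ⟨i, ?_, ?_⟩
        · rw [ab, hX, hi]
        · rw [ab]
          exact mul_le_mul_of_nonneg_left (hj _) (by positivity)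
      · left; rw [ab, hX, hi]
    refine hΛ.trans ?_
    have b1 : ((2 * π * X) * m) ^ (-δ') ≤ (X * m) ^ (-δ') := by
      refine Real.rpow_le_rpow_of_nonpos (by positivity) ?_ (by linarith)
      have : X ≤ 2 * π * X := by nlinarith [Real.pi_gt_three]
      gcongr
    have b2 : 1 + nsq ξ ≤ ((n + 2 : ℕ) : ℝ) * X ^ 2 := by
      push_cast
      nlinarith
    have b3 : X ^ (-δ') ≤ ((n + 2 : ℕ) : ℝ) * (1 + nsq ξ) ^ (-(δ' / 2)) := by
      rw [Real.rpow_neg hq0.le, ← div_eq_mul_inv, le_div_iff₀ hqq, Real.rpow_neg hX0, inv_mul_le_iff₀ (Real.rpow_pos_of_pos hXp _)]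
      calc (1 + nsq ξ) ^ (δ' / 2) ≤ (((n + 2 : ℕ) : ℝ) * X ^ 2) ^ (δ' / 2) := Real.rpow_le_rpow hq0.le b2 (by linarith)
        _ = ((n + 2 : ℕ) : ℝ) ^ (δ' / 2) * X ^ δ' := by
          rw [Real.mul_rpow (by positivity) (by positivity), ← Real.rpow_natCast, ← Real.rpow_mul hX0]
          congr 2; push_cast; ring
        _ ≤ ((n + 2 : ℕ) : ℝ) * X ^ δ' := by gcongr
        _ = _ := by ring
    calc E * ((2 * π * X) * m) ^ (-δ') ≤ E * (X * m) ^ (-δ') := by gcongr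
      _ = E * (X ^ (-δ') * m ^ (-δ')) := by rw [Real.mul_rpow hX0 hm.le]
      _ ≤ E * ((((n + 2 : ℕ) : ℝ) * (1 + nsq ξ) ^ (-(δ' / 2))) * m ^ (-δ')) := by gcongr
      _ = _ := by ring

theorem main_thm
    (n m : ℕ) (hn : 0 < n) (hm : 0 < m)
    (grp : Fin n → Fin m) (hgrp : Function.Surjective grp)
    (l : Fin m → ℕ) (hl : ∀ k, l k = (Finset.univ.filter (fun i => grp i = k)).card)
    (a : Fin m → ℝ) (ha : ∀ k, 0 ≤ a k ∧ a k < l k)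
    (S : (Fin n → ℝ) → ℝ) (c : (Fin n → ℕ) → ℝ)
    (hSc : HasTaylorSeriesAtOrigin S c) (hc : c ≠ 0)
    (hS0 : S 0 = 0) (hS1 : fderiv ℝ S 0 = 0)
    (a₀ : ℝ) (d₀ : ℕ) (ha₀ : IsSublevelExponent grp a c a₀ d₀)
    (oS : ℕ) (hoS : newtonOrder c = (oS : ℕ∞))
    (g : ℝ) (hg : g = min a₀ (⨅ k, ((l k : ℝ) - a k))) :
    ∃ V ∈ 𝓝 (0 : Fin n → ℝ), ∀ K : (Fin n → ℝ) → ℝ,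
      Function.support K ⊆ V → KernelBounds grp a K →
      ∀ p β : ℝ,
        (1 / p, β) ∈ interior (convexHull ℝ
          {((1 : ℝ) / 2, 1 / max (oS : ℝ) 2), ((0 : ℝ), (0 : ℝ)), ((1 : ℝ), (0 : ℝ))}) →
        β < g →
        BddLpSobolev p β (radonOp S K) := by
  obtain ⟨R, hR⟩ := exists_goodR hSc
  have hc2 : ∀ α, c α ≠ 0 → 2 ≤ ∑ i, α i := by
    intro α hα
    by_contra hlt
    rcases deg_cases α (by omega) with rfl | ⟨j, rfl⟩
    · exact hα (c_zero hR hS0)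
    · exact hα (c_single hR hS0 hS1 j)
  obtain ⟨A, hA1, hA⟩ := exists_minimal c
  have hAne : A.Nonempty := by
    obtain ⟨α, hα⟩ := Function.ne_iff.1 hc
    obtain ⟨b, hb, -⟩ := hA α hα
    exact ⟨b, hb⟩
  obtain ⟨δ1, hδ1, hδ11, hδ1R, r, hr, hr1, C1, hC1, hdec⟩ :=
    decay hn grp hgrp (fun k => (ha k).1) hoS (k0 := max oS 2) rfl hR hA1 hA hAne hc2
  obtain ⟨δ0, hδ0, hintm⟩ := int_main grp hgrp hn l hl a ha ha₀ (σ := sig A) (measurable_sig A)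
    (fun t ht => sig_pos hAne ht) (fun t _ => starFn_le hA1 hA t) (fun t => sig_abs A t)
  set δ := min δ1 δ0 with hδ
  have hδp : 0 < δ := lt_min hδ1 hδ0
  have hδδ1 : δ ≤ δ1 := min_le_left _ _
  have hδr : δ * r < δ := by nlinarith
  refine ⟨{t | ∀ i, |t i| < δ * r}, ?_, ?_⟩
  · have ho : IsOpen {t : Fin n → ℝ | ∀ i, |t i| < δ * r} := by
      have : {t : Fin n → ℝ | ∀ i, |t i| < δ * r} = ⋂ i, {t | |t i| < δ * r} := by ext; simp
      rw [this]
      exact isOpen_iInter_of_finite fun i => isOpen_lt (by fun_prop) continuous_const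
    refine ho.mem_nhds fun i => ?_
    simp; positivity
  intro K hKs hKb p β hpβ hβg
  obtain ⟨hKd, C', hC'⟩ := hKb
  set C := |C'| + 1 with hC
  have hC0 : 0 < C := by positivity
  have hCC : C' ≤ C := by linarith [le_abs_self C']
  have hKC : ∀ t : Fin n → ℝ, (∀ i, t i ≠ 0) → |K t| ≤ C * kernelWeight grp a t ∧
        ∀ i : Fin n, |fderiv ℝ K t (Pi.single i 1)| ≤ C / |t i| * kernelWeight grp a t := by
    intro t ht
    have hk := kernelWeight_nonneg grp a t
    refine ⟨(hC' t ht).1.trans (by gcongr), fun i => ((hC' t ht).2 i).trans (by gcongr)⟩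
  -- exponents
  have hmx : (0:ℝ) < 1 / max (oS : ℝ) 2 := by positivity
  have hmx2 : (1:ℝ) / max (oS : ℝ) 2 ≤ 1 / 2 := one_div_le_one_div_of_le (by norm_num) (le_max_right _ _)
  set h : ℝ := 1 / max (oS : ℝ) 2 with hh
  obtain ⟨hβ0, hβ1, hβ2⟩ := triangle hmx hpβ
  have hx0 : 0 < 1 / p := by
    by_contra hcon
    push Not at hcon
    nlinarith
  have hx1 : 1 / p < 1 := by
    by_contra hcon
    push Not at hcon
    nlinarith
  have hp0 : 0 < p := by simpa using hx0
  have hp : 1 < p := by rwa [div_lt_one hp0] at hx1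
  set θ := 2 * min (1 / p) (1 - 1 / p) with hθ
  have hθ0 : 0 < θ := by
    have : 0 < min (1 / p) (1 - 1 / p) := lt_min hx0 (by linarith)
    linarith
  have hθ1 : θ ≤ 1 := by
    have h1 := min_le_left (1 / p) (1 - 1 / p)
    have h2 := min_le_right (1 / p) (1 - 1 / p)
    linarith
  have hβθ : β < h * θ := by
    rw [hθ]
    rcases min_choice (1 / p) (1 - 1 / p) with e | e <;> rw [e] <;> linarith
  obtain ⟨β', hββ', hβ'⟩ := exists_between (lt_min hβg hβθ)
  have hβ'g := hβ'.trans_le (min_le_left _ _)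
  have hβ'θ := hβ'.trans_le (min_le_right _ _)
  have hβ'1 : β' < 1 := by nlinarith
  have hβ'0 : 0 < β' := hβ0.trans hββ'
  set δ' := β' / θ with hδ'
  have hδ'0 : 0 ≤ δ' := by positivity
  have hδ'h : δ' ≤ h := by rw [hδ', div_le_iff₀ hθ0]; exact hβ'θ.le
  have hδ'θ : δ' * θ = β' := by rw [hδ']; field_simp
  -- the modified data
  set U : Set (Fin n → ℝ) := {t | ∀ i, t i ≠ 0} with hU
  have hUm : MeasurableSet U := by
    have : U = ⋂ i, {t | t i ≠ 0} := by ext; simp [hU]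
    rw [this]
    refine MeasurableSet.iInter fun i => ?_
    have hmi : Measurable (fun t : Fin n → ℝ => t i) := measurable_pi_apply i
    exact hmi (measurableSet_singleton (0:ℝ)).compl
  set W : Set (Fin n → ℝ) := {t | ∀ i, |t i| ≤ R} with hW
  have hWm : MeasurableSet W := by
    have : W = ⋂ i, {t | |t i| ≤ R} := by ext; simp [hW]
    rw [this]
    refine MeasurableSet.iInter fun i => ?_
    exact measurableSet_le (by fun_prop) measurable_const
  set K1 : (Fin n → ℝ) → ℂ := fun t => ((U.indicator K t : ℝ) : ℂ) with hK1
  set S1 : (Fin n → ℝ) → ℝ := W.indicator S with hS1'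
  have hS1m : Measurable S1 := meas_ind hWm (S_cont hR)
  have hK1m : Measurable K1 := Complex.measurable_ofReal.comp (meas_ind hUm hKd.continuousOn)
  set Γ : (Fin n → ℝ) → (Fin (n+1) → ℝ) := fun t => Fin.snoc (α := fun _ => ℝ) t (S1 t) with hΓ
  have hΓm : Measurable Γ := by
    refine measurable_pi_lambda _ fun j => ?_
    refine Fin.lastCases ?_ (fun i => ?_) j
    · simp only [hΓ, Fin.snoc_last]; exact hS1m
    · simp only [hΓ, Fin.snoc_castSucc]; exact measurable_pi_apply i
  have hK1s : ∀ t, K1 t ≠ 0 → t ∈ pbox n (δ * r) := by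
    intro t ht i
    have h1 : U.indicator K t ≠ 0 := by
      intro h0; apply ht; simp [hK1, h0]
    have h2 := mem_of_indicator_ne_zero h1
    rw [indicator_of_mem h2] at h1
    exact ⟨abs_pos.2 (h2 i), hKs h1 i⟩
  have hK1n : ∀ t, ‖K1 t‖ ≤ C * kernelWeight grp a t := by
    intro t
    simp only [hK1, Complex.norm_real]
    by_cases ht : t ∈ U
    · rw [indicator_of_mem ht]; exact (hKC t ht).1
    · rw [indicator_of_notMem ht, norm_zero]
      exact mul_nonneg hC0.le (kernelWeight_nonneg grp a t)
  have hkwm := measurable_kernelWeight grp a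
  have hXfin : ∫⁻ τ in pbox n δ, ENNReal.ofReal (kernelWeight grp a τ) < ⊤ :=
    even_lint (fun t => by rw [kernelWeight_abs]) (int_kw grp hgrp hn l hl a ha hδp)
  have hK1i : Integrable K1 := by
    refine ⟨hK1m.aestronglyMeasurable, ?_⟩
    have e : ∫⁻ t, ‖K1 t‖ₑ ≤ ∫⁻ t in pbox n δ, ENNReal.ofReal C * ENNReal.ofReal (kernelWeight grp a t) := by
      rw [← lintegral_indicator (measurableSet_pbox n δ)]
      refine lintegral_mono fun t => ?_
      by_cases ht : K1 t = 0
      · simp [ht]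
      · have : t ∈ pbox n δ := fun i => ⟨(hK1s t ht i).1, (hK1s t ht i).2.trans hδr⟩
        rw [indicator_of_mem this, ← ENNReal.ofReal_mul hC0.le, ← ofReal_norm]
        exact ENNReal.ofReal_le_ofReal (hK1n t)
    refine lt_of_le_of_lt e ?_
    rw [lintegral_const_mul _ hkwm.ennreal_ofReal]
    exact ENNReal.mul_lt_top ENNReal.ofReal_lt_top hXfin
  have hne : ∀ τ ∈ pbox n δ, ∀ i, τ i ≠ 0 := fun τ hτ i => abs_pos.1 (hτ i).1
  have hMm : Measurable (mmin (sig A)) := by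
    unfold mmin
    refine Measurable.min ?_ (measurable_sig A)
    exact Measurable.iInf fun i => by fun_prop
  set ρ := r ^ (-∑ k, a k) with hρ
  have hρ0 : 0 < ρ := Real.rpow_pos_of_pos hr _
  set D : ℝ := ((n + 2 : ℕ) : ℝ) * (C1 * C) + C * ρ * 3 ^ n with hD
  have hD0 : 0 < D := by positivity
  have hcore := core hr hr1 hδp hΓm hK1m hK1i hK1s hkwm hMm
    (fun τ hτ => kernelWeight_pos grp hgrp a (hne τ hτ)) (fun τ hτ => mmin_pos hn hAne (hne τ hτ)) hD0
    (p := p) (β := β) (β' := β') (δ' := δ') ?_ hp hβ0 hββ' (by linarith) hδ'0 (by linarith) hδ'θ ?_ hXfin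
    (hintm δ hδp (min_le_right _ _) β' hβ'0 hβ'1 (by rw [← hg]; exact hβ'g))
  · obtain ⟨CF, hCF0, hCF⟩ := hcore
    refine ⟨CF, hCF0, fun f => ?_⟩
    have hfi : Integrable f := f.integrable
    have e1 : radonOp S K f = fun x => ∫ t, K1 t * f (x - Γ t) := by
      ext x
      unfold radonOp
      refine integral_congr_ae ?_
      filter_upwards [ae_ne (n := n)] with t ht
      simp only [hK1]
      rw [indicator_of_mem (show t ∈ U from ht)]
      by_cases h0 : K t = 0
      · simp [h0]
      · have htW : t ∈ W := fun i => ((hKs h0 i).trans (hδr.trans_le (hδδ1.trans hδ1R))).le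
        have : Γ t = Fin.snoc (α := fun _ => ℝ) t (S t) := by
          simp only [hΓ, hS1']; rw [indicator_of_mem htW]
        rw [this]
        rfl
    have e2 : besselPotential β (radonOp S K f) = fourierInv fun ξ => (((1 + nsq ξ) ^ (β / 2) : ℝ) : ℂ) * (mult volume Γ K1 ξ * fourierTransform f ξ) := by
      ext x
      unfold besselPotential
      congr 1
      ext ξ
      rw [e1, mult_conv_ft hΓm hK1i hfi f.continuous.measurable]
      rfl
    rw [e2]
    exact hCF f
  · intro τ hτ
    have hk := kernelWeight_pos grp hgrp a (hne τ hτ)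
    have hP : 0 < ∏ i, |τ i| := Finset.prod_pos fun i _ => (hτ i).1
    have hvol : volume (RB r τ) ≤ ENNReal.ofReal (3 ^ n * ∏ i, |τ i|) := by
      rw [← volume_box3 (hne τ hτ)]
      refine measure_mono fun t ht i => ?_
      have := ht i
      exact ⟨by linarith [this.1], by linarith [this.2]⟩
    have hb := norm_setIntegral_le_of_norm_le_const (μ := volume) (s := RB r τ) (f := fun t => ‖K1 t‖) (C := C * (ρ * kernelWeight grp a τ))
      (lt_of_le_of_lt hvol ENNReal.ofReal_lt_top) (fun t ht => by
        rw [norm_norm]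
        exact (hK1n t).trans (mul_le_mul_of_nonneg_left (kw_RB grp hgrp (fun k => (ha k).1) hr (hne τ hτ) ht) hC0.le))
    have hvr : volume.real (RB r τ) ≤ 3 ^ n * ∏ i, |τ i| := ENNReal.toReal_le_of_le_ofReal (by positivity) hvol
    refine (le_abs_self _).trans (hb.trans ?_)
    calc C * (ρ * kernelWeight grp a τ) * volume.real (RB r τ) ≤ C * (ρ * kernelWeight grp a τ) * (3 ^ n * ∏ i, |τ i|) := by gcongr
      _ = (C * ρ * 3 ^ n) * (kernelWeight grp a τ * ∏ i, |τ i|) := by ring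
      _ ≤ D * (kernelWeight grp a τ * ∏ i, |τ i|) := by
        refine mul_le_mul_of_nonneg_right ?_ (by positivity)
        rw [hD]
        have : 0 < ((n + 2 : ℕ) : ℝ) * (C1 * C) := by positivity
        linarith
      _ = _ := by ring
  · intro τ hτ ξ
    have hk := kernelWeight_pos grp hgrp a (hne τ hτ)
    have hP : 0 < ∏ i, |τ i| := Finset.prod_pos fun i _ => (hτ i).1
    have hτ1 : ∀ i, 0 < |τ i| ∧ |τ i| < δ1 := fun i => ⟨(hτ i).1, (hτ i).2.trans_le hδδ1⟩
    have hm0 := mmin_pos hn hAne (hne τ hτ)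
    have hm1 : mmin (sig A) τ ≤ 1 := (mmin_le_abs _ τ ⟨0, hn⟩).trans ((hτ1 ⟨0, hn⟩).2.le.trans hδ11)
    have heq := aT_eq (S := S) (K := K) (Γ := Γ) (K1 := K1) (r := r) (τ := τ) (fun t ht => by
        have htW : t ∈ W := fun i => ((RB_small (R := R) hr hτ1 ht i).trans_le hδ1R).le
        simp only [hΓ, hS1']; rw [indicator_of_mem htW])
      (fun t ht => by
        have htU : t ∈ U := fun i => RB_ne hr ht i
        simp only [hK1]; rw [indicator_of_mem htU]) ξ
    obtain ⟨d1, d2⟩ := hdec K C hKd hC0.le hKC τ hτ1 (fun i => -(2 * π * ξ i.castSucc)) (-(2 * π * ξ (Fin.last n)))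
    rw [← heq] at d1 d2
    have hk0 : δ' ≤ 1 / ((max oS 2 : ℕ) : ℝ) := by push_cast; exact hδ'h
    have hfin := decay_num ξ hm0 hm1 hδ'0 (by linarith) (by positivity) d1 (fun Λ hΛ hd => d2 Λ hΛ hd δ' hδ'0 hk0)
    refine hfin.trans ?_
    have hns : 0 < 1 + nsq ξ := by linarith [nsq_nonneg ξ]
    have hG : 0 < (1 + nsq ξ) ^ (-(δ' / 2)) * mmin (sig A) τ ^ (-δ') := by positivity
    refine mul_le_mul_of_nonneg_right ?_ hG.le
    calc ((n + 2 : ℕ) : ℝ) * (C1 * (C * kernelWeight grp a τ * ∏ i, |τ i|)) = (((n + 2 : ℕ) : ℝ) * (C1 * C)) * (kernelWeight grp a τ * ∏ i, |τ i|) := by ring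
      _ ≤ D * (kernelWeight grp a τ * ∏ i, |τ i|) := by
        refine mul_le_mul_of_nonneg_right ?_ (by positivity)
        rw [hD]
        have : 0 < C * ρ * 3 ^ n := by positivity
        linarith
      _ = _ := by ring

end

/-- **Theorem 1.1, part 1.** There is a neighborhood `V` of the origin such that
whenever the kernel `K` is supported in `V` and satisfies the bounds (1.2a)-(1.2b),
the operator `T` is bounded from `L^p(ℝ^{n+1})` to `L^p_β(ℝ^{n+1})` for every `(1/p, β)`
in the set `B = {(x,y) ∈ A : y < g}`, where `A` is the open triangle with vertices
`(1/2, 1/max(o(S),2))`, `(0,0)`, `(1,0)` and `g = min(a₀, l₁-α₁, ..., l_m-α_m)`. -/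
theorem theorem_1_1_part1
    (n m : ℕ) (hn : 0 < n) (hm : 0 < m)
    (grp : Fin n → Fin m) (hgrp : Function.Surjective grp)
    (l : Fin m → ℕ) (hl : ∀ k, l k = (Finset.univ.filter (fun i => grp i = k)).card)
    (a : Fin m → ℝ) (ha : ∀ k, 0 ≤ a k ∧ a k < l k)
    (S : (Fin n → ℝ) → ℝ) (c : (Fin n → ℕ) → ℝ)
    (hSc : HasTaylorSeriesAtOrigin S c) (hc : c ≠ 0)
    (hS0 : S 0 = 0) (hS1 : fderiv ℝ S 0 = 0)
    (a₀ : ℝ) (d₀ : ℕ) (ha₀ : IsSublevelExponent grp a c a₀ d₀)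
    (oS : ℕ) (hoS : newtonOrder c = (oS : ℕ∞))
    (g : ℝ) (hg : g = min a₀ (⨅ k, ((l k : ℝ) - a k))) :
    ∃ V ∈ 𝓝 (0 : Fin n → ℝ), ∀ K : (Fin n → ℝ) → ℝ,
      Function.support K ⊆ V → KernelBounds grp a K →
      ∀ p β : ℝ,
        (1 / p, β) ∈ interior (convexHull ℝ
          {((1 : ℝ) / 2, 1 / max (oS : ℝ) 2), ((0 : ℝ), (0 : ℝ)), ((1 : ℝ), (0 : ℝ))}) →
        β < g →
        BddLpSobolev p β (radonOp S K) := by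
  exact main_thm n m hn hm grp hgrp l hl a ha S c hSc hc hS0 hS1 a₀ d₀ ha₀ oS hoS g hg

end Paper
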